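/- Let α ∈ (0,1) be a Liouville number. For every lift g of an orientation-preserving C^∞ circle diffeomorphism with rotation number ρ(g) = α, every r ∈ ℕ and every ε > 0, there exists a lift f of an orientation-preserving C^∞ circle diffeomorphism with rotation number ρ(f) = α such that d_r(f, g) < ε and the circle diffeomorphism induced by f admits an invariant σ-finite infinite Borel measure equivalent to the Lebesgue measure m but admits no invariant finite Borel measure equivalent to m (i.e. it is of type II_∞). -/

import Mathlib

noncomputable section
open MeasureTheory Filter Topology

/-- A lift of an orientation-preserving `C^∞` circle diffeomorphism: a `C^∞` map
`f : ℝ → ℝ` with `f (x+1) = f x + 1` and everywhere positive derivative. -/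
def IsCircleDiffeoLift (f : ℝ → ℝ) : Prop :=
  ContDiff ℝ (⊤ : ℕ∞) f ∧ (∀ x : ℝ, f (x + 1) = f x + 1) ∧ ∀ x : ℝ, 0 < deriv f x

/-- The `C^r` norm `‖φ‖_r = max_{0 ≤ i ≤ r} sup_x |φ^{(i)}(x)|`. -/
def CrNorm (r : ℕ) (φ : ℝ → ℝ) : ℝ :=
  (Finset.range (r + 1)).sup' (Finset.nonempty_range_iff.mpr r.succ_ne_zero)
    fun i => ⨆ x : ℝ, |iteratedDeriv i φ x|

/-- `d_r(f, g) = max {‖f - g‖_r, ‖f⁻¹ - g⁻¹‖_r}`. -/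
def liftDist (r : ℕ) (f g : ℝ → ℝ) : ℝ :=
  max (CrNorm r (fun x => f x - g x))
    (CrNorm r (fun x => Function.invFun f x - Function.invFun g x))

/-- `|f|_r = max {‖f - id‖_r, ‖f⁻¹ - id‖_r, 1}`. -/
def liftNorm (r : ℕ) (f : ℝ → ℝ) : ℝ :=
  max (max (CrNorm r (fun x => f x - x)) (CrNorm r (fun x => Function.invFun f x - x))) 1

/-- The lift `x ↦ x + a` of the rotation by `a`. -/
def RotLift (a : ℝ) : ℝ → ℝ := fun x => x + a

/-- The rotation number of the circle diffeomorphism induced by the lift `f` equals `a`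
(mod 1): the translation number `lim (fⁿ(0) - 0)/n` equals `a + k` for some integer `k`. -/
def HasRotationNumber (f : ℝ → ℝ) (a : ℝ) : Prop :=
  ∃ k : ℤ, Tendsto (fun n : ℕ => f^[n] 0 / (n : ℝ)) atTop (nhds (a + k))

/-- The lift of the `i`-th iterate (`i ∈ ℤ`) of the circle diffeomorphism induced by `f`. -/
def zpowLift (f : ℝ → ℝ) : ℤ → ℝ → ℝ := fun i =>
  if 0 ≤ i then f^[i.toNat] else (Function.invFun f)^[(-i).toNat]

/-- The ratio set of a circle diffeomorphism, described through the family `Fz i` of its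
iterates (`i ∈ ℤ`) and the family `D i` of the derivatives of its iterates: `t ≥ 0` lies in
the ratio set iff for every Borel `A` of positive Haar measure and every `ε > 0` there are a
Borel `B ⊆ A` of positive measure and `i ∈ ℤ` with `Fz i '' B ⊆ A` and `|D i x - t| < ε`
on `B`. -/
def ratioSet (Fz : ℤ → UnitAddCircle → UnitAddCircle) (D : ℤ → UnitAddCircle → ℝ) : Set ℝ :=
  {t : ℝ | 0 ≤ t ∧ ∀ A : Set UnitAddCircle, MeasurableSet A → 0 < volume A →
    ∀ ε : ℝ, 0 < ε → ∃ B : Set UnitAddCircle, MeasurableSet B ∧ B ⊆ A ∧ 0 < volume B ∧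
      ∃ i : ℤ, Fz i '' B ⊆ A ∧ ∀ x ∈ B, |D i x - t| < ε}

/-- A lift of an orientation-preserving `C¹` circle diffeomorphism. -/
def IsC1CircleLift (f : ℝ → ℝ) : Prop :=
  ContDiff ℝ 1 f ∧ (∀ x : ℝ, f (x + 1) = f x + 1) ∧ ∀ x : ℝ, 0 < deriv f x

/-- Smoothness of a real function. -/
abbrev Sm (f : ℝ → ℝ) : Prop := ContDiff ℝ (⊤ : ℕ∞) f

/-- The derivatives of `f` at `x` up to order `n` are bounded by `C`. -/
def JB (n : ℕ) (C : ℝ) (f : ℝ → ℝ) (x : ℝ) : Prop := ∀ i ≤ n, |iteratedDeriv i f x| ≤ C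

lemma Sm.nat {f : ℝ → ℝ} (hf : Sm f) (n : ℕ) : ContDiff ℝ n f :=
  hf.of_le (by exact_mod_cast le_top)

lemma Sm.differentiable' {f : ℝ → ℝ} (hf : Sm f) : Differentiable ℝ f :=
  (hf.nat 1).differentiable (by simp)

lemma Sm.hasDerivAt {f : ℝ → ℝ} (hf : Sm f) (x : ℝ) : HasDerivAt f (deriv f x) x :=
  (hf.differentiable' x).hasDerivAt

lemma Sm.deriv {f : ℝ → ℝ} (hf : Sm f) : Sm (deriv f) := by
  have := hf
  rw [Sm, contDiff_infty_iff_deriv] at this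
  exact this.2

lemma Sm.iteratedDeriv {f : ℝ → ℝ} (hf : Sm f) (n : ℕ) : Sm (iteratedDeriv n f) := by
  induction n with
  | zero => simpa using hf
  | succ n ih => rw [iteratedDeriv_succ]; exact ih.deriv

lemma JB.mono {n m : ℕ} {C D : ℝ} {f : ℝ → ℝ} {x : ℝ} (h : JB n C f x) (hm : m ≤ n)
    (hC : C ≤ D) : JB m D f x := fun i hi => (h i (hi.trans hm)).trans hC

lemma JB.nonneg {n : ℕ} {C : ℝ} {f : ℝ → ℝ} {x : ℝ} (h : JB n C f x) : 0 ≤ C :=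
  (abs_nonneg _).trans (h 0 n.zero_le)

lemma JB.apply {n : ℕ} {C : ℝ} {f : ℝ → ℝ} {x : ℝ} (h : JB n C f x) : |f x| ≤ C := by
  simpa using h 0 n.zero_le

lemma JB_zero {C : ℝ} {f : ℝ → ℝ} {x : ℝ} : JB 0 C f x ↔ |f x| ≤ C := by
  simp [JB]

lemma JB_succ {n : ℕ} {C : ℝ} {f : ℝ → ℝ} {x : ℝ} :
    JB (n + 1) C f x ↔ |f x| ≤ C ∧ JB n C (deriv f) x := by
  constructor
  · intro h
    refine ⟨h.apply, fun i hi => ?_⟩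
    rw [← iteratedDeriv_succ']
    exact h _ (by omega)
  · rintro ⟨h0, h⟩ i hi
    cases i with
    | zero => simpa using h0
    | succ i => rw [iteratedDeriv_succ']; exact h i (by omega)

lemma JB.add {n : ℕ} {C D : ℝ} {f g : ℝ → ℝ} {x : ℝ} (hf : Sm f) (hg : Sm g)
    (h1 : JB n C f x) (h2 : JB n D g x) : JB n (C + D) (fun y => f y + g y) x := by
  intro i hi
  rw [iteratedDeriv_fun_add (hf.nat i).contDiffAt (hg.nat i).contDiffAt]
  exact (abs_add_le _ _).trans (add_le_add (h1 i hi) (h2 i hi))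

lemma JB.sub {n : ℕ} {C D : ℝ} {f g : ℝ → ℝ} {x : ℝ} (hf : Sm f) (hg : Sm g)
    (h1 : JB n C f x) (h2 : JB n D g x) : JB n (C + D) (fun y => f y - g y) x := by
  intro i hi
  rw [iteratedDeriv_fun_sub (hf.nat i).contDiffAt (hg.nat i).contDiffAt]
  exact (abs_sub _ _).trans (add_le_add (h1 i hi) (h2 i hi))

lemma JB.neg {n : ℕ} {C : ℝ} {f : ℝ → ℝ} {x : ℝ}
    (h1 : JB n C f x) : JB n C (fun y => - f y) x := by
  intro i hi
  rw [iteratedDeriv_fun_neg]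
  simpa using h1 i hi

lemma JB.const_mul {n : ℕ} {C c D : ℝ} {f : ℝ → ℝ} {x : ℝ} (hc : |c| ≤ D)
    (h1 : JB n C f x) : JB n (D * C) (fun y => c * f y) x := by
  intro i hi
  rw [iteratedDeriv_const_mul_field, abs_mul]
  exact mul_le_mul hc (h1 i hi) (abs_nonneg _) ((abs_nonneg _).trans hc)

lemma JB_const (n : ℕ) (c x : ℝ) : JB n |c| (fun _ => c) x := by
  intro i hi
  rw [iteratedDeriv_const]
  split_ifs <;> simp

lemma JB.mul {n : ℕ} {C D : ℝ} {f g : ℝ → ℝ} {x : ℝ} (hf : Sm f) (hg : Sm g)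
    (h1 : JB n C f x) (h2 : JB n D g x) : JB n (2 ^ n * (C * D)) (fun y => f y * g y) x := by
  intro i hi
  have := norm_iteratedFDeriv_mul_le (𝕜 := ℝ) (hf.nat i) (hg.nat i) x (n := i) le_rfl
  simp only [norm_iteratedFDeriv_eq_norm_iteratedDeriv, Real.norm_eq_abs] at this
  refine this.trans ?_
  calc _ ≤ ∑ j ∈ Finset.range (i + 1), (i.choose j : ℝ) * (C * D) := by
        refine Finset.sum_le_sum fun j hj => ?_
        rw [Finset.mem_range] at hj
        rw [mul_assoc]
        gcongr
        · exact h1.nonneg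
        · exact h1 j (by omega)
        · exact h2 _ (by omega)
    _ = 2 ^ i * (C * D) := by
        rw [← Finset.sum_mul]; congr 1; exact_mod_cast Nat.sum_range_choose i
    _ ≤ _ := by
        have := h1.nonneg; have := h2.nonneg
        gcongr
        norm_num

lemma JB.comp {n : ℕ} {C D : ℝ} {f g : ℝ → ℝ} {x : ℝ} (hg : Sm g) (hf : Sm f) (hD : 1 ≤ D)
    (h1 : JB n C g (f x)) (h2 : ∀ i, 1 ≤ i → i ≤ n → |iteratedDeriv i f x| ≤ D) :
    JB n (n.factorial * C * D ^ n) (fun y => g (f y)) x := by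
  intro i hi
  have := norm_iteratedFDeriv_comp_le (𝕜 := ℝ) (g := g) (f := f) (hg.nat i) (hf.nat i)
    (n := i) le_rfl x
    (C := C) (D := D) (fun j hj => ?_) (fun j hj1 hj => ?_)
  · rw [norm_iteratedFDeriv_eq_norm_iteratedDeriv] at this
    refine this.trans ?_
    have := h1.nonneg
    gcongr
  · rw [norm_iteratedFDeriv_eq_norm_iteratedDeriv]; exact h1 j (hj.trans hi)
  · rw [norm_iteratedFDeriv_eq_norm_iteratedDeriv]
    exact (h2 j hj1 (hj.trans hi)).trans (le_self_pow₀ hD (by omega))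

lemma JB.sum {ι : Type*} {n : ℕ} {C : ι → ℝ} {s : Finset ι} {f : ι → ℝ → ℝ} {x : ℝ}
    (hf : ∀ i ∈ s, Sm (f i)) (h : ∀ i ∈ s, JB n (C i) (f i) x) :
    JB n (∑ i ∈ s, C i) (fun y => ∑ i ∈ s, f i y) x := by
  intro k hk
  rw [iteratedDeriv_fun_sum fun i hi => ((hf i hi).nat k).contDiffAt]
  exact (Finset.abs_sum_le_sum_abs _ _).trans (Finset.sum_le_sum fun i hi => h i hi k hk)

lemma JB_inv (n : ℕ) (c C : ℝ) (hc : 0 < c) : ∃ K, 0 ≤ K ∧ ∀ (f : ℝ → ℝ) (x : ℝ), Sm f →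
    (∀ y, f y ≠ 0) → JB n C f x → c ≤ |f x| → JB n K (fun y => (f y)⁻¹) x := by
  induction n with
  | zero =>
    refine ⟨c⁻¹, by positivity, fun f x _ _ _ h => ?_⟩
    rw [JB_zero, abs_inv]
    gcongr
  | succ n ih =>
    obtain ⟨K, hK, H⟩ := ih
    refine ⟨max c⁻¹ (2 ^ n * (C * (2 ^ n * (K * K)))), by positivity, fun f x hf h0 hJ h => ?_⟩
    rw [JB_succ]
    refine ⟨?_, ?_⟩
    · rw [abs_inv]; exact le_max_of_le_left (by gcongr)
    have hi : Sm (fun y => (f y)⁻¹) := ContDiff.inv hf h0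
    have e : deriv (fun y => (f y)⁻¹) = fun y => - (deriv f y * ((f y)⁻¹ * (f y)⁻¹)) := by
      ext y
      rw [((hf.hasDerivAt y).fun_inv (h0 y)).deriv]
      field_simp
    rw [e]
    have hJ' := JB_succ.1 hJ
    have h1 := H f x hf h0 (hJ.mono n.le_succ le_rfl) h
    exact ((hJ'.2.mul hf.deriv (hi.mul hi) (h1.mul hi hi h1)).neg).mono le_rfl (le_max_right _ _)

lemma abs_comp_add_sub_le {I : ℝ → ℝ} {a b C : ℝ} (hI : Sm I)
    (hY : ∀ s ∈ Set.Icc (0 : ℝ) 1, |deriv I (a + s * b)| ≤ C) :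
    |I (a + b) - I a| ≤ C * |b| := by
  have hφ : ∀ s ∈ Set.Icc (0 : ℝ) 1, HasDerivWithinAt (fun s => I (a + s * b))
      (deriv I (a + s * b) * b) (Set.Icc 0 1) s := by
    intro s hs
    have h2 : HasDerivAt (fun s => a + s * b) b s := by
      simpa using ((hasDerivAt_id s).mul_const b).const_add a
    exact ((hI.hasDerivAt (a + s * b)).comp s h2).hasDerivWithinAt
  have := (convex_Icc (0:ℝ) 1).norm_image_sub_le_of_norm_hasDerivWithin_le (C := C * |b|) hφ
    (fun s hs => by
      rw [norm_mul]
      exact mul_le_mul_of_nonneg_right (hY s hs) (abs_nonneg _))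
    (x := 0) (y := 1) (by simp) (by simp)
  simpa using this

/-- A difference estimate for composition with a small displacement. -/
lemma JB_comp_sub (k : ℕ) (C : ℝ) : ∃ K, 0 ≤ K ∧ ∀ (I u e : ℝ → ℝ) (w η : ℝ), Sm I → Sm u →
    Sm e → η ≤ 1 → (∀ s ∈ Set.Icc (0 : ℝ) 1, JB k C (deriv I) (u w + s * e w)) →
    (∀ i, 1 ≤ i → i ≤ k → |iteratedDeriv i u w| ≤ C) → JB k η e w →
    JB k (K * η) (fun y => I (u y + e y) - I (u y)) w := by
  induction k with
  | zero =>
    refine ⟨|C|, abs_nonneg _, fun I u e w η hI hu he h1 hY hu' he' => ?_⟩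
    rw [JB_zero]
    have := abs_comp_add_sub_le hI fun s hs => (hY s hs).apply
    exact this.trans (mul_le_mul (le_abs_self C) he'.apply (abs_nonneg _) (abs_nonneg _))
  | succ k ih =>
    obtain ⟨K, hK, H⟩ := ih
    refine ⟨|C| + (2 ^ k * (K * (|C| + 1)) + 2 ^ k * (k.factorial * |C| * (|C| + 1) ^ k)),
      by positivity, fun I u e w η hI hu he h1 hY hu' he' => ?_⟩
    have hη := he'.nonneg
    have hIu : Sm (fun y => I (u y + e y)) := hI.comp (hu.add he)
    have hIu2 : Sm (fun y => I (u y)) := hI.comp hu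
    rw [JB_succ]
    have hd : deriv (fun y => I (u y + e y) - I (u y)) = fun y =>
        (deriv I (u y + e y) - deriv I (u y)) * (deriv u y + deriv e y) +
          deriv I (u y) * deriv e y := by
      ext y
      have a1 : HasDerivAt (fun y => I (u y + e y)) _ y :=
        (hI.hasDerivAt (u y + e y)).comp y ((hu.hasDerivAt y).add (he.hasDerivAt y))
      have a2 : HasDerivAt (fun y => I (u y)) _ y := (hI.hasDerivAt (u y)).comp y (hu.hasDerivAt y)
      rw [(a1.fun_sub a2).deriv]
      ring
    refine ⟨?_, ?_⟩
    · have h2 := abs_comp_add_sub_le hI fun s hs => (hY s hs).apply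
      have h3 : |I (u w + e w) - I (u w)| ≤ |C| * η :=
        h2.trans (mul_le_mul (le_abs_self C) he'.apply (abs_nonneg _) (abs_nonneg _))
      refine h3.trans ?_
      gcongr
      have : 0 ≤ 2 ^ k * (K * (|C| + 1)) + 2 ^ k * (k.factorial * |C| * (|C| + 1) ^ k) := by
        positivity
      linarith
    · rw [hd]
      have hY' : ∀ s ∈ Set.Icc (0 : ℝ) 1, JB k C (deriv (deriv I)) (u w + s * e w) := fun s hs =>
        (JB_succ.1 (hY s hs)).2
      have b1 := H (deriv I) u e w η hI.deriv hu he h1 hY' (fun i h1 hi => hu' i h1 (by omega))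
        (he'.mono k.le_succ le_rfl)
      have b2 : JB k |C| (deriv u) w := fun i hi => by
        rw [← iteratedDeriv_succ']
        exact (hu' (i + 1) (by omega) (by omega)).trans (le_abs_self _)
      have b3 := (JB_succ.1 he').2
      have b4 : JB k |C| (deriv I) (u w) := by
        have := hY 0 (by simp)
        simp only [zero_mul, add_zero] at this
        exact this.mono k.le_succ (le_abs_self _)
      have b5 := b4.comp hI.deriv hu (D := |C| + 1) (by linarith [abs_nonneg C])
        (fun i h1 hi => (hu' i h1 (by omega)).trans (by linarith [le_abs_self C]))
      have b6 := (b1.mul ((hI.deriv.comp (hu.add he)).sub (hI.deriv.comp hu))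
        (hu.deriv.add he.deriv)
        ((b2.add hu.deriv he.deriv b3).mono (D := |C| + 1) le_rfl (by linarith))).add
        (((hI.deriv.comp (hu.add he)).sub (hI.deriv.comp hu)).mul (hu.deriv.add he.deriv))
        ((hI.deriv.comp hu).mul he.deriv)
        (b5.mul (hI.deriv.comp hu) he.deriv b3)
      refine b6.mono le_rfl ?_
      have : 0 ≤ |C| * η := by positivity
      nlinarith

/-- The derivative of an inverse function. -/
lemma hasDerivAt_of_inverse {f I : ℝ → ℝ} (hf : Sm f) (hI : Sm I) (h : ∀ x, f (I x) = x) (x : ℝ) :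
    deriv f (I x) * deriv I x = 1 := by
  have h1 : HasDerivAt (fun x => f (I x)) _ x := (hf.hasDerivAt (I x)).comp x (hI.hasDerivAt x)
  have h2 : HasDerivAt (fun x => f (I x)) 1 x := by
    simp only [h]; exact hasDerivAt_id x
  exact h1.unique h2

lemma JB_inverse (n : ℕ) (c C : ℝ) (hc : 0 < c) : ∃ K, 0 ≤ K ∧ ∀ (f I : ℝ → ℝ) (x : ℝ), Sm f →
    Sm I → (∀ x, f (I x) = x) → (∀ y, deriv f y ≠ 0) → c ≤ |deriv f (I x)| →
    JB n C (deriv f) (I x) → JB n K (deriv I) x := by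
  induction n with
  | zero =>
    refine ⟨c⁻¹, by positivity, fun f I x hf hI h h0 hx hJ => ?_⟩
    rw [JB_zero]
    have := hasDerivAt_of_inverse hf hI h x
    rw [eq_inv_of_mul_eq_one_right this, abs_inv]
    gcongr
  | succ n ih =>
    obtain ⟨K, hK, H⟩ := ih
    obtain ⟨K1, hK1, H1⟩ := JB_inv (n + 1) c C hc
    refine ⟨(n + 1).factorial * K1 * (K + 1) ^ (n + 1), by positivity,
      fun f I x hf hI h h0 hx hJ => ?_⟩
    have e : deriv I = fun y => (deriv f (I y))⁻¹ := by
      ext y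
      exact eq_inv_of_mul_eq_one_right (hasDerivAt_of_inverse hf hI h y)
    have b1 := H f I x hf hI h h0 hx (hJ.mono n.le_succ le_rfl)
    have b2 := H1 (deriv f) (I x) hf.deriv h0 hJ hx
    rw [e]
    refine b2.comp (g := fun y => (deriv f y)⁻¹) (hf.deriv.inv h0) hI (by linarith) (fun i h1 hi => ?_)
    obtain ⟨i, rfl⟩ : ∃ j, i = j + 1 := ⟨i - 1, by omega⟩
    rw [iteratedDeriv_succ']
    exact (b1 i (by omega)).trans (by linarith)

lemma periodic_iteratedDeriv {f : ℝ → ℝ} (h : ∀ x, f (x + 1) = f x) (n : ℕ) (x : ℝ) :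
    iteratedDeriv n f (x + 1) = iteratedDeriv n f x := by
  have := iteratedDeriv_comp_add_const n f 1
  have h2 : (fun z => f (z + 1)) = f := funext h
  rw [h2] at this
  exact (congrFun this x).symm

lemma exists_bound_of_periodic {f : ℝ → ℝ} (hf : Continuous f) (h : ∀ x, f (x + 1) = f x) :
    ∃ C, 0 ≤ C ∧ ∀ x, |f x| ≤ C := by
  obtain ⟨C, hC⟩ := isCompact_Icc.exists_bound_of_continuousOn (s := Set.Icc (0:ℝ) 1)
    hf.continuousOn
  refine ⟨C, (norm_nonneg _).trans (hC 0 (by simp)), fun x => ?_⟩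
  have hp : Function.Periodic f 1 := h
  have : f x = f (Int.fract x) := by
    have := hp.sub_int_mul_eq (x := x) ⌊x⌋
    rw [← this]; rw [mul_one, Int.self_sub_floor]
  rw [this]
  exact hC _ ⟨Int.fract_nonneg _, (Int.fract_lt_one _).le⟩

lemma Sm.exists_JB_of_periodic {f : ℝ → ℝ} (hf : Sm f) (h : ∀ x, f (x + 1) = f x) (n : ℕ) :
    ∃ C, 0 ≤ C ∧ ∀ x, JB n C f x := by
  choose C hC0 hC using fun i => exists_bound_of_periodic (hf.iteratedDeriv i).continuous
    (periodic_iteratedDeriv h i)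
  refine ⟨∑ i ∈ Finset.range (n + 1), C i, Finset.sum_nonneg fun i _ => hC0 i, fun x i hi => ?_⟩
  exact (hC i x).trans (Finset.single_le_sum (fun i _ => hC0 i) (by simp; omega))

namespace IsCircleDiffeoLift

variable {f g : ℝ → ℝ}

lemma sm (hf : IsCircleDiffeoLift f) : Sm f := hf.1

lemma add_one (hf : IsCircleDiffeoLift f) (x : ℝ) : f (x + 1) = f x + 1 := hf.2.1 x

lemma deriv_pos (hf : IsCircleDiffeoLift f) (x : ℝ) : 0 < deriv f x := hf.2.2 x

lemma deriv_ne (hf : IsCircleDiffeoLift f) (x : ℝ) : deriv f x ≠ 0 := (hf.2.2 x).ne'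

lemma strictMono (hf : IsCircleDiffeoLift f) : StrictMono f := strictMono_of_deriv_pos hf.2.2

lemma sub_periodic (hf : IsCircleDiffeoLift f) (x : ℝ) : f (x + 1) - (x + 1) = f x - x := by
  rw [hf.add_one]; ring

lemma add_int (hf : IsCircleDiffeoLift f) (x : ℝ) (k : ℤ) : f (x + k) = f x + k := by
  have h : Function.Periodic (fun x => f x - x) 1 := hf.sub_periodic
  have h2 := h.int_mul k x
  simp only [mul_one] at h2
  linarith

lemma exists_abs_sub_le (hf : IsCircleDiffeoLift f) : ∃ C, ∀ x, |f x - x| ≤ C := by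
  obtain ⟨C, -, hC⟩ := exists_bound_of_periodic (f := fun x => f x - x)
    (hf.sm.continuous.sub continuous_id) hf.sub_periodic
  exact ⟨C, hC⟩

lemma surjective (hf : IsCircleDiffeoLift f) : Function.Surjective f := by
  obtain ⟨C, hC⟩ := hf.exists_abs_sub_le
  refine hf.sm.continuous.surjective ?_ ?_
  · refine tendsto_atTop_mono (f := fun x => x - C) (fun x => ?_)
      (tendsto_atTop_add_const_right _ _ tendsto_id)
    linarith [(abs_le.1 (hC x)).1]
  · have h : Tendsto (fun x : ℝ => x + C) atBot atBot :=
      tendsto_atBot_add_const_right _ _ tendsto_id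
    refine tendsto_atBot_mono (fun x => ?_) h
    linarith [(abs_le.1 (hC x)).2]

lemma bijective (hf : IsCircleDiffeoLift f) : Function.Bijective f :=
  ⟨hf.strictMono.injective, hf.surjective⟩

/-- The permutation of the line given by a lift. -/
def toPerm (hf : IsCircleDiffeoLift f) : Equiv.Perm ℝ := Equiv.ofBijective f hf.bijective

@[simp] lemma coe_toPerm (hf : IsCircleDiffeoLift f) : ⇑hf.toPerm = f := rfl

lemma invFun_eq (hf : IsCircleDiffeoLift f) : Function.invFun f = ⇑hf.toPerm⁻¹ := by
  ext x
  obtain ⟨y, rfl⟩ := hf.surjective x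
  rw [Function.leftInverse_invFun hf.strictMono.injective]
  exact (hf.toPerm.symm_apply_apply y).symm

lemma deriv_periodic (hf : IsCircleDiffeoLift f) (x : ℝ) : deriv f (x + 1) = deriv f x := by
  rw [← deriv_comp_add_const]
  have : (fun x => f (x + 1)) = fun x => f x + 1 := funext hf.add_one
  rw [this, deriv_add_const]

lemma exists_le_deriv (hf : IsCircleDiffeoLift f) : ∃ c, 0 < c ∧ ∀ x, c ≤ deriv f x := by
  obtain ⟨C, hC0, hC⟩ := exists_bound_of_periodic (f := fun x => (deriv f x)⁻¹)
    (hf.sm.deriv.continuous.inv₀ hf.deriv_ne) (fun x => by rw [hf.deriv_periodic])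
  refine ⟨(C + 1)⁻¹, by positivity, fun x => ?_⟩
  have h1 := hC x
  rw [abs_of_pos (inv_pos.2 (hf.deriv_pos x))] at h1
  rw [inv_le_comm₀ (by positivity) (hf.deriv_pos x)]
  linarith

lemma exists_deriv_le (hf : IsCircleDiffeoLift f) : ∃ c, 0 < c ∧ ∀ x, deriv f x ≤ c := by
  obtain ⟨C, hC0, hC⟩ := exists_bound_of_periodic hf.sm.deriv.continuous hf.deriv_periodic
  exact ⟨C + 1, by linarith, fun x => by linarith [le_abs_self (deriv f x), hC x]⟩

lemma comp (hf : IsCircleDiffeoLift f) (hg : IsCircleDiffeoLift g) :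
    IsCircleDiffeoLift (fun x => f (g x)) := by
  refine ⟨hf.sm.comp hg.sm, fun x => by simp only [hg.add_one, hf.add_one], fun x => ?_⟩
  have : HasDerivAt (fun x => f (g x)) _ x := (hf.sm.hasDerivAt (g x)).comp x (hg.sm.hasDerivAt x)
  rw [this.deriv]
  exact mul_pos (hf.deriv_pos _) (hg.deriv_pos _)

lemma add_const (hf : IsCircleDiffeoLift f) (c : ℝ) : IsCircleDiffeoLift (fun x => f x + c) := by
  refine ⟨hf.sm.add contDiff_const, fun x => by simp only [hf.add_one]; ring, fun x => ?_⟩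
  rw [deriv_add_const]; exact hf.deriv_pos x

lemma id : IsCircleDiffeoLift (fun x : ℝ => x) :=
  ⟨contDiff_id, fun _ => rfl, fun x => by simp⟩

lemma inv {F : Equiv.Perm ℝ} (hF : IsCircleDiffeoLift F) : IsCircleDiffeoLift ⇑F⁻¹ := by
  have hF' : ∀ x, F (F⁻¹ x) = x := fun x => F.apply_symm_apply x
  have hcont : Continuous ⇑F⁻¹ :=
    (hF.strictMono.orderIsoOfSurjective _ hF.surjective).symm.continuous.congr fun x => by
      apply F.injective
      rw [hF']
      exact (hF.strictMono.orderIsoOfSurjective _ hF.surjective).apply_symm_apply x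
  let e : ℝ ≃ₜ ℝ := ⟨F, hF.sm.continuous, hcont⟩
  have hsm : Sm ⇑F⁻¹ := e.contDiff_symm_deriv (f' := deriv F) hF.deriv_ne
    (fun x => hF.sm.hasDerivAt x) hF.sm
  refine ⟨hsm, fun x => ?_, fun x => ?_⟩
  · apply F.injective
    rw [hF', hF.add_one, hF']
  · have := hasDerivAt_of_inverse hF.sm hsm hF' x
    exact pos_of_mul_pos_right (by rw [this]; exact one_pos) (hF.deriv_pos _).le

lemma perm_mul {F G : Equiv.Perm ℝ} (hF : IsCircleDiffeoLift F) (hG : IsCircleDiffeoLift G) :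
    IsCircleDiffeoLift ⇑(F * G) := hF.comp hG

lemma perm_one : IsCircleDiffeoLift ⇑(1 : Equiv.Perm ℝ) := IsCircleDiffeoLift.id

lemma perm_pow {F : Equiv.Perm ℝ} (hF : IsCircleDiffeoLift F) (n : ℕ) :
    IsCircleDiffeoLift ⇑(F ^ n) := by
  induction n with
  | zero => exact perm_one
  | succ n ih => rw [pow_succ]; exact ih.perm_mul hF

lemma perm_zpow {F : Equiv.Perm ℝ} (hF : IsCircleDiffeoLift F) (n : ℤ) :
    IsCircleDiffeoLift ⇑(F ^ n) := by
  cases n with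
  | ofNat n => exact hF.perm_pow n
  | negSucc n => rw [zpow_negSucc]; exact (hF.perm_pow _).inv

end IsCircleDiffeoLift

lemma rotLift_isCircleDiffeoLift (a : ℝ) : IsCircleDiffeoLift (fun x => x + a) :=
  IsCircleDiffeoLift.id.add_const a

lemma CrNorm_le {r : ℕ} {C : ℝ} {φ : ℝ → ℝ} (h : ∀ x, JB r C φ x) : CrNorm r φ ≤ C := by
  refine Finset.sup'_le _ _ fun i hi => ciSup_le fun x => h x i ?_
  simp at hi; omega

lemma JB_sub_id {f : ℝ → ℝ} (hf : IsCircleDiffeoLift f) (n : ℕ) : ∃ C, 1 ≤ C ∧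
    ∀ x i, 1 ≤ i → i ≤ n → |iteratedDeriv i f x| ≤ C := by
  obtain ⟨C, hC0, hC⟩ := hf.sm.deriv.exists_JB_of_periodic hf.deriv_periodic n
  refine ⟨C + 1, by linarith, fun x i h1 hi => ?_⟩
  obtain ⟨i, rfl⟩ : ∃ j, i = j + 1 := ⟨i - 1, by omega⟩
  rw [iteratedDeriv_succ']
  exact (hC x i (by omega)).trans (by linarith)

lemma abs_iteratedDeriv_id_le (i : ℕ) (hi : 1 ≤ i) (x : ℝ) :
    |iteratedDeriv i (fun x : ℝ => x) x| ≤ 1 := by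
  obtain ⟨i, rfl⟩ : ∃ j, i = j + 1 := ⟨i - 1, by omega⟩
  rw [iteratedDeriv_succ']
  simp only [deriv_id'', iteratedDeriv_const]
  split_ifs <;> simp

/-- Inversion is continuous for the `C^r` topology. -/
lemma inv_close (G : Equiv.Perm ℝ) (hG : IsCircleDiffeoLift G) (r : ℕ) (ε : ℝ) (hε : 0 < ε) :
    ∃ δ > 0, ∀ F : Equiv.Perm ℝ, IsCircleDiffeoLift F →
      (∀ x, JB (r + 1) δ (fun x => F x - G x) x) →
      ∀ x, JB r ε (fun x => F⁻¹ x - G⁻¹ x) x := by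
  obtain ⟨c, hc, hcG⟩ := hG.exists_le_deriv
  obtain ⟨C, hC0, hC⟩ := hG.sm.deriv.exists_JB_of_periodic hG.deriv_periodic r
  obtain ⟨D, hD1, hD⟩ := JB_sub_id hG.inv (r + 1)
  obtain ⟨K, hK0, hK⟩ := JB_inverse r (c / 2) (C + 1) (by linarith)
  set E : ℝ := r.factorial * (K + 1) ^ r with hE
  have hEpos : 0 < E := by positivity
  set B : ℝ := D + K + 1 + E with hB
  obtain ⟨b, hb0, hb⟩ := exists_bound_of_periodic (f := fun x => G⁻¹ x - x)
    (hG.inv.sm.continuous.sub continuous_id) hG.inv.sub_periodic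
  obtain ⟨Q, hQ0, hQ⟩ := JB_comp_sub r B
  -- `u = G ∘ F⁻¹` has derivatives bounded since `u = id - (F - G) ∘ F⁻¹`
  obtain ⟨δ, hδ, h1, h2, h3, h4⟩ : ∃ δ : ℝ, 0 < δ ∧ δ ≤ c / 2 ∧ δ ≤ 1 ∧ E * δ ≤ 1 ∧
      Q * (E * δ) ≤ ε := by
    refine ⟨min (min (c / 2) 1) (min (1 / E) (ε / (Q * E + 1))), by positivity, ?_, ?_, ?_, ?_⟩
    · exact (min_le_left _ _).trans (min_le_left _ _)
    · exact (min_le_left _ _).trans (min_le_right _ _)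
    · calc _ ≤ E * (1 / E) := by gcongr; exact (min_le_right _ _).trans (min_le_left _ _)
        _ = 1 := by field_simp
    · calc _ ≤ Q * (E * (ε / (Q * E + 1))) := by
            gcongr; exact (min_le_right _ _).trans (min_le_right _ _)
        _ ≤ ε := by
          rw [← mul_assoc, mul_div_assoc', div_le_iff₀ (by positivity)]; nlinarith [mul_nonneg hQ0 hEpos.le]
  refine ⟨δ, hδ, fun F hF h x => ?_⟩
  have hFG : Sm (fun x => F x - G x) := hF.sm.sub hG.sm
  have hder : ∀ x, deriv (fun x => F x - G x) x = deriv F x - deriv G x := fun x =>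
    ((hF.sm.hasDerivAt x).fun_sub (hG.sm.hasDerivAt x)).deriv
  have hFi := hF.inv
  have hFF : ∀ x, F (F⁻¹ x) = x := fun x => F.apply_symm_apply x
  have hJF : JB r (C + 1) (deriv F) (F⁻¹ x) := by
    have e : deriv F = fun x => deriv G x + deriv (fun x => F x - G x) x := by
      ext y; rw [hder]; ring
    rw [e]
    exact ((hC _).add hG.sm.deriv hFG.deriv (JB_succ.1 (h _)).2).mono le_rfl (by linarith)
  have hcF : c / 2 ≤ |deriv F (F⁻¹ x)| := by
    have := (JB_succ.1 (h (F⁻¹ x))).2.apply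
    rw [hder] at this
    have h5 := hcG (F⁻¹ x)
    exact le_trans (by linarith [(abs_le.1 this).1]) (le_abs_self _)
  have hI := hK F ⇑F⁻¹ x hF.sm hFi.sm hFF hF.deriv_ne hcF hJF
  have hI' : ∀ i, 1 ≤ i → i ≤ r → |iteratedDeriv i ⇑F⁻¹ x| ≤ K + 1 := by
    intro i h1 hi
    obtain ⟨i, rfl⟩ : ∃ j, i = j + 1 := ⟨i - 1, by omega⟩
    rw [iteratedDeriv_succ']
    exact (hI i (by omega)).trans (by linarith)
  have hu : JB r (E * δ) (fun x => F (F⁻¹ x) - G (F⁻¹ x)) x := by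
    refine (JB.comp hFG hFi.sm (D := K + 1) (by linarith)
      ((h (F⁻¹ x)).mono r.le_succ le_rfl) hI').mono le_rfl ?_
    rw [hE]; exact le_of_eq (by ring)
  have hue : Sm (fun x => F (F⁻¹ x) - G (F⁻¹ x)) := hFG.comp hFi.sm
  have hGI : Sm (fun x => G (F⁻¹ x)) := hG.sm.comp hFi.sm
  have hGI' : ∀ i, 1 ≤ i → i ≤ r → |iteratedDeriv i (fun x => G (F⁻¹ x)) x| ≤ B := by
    intro i h1 hi
    have e2 : (fun x => G (F⁻¹ x)) = fun x => x - (F (F⁻¹ x) - G (F⁻¹ x)) := by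
      ext y
      rw [hFF]; ring
    rw [e2, iteratedDeriv_fun_sub (f := fun x => x) contDiff_id.contDiffAt (hue.nat i).contDiffAt]
    have h5 := abs_iteratedDeriv_id_le i h1 x
    refine (abs_sub _ _).trans ((add_le_add h5 (hu i hi)).trans ?_)
    linarith
  have key := hQ ⇑G⁻¹ (fun x => G (F⁻¹ x)) (fun x => F (F⁻¹ x) - G (F⁻¹ x)) x (E * δ)
    hG.inv.sm hGI hue h3 (fun s _ => ?_) hGI' hu
  · have e : (fun x => F⁻¹ x - G⁻¹ x) = fun y => -(G⁻¹ (G (F⁻¹ y) + (F (F⁻¹ y) - G (F⁻¹ y))) -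
        G⁻¹ (G (F⁻¹ y))) := by
      ext y
      have h1 : G⁻¹ (G (F⁻¹ y)) = F⁻¹ y := G.symm_apply_apply _
      rw [h1, hFF]
      ring_nf
    rw [e]
    exact key.neg.mono le_rfl h4
  · intro i hi
    rw [← iteratedDeriv_succ']
    exact (hD _ _ (by omega) (by omega)).trans (by linarith)

/-- The nonlinearity `f'' / f'`, the derivative of `log f'`. -/
def nl (f : ℝ → ℝ) (x : ℝ) : ℝ := deriv (deriv f) x * (deriv f x)⁻¹

lemma IsCircleDiffeoLift.sm_nl {f : ℝ → ℝ} (hf : IsCircleDiffeoLift f) : Sm (nl f) :=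
  hf.sm.deriv.deriv.mul (hf.sm.deriv.inv hf.deriv_ne)

lemma IsCircleDiffeoLift.nl_periodic {f : ℝ → ℝ} (hf : IsCircleDiffeoLift f) (x : ℝ) :
    nl f (x + 1) = nl f x := by
  have := periodic_iteratedDeriv hf.deriv_periodic 1 x
  rw [iteratedDeriv_one] at this
  rw [nl, nl, this, hf.deriv_periodic]

lemma IsCircleDiffeoLift.hasDerivAt_log {f : ℝ → ℝ} (hf : IsCircleDiffeoLift f) (x : ℝ) :
    HasDerivAt (fun x => Real.log (deriv f x)) (nl f x) x := by
  have := (hf.sm.deriv.hasDerivAt x).log (hf.deriv_ne x)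
  rwa [div_eq_mul_inv] at this

lemma IsCircleDiffeoLift.abs_log_deriv_le {f : ℝ → ℝ} (hf : IsCircleDiffeoLift f) {V : ℝ}
    (hV : ∀ x, |nl f x| ≤ V) (x : ℝ) : |Real.log (deriv f x)| ≤ V := by
  obtain ⟨c, hc, hc1⟩ := exists_deriv_eq_slope f (a := x) (b := x + 1) (by linarith)
    hf.sm.continuous.continuousOn hf.sm.differentiable'.differentiableOn
  rw [hf.add_one] at hc1
  have h1 : deriv f c = 1 := by rw [hc1]; field_simp; ring
  have := convex_univ.norm_image_sub_le_of_norm_hasDerivWithin_le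
    (f := fun x => Real.log (deriv f x)) (C := V) (fun x _ => (hf.hasDerivAt_log x).hasDerivWithinAt)
    (fun x _ => hV x) (Set.mem_univ c) (Set.mem_univ x)
  simp only [h1, Real.log_one, sub_zero, Real.norm_eq_abs] at this
  refine this.trans ?_
  have h0 : 0 ≤ V := (abs_nonneg _).trans (hV x)
  have : |x - c| ≤ 1 := by rw [abs_le]; constructor <;> linarith [hc.1, hc.2]
  nlinarith

lemma IsCircleDiffeoLift.deriv_le_exp {f : ℝ → ℝ} (hf : IsCircleDiffeoLift f) {V : ℝ}
    (hV : ∀ x, |nl f x| ≤ V) (x : ℝ) : deriv f x ≤ Real.exp V := by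
  rw [← Real.log_le_iff_le_exp (hf.deriv_pos x)]
  exact (le_abs_self _).trans (hf.abs_log_deriv_le hV x)

lemma IsCircleDiffeoLift.exp_le_deriv {f : ℝ → ℝ} (hf : IsCircleDiffeoLift f) {V : ℝ}
    (hV : ∀ x, |nl f x| ≤ V) (x : ℝ) : Real.exp (-V) ≤ deriv f x := by
  rw [← Real.le_log_iff_exp_le (hf.deriv_pos x)]
  exact (abs_le.1 (hf.abs_log_deriv_le hV x)).1

/-- A lift with bounded nonlinearity, a periodic orbit of rotation number `p/q`, listed in
increasing order, and whose largest gap is `[y 0, y 1]`. -/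
structure Orb (B : ℕ → ℝ) where
  f : Equiv.Perm ℝ
  lift : IsCircleDiffeoLift f
  bd : ∀ n x, JB n (B n) (nl f) x
  bdi : ∀ n x, JB n (B n) (nl ⇑f⁻¹) x
  p : ℤ
  q : ℕ
  hq : 0 < q
  cop : IsCoprime p (q : ℤ)
  y : ℤ → ℝ
  mono : StrictMono y
  per : ∀ k, y (k + q) = y k + 1
  shift : ∀ k, f (y k) = y (k + p)
  hmax : ∀ k, y (k + 1) - y k ≤ y 1 - y 0

namespace Orb

variable {B : ℕ → ℝ} (D : Orb B)

/-- The same orbit, seen as an orbit of the inverse. -/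
def inv : Orb B where
  f := D.f⁻¹
  lift := D.lift.inv
  bd := D.bdi
  bdi := by rw [inv_inv]; exact D.bd
  p := -D.p
  q := D.q
  hq := D.hq
  cop := D.cop.neg_left
  y := D.y
  mono := D.mono
  per := D.per
  shift k := by
    have := D.shift (k - D.p)
    rw [sub_add_cancel] at this
    rw [← this, ← sub_eq_add_neg]
    exact D.f.symm_apply_apply _
  hmax := D.hmax

/-- The gaps of the orbit. -/
def gap (k : ℤ) : ℝ := D.y (k + 1) - D.y k

/-- The largest gap. -/
def M : ℝ := D.y 1 - D.y 0

lemma gap_pos (k : ℤ) : 0 < D.gap k := sub_pos.2 (D.mono (lt_add_one k))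

lemma gap_le (k : ℤ) : D.gap k ≤ D.M := D.hmax k

lemma gap_zero : D.gap 0 = D.M := by simp [gap, M]

lemma M_pos : 0 < D.M := D.gap_zero ▸ D.gap_pos 0

lemma per_mul (k m : ℤ) : D.y (k + m * D.q) = D.y k + m := by
  induction m with
  | zero => simp
  | succ m ih => rw [add_mul, ← add_assoc, one_mul, D.per, ih]; push_cast; ring
  | pred m ih =>
    have := D.per (k + (-(m:ℤ) - 1) * D.q)
    rw [show k + (-(m:ℤ) - 1) * D.q + D.q = k + (-(m:ℤ)) * D.q by ring, ih] at this
    push_cast at *; linarith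

lemma gap_per (k m : ℤ) : D.gap (k + m * D.q) = D.gap k := by
  rw [gap, gap, add_right_comm, D.per_mul, D.per_mul]; ring

lemma gap_congr {k l : ℤ} (h : (k : ZMod D.q) = l) : D.gap k = D.gap l := by
  rw [ZMod.intCast_eq_intCast_iff_dvd_sub] at h
  obtain ⟨c, hc⟩ := h
  rw [show l = k + c * D.q by linarith, gap_per]

/-- The gaps as a function on `ℤ/q`. -/
def zgap (c : ZMod D.q) : ℝ := D.gap c.valMinAbs

lemma zgap_coe (k : ℤ) : D.zgap k = D.gap k := D.gap_congr (by simp)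

instance : NeZero D.q := ⟨D.hq.ne'⟩

lemma sum_gap (n : ℕ) (k : ℤ) : ∑ i ∈ Finset.range n, D.gap (k + i) = D.y (k + n) - D.y k := by
  induction n with
  | zero => simp
  | succ n ih => rw [Finset.sum_range_succ, ih, gap]; push_cast; rw [add_assoc k]; ring

lemma zgap_pos (c : ZMod D.q) : 0 < D.zgap c := D.gap_pos _

lemma sum_zgap : ∑ c, D.zgap c = 1 := by
  have h1 := D.sum_gap D.q 0
  have h2 := D.per 0
  rw [h2, add_sub_cancel_left] at h1
  rw [← h1]
  symm
  refine Finset.sum_bij (fun i _ => ((i : ℤ) : ZMod D.q)) (fun _ _ => Finset.mem_univ _) ?_ ?_ ?_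
  · intro i hi j hj h
    simp only [Finset.mem_range] at hi hj
    rw [ZMod.intCast_eq_intCast_iff] at h
    have := (Int.natCast_modEq_iff).1 h
    exact Nat.ModEq.eq_of_lt_of_lt this hi hj
  · intro c _
    exact ⟨c.val, by simpa using c.val_lt, by simp⟩
  · intro i _
    rw [D.zgap_coe, zero_add]

lemma sum_gap_le_one {ι : Type*} (s : Finset ι) (k : ι → ℤ)
    (h : Set.InjOn (fun i => (k i : ZMod D.q)) s) : ∑ i ∈ s, D.gap (k i) ≤ 1 := by
  classical
  calc _ = ∑ i ∈ s, D.zgap (k i) := by simp_rw [D.zgap_coe]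
    _ = ∑ c ∈ s.image (fun i => (k i : ZMod D.q)), D.zgap c := by
      rw [Finset.sum_image h]
    _ ≤ ∑ c, D.zgap c := Finset.sum_le_sum_of_subset_of_nonneg (Finset.subset_univ _)
        fun c _ _ => (D.zgap_pos c).le
    _ = 1 := D.sum_zgap

lemma one_le_q_mul_M : 1 ≤ D.q * D.M := by
  rw [← D.sum_zgap]
  calc _ ≤ ∑ c : ZMod D.q, D.M := Finset.sum_le_sum fun c _ => D.gap_le _
    _ = _ := by simp [ZMod.card]

lemma isUnit_p : IsUnit (D.p : ZMod D.q) := by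
  obtain ⟨u, v, h⟩ := D.cop
  have : (u : ZMod D.q) * D.p = 1 := by
    have := congrArg (Int.cast : ℤ → ZMod D.q) h
    simpa using this
  exact IsUnit.of_mul_eq_one_right _ this

lemma injOn_mul_p (k : ℤ) :
    Set.InjOn (fun i : ℕ => ((k + i * D.p : ℤ) : ZMod D.q)) (Finset.range D.q) := by
  intro i hi j hj h
  simp only [Finset.coe_range, Set.mem_Iio] at hi hj
  push_cast at h
  have h := D.isUnit_p.mul_right_cancel (add_left_cancel h)
  have := (ZMod.natCast_eq_natCast_iff _ _ _).1 h
  exact Nat.ModEq.eq_of_lt_of_lt this hi hj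

lemma sum_orbit_gap_le (k : ℤ) {j : ℕ} (hj : j ≤ D.q) :
    ∑ i ∈ Finset.range j, D.gap (k + i * D.p) ≤ 1 :=
  D.sum_gap_le_one _ _ ((D.injOn_mul_p k).mono (by simpa using hj))

lemma exists_mul_p (k l : ℤ) : ∃ j < D.q, ((k + (j : ℤ) * D.p : ℤ) : ZMod D.q) = l := by
  obtain ⟨u, hu⟩ := D.isUnit_p
  refine ⟨(((l - k : ℤ) : ZMod D.q) * (u⁻¹ : (ZMod D.q)ˣ)).val, ZMod.val_lt _, ?_⟩
  push_cast
  rw [ZMod.natCast_zmod_val, ← hu, mul_assoc, Units.inv_mul]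
  ring

lemma iter_y (j : ℕ) (k : ℤ) : (D.f ^ j) (D.y k) = D.y (k + j * D.p) := by
  induction j with
  | zero => simp
  | succ j ih =>
    rw [pow_succ', Equiv.Perm.mul_apply, ih, D.shift]; push_cast; congr 1; ring

end Orb

lemma exists_orb_points (F : Equiv.Perm ℝ) (hF : IsCircleDiffeoLift F) (p : ℤ) (q : ℕ)
    (cop : IsCoprime p (q : ℤ)) (x : ℝ) (hx : (F ^ q) x = x + p) :
    ∃ y : ℤ → ℝ, StrictMono y ∧ (∀ k, y (k + q) = y k + 1) ∧ ∀ k, F (y k) = y (k + p) := by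
  obtain ⟨u, v, huv⟩ := cop
  let T : Equiv.Perm ℝ := Equiv.addRight (1 : ℝ)
  have hT : ∀ m : ℤ, ∀ x, (T ^ m) x = x + m := by
    intro m x
    induction m generalizing x with
    | zero => simp
    | succ m ih =>
      rw [zpow_add_one, Equiv.Perm.mul_apply, ih]
      show x + 1 + _ = _
      push_cast; ring
    | pred m ih =>
      rw [zpow_sub_one, Equiv.Perm.mul_apply, ih]
      show x + -1 + _ = _
      push_cast; ring
  have hTl : IsCircleDiffeoLift T := rotLift_isCircleDiffeoLift 1
  have hc : Commute F T := by
    refine Equiv.ext fun x => ?_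
    exact hF.add_one x
  set G : Equiv.Perm ℝ := F ^ u * T ^ v with hG
  have hGl : IsCircleDiffeoLift G := (hF.perm_zpow u).perm_mul (hTl.perm_zpow v)
  have hGz : ∀ m : ℤ, G ^ m = F ^ (u * m) * T ^ (v * m) := fun m => by
    rw [hG, (hc.zpow_zpow u v).mul_zpow, ← zpow_mul, ← zpow_mul]
  have hFq : ∀ m : ℤ, (F ^ ((q : ℤ) * m)) x = x + p * m := by
    intro m
    have h1 : ∀ n : ℤ, (F ^ (q : ℤ)) (x + n) = x + n + p := fun n => by
      rw [zpow_natCast, (hF.perm_pow q).add_int, hx]; ring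
    rw [zpow_mul]
    induction m with
    | zero => simp
    | succ m ih =>
      rw [zpow_add_one, Equiv.Perm.mul_apply]
      have := h1 0
      rw [Int.cast_zero, add_zero] at this
      rw [this, ← zpow_mul, (hF.perm_zpow _).add_int, zpow_mul, ih]; push_cast; ring
    | pred m ih =>
      rw [zpow_sub_one, Equiv.Perm.mul_apply]
      have h2 : (F ^ (q:ℤ))⁻¹ x = x + (-p : ℤ) := by
        rw [Equiv.Perm.inv_eq_iff_eq, h1]; push_cast; ring
      rw [h2, ← zpow_mul, (hF.perm_zpow _).add_int, zpow_mul, ih]; push_cast; ring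
  have hGq : (G ^ (q:ℤ)) x = x + 1 := by
    rw [hGz, Equiv.Perm.mul_apply, hT, (hF.perm_zpow _).add_int, mul_comm u, hFq]
    have : (u:ℝ) * p + v * q = 1 := by exact_mod_cast huv
    push_cast; linarith
  have hGp : (G ^ p) x = F x := by
    rw [hGz, Equiv.Perm.mul_apply, hT, (hF.perm_zpow _).add_int,
      show u * p = 1 + q * (-v) by linarith, zpow_add, zpow_one, Equiv.Perm.mul_apply, hFq]
    have := hF.add_int x (p * (-v))
    push_cast at this ⊢
    rw [this]; ring
  have hGx : x < G x := by
    by_contra! h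
    have : ∀ n : ℕ, (G ^ n) x ≤ x := by
      intro n
      induction n with
      | zero => simp
      | succ n ih =>
        rw [pow_succ, Equiv.Perm.mul_apply]
        exact ((hGl.perm_pow n).strictMono.monotone h).trans ih
    have h2 := this q
    rw [← zpow_natCast, hGq] at h2
    linarith
  refine ⟨fun k => (G ^ k) x, strictMono_int_of_lt_succ fun k => ?_, fun k => ?_, fun k => ?_⟩
  · show (G ^ k) x < (G ^ (k + 1)) x
    rw [zpow_add_one, Equiv.Perm.mul_apply]
    exact (hGl.perm_zpow k).strictMono hGx
  · show (G ^ (k + q)) x = (G ^ k) x + 1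
    rw [zpow_add, Equiv.Perm.mul_apply, hGq, (hGl.perm_zpow k).add_one]
  · show F ((G ^ k) x) = (G ^ (k + p)) x
    rw [zpow_add, Equiv.Perm.mul_apply, hGp]
    have : Commute F (G ^ k) :=
      ((Commute.refl F).zpow_right u |>.mul_right (hc.zpow_right v)).zpow_right k
    exact congrArg (fun e : Equiv.Perm ℝ => e x) this.eq

lemma exists_shift_periodic (G : Equiv.Perm ℝ) (hG : IsCircleDiffeoLift G) (a : ℝ)
    (ha : Tendsto (fun n : ℕ => (G ^ n) 0 / (n : ℝ)) atTop (nhds a)) (p : ℤ) (q : ℕ)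
    (hq : 0 < q) : ∃ t : ℝ, |t| ≤ |q * a - p| ∧ ∃ x, (fun y => G y + t)^[q] x = x + p := by
  let L : CircleDeg1Lift := ⟨⟨G, hG.strictMono.monotone⟩, hG.add_one⟩
  have hL : ∀ n : ℕ, ⇑(L ^ n) = G^[n] := fun n => CircleDeg1Lift.coe_pow L n
  have hτ : L.translationNumber = a := by
    refine tendsto_nhds_unique L.tendsto_translation_number₀ ?_
    refine ha.congr fun n => ?_
    rw [hL, Equiv.Perm.iterate_eq_pow]
  obtain ⟨x, hx⟩ := CircleDeg1Lift.exists_eq_add_translationNumber (L ^ q)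
    (by rw [hL]; exact hG.sm.continuous.iterate q)
  rw [hL, CircleDeg1Lift.translationNumber_pow, hτ] at hx
  have hcont : ∀ n : ℕ, Continuous fun t : ℝ => (fun y => G y + t)^[n] x := by
    intro n
    induction n with
    | zero => simpa using continuous_const
    | succ n ih =>
      simp only [Function.iterate_succ_apply']
      exact (hG.sm.continuous.comp ih).add continuous_id
  have hmono : ∀ n : ℕ, ∀ t : ℝ, t ≤ 0 → (fun y => G y + t)^[n] x ≤ G^[n] x := by
    intro n t ht
    induction n with
    | zero => simp
    | succ n ih =>
      simp only [Function.iterate_succ_apply']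
      linarith [hG.strictMono.monotone ih]
  have hmono' : ∀ n : ℕ, ∀ t : ℝ, 0 ≤ t → G^[n] x ≤ (fun y => G y + t)^[n] x := by
    intro n t ht
    induction n with
    | zero => simp
    | succ n ih =>
      simp only [Function.iterate_succ_apply']
      linarith [hG.strictMono.monotone ih]
  obtain ⟨m, rfl⟩ : ∃ m, q = m + 1 := ⟨q - 1, by omega⟩
  have hx0 : (fun y => G y + (0:ℝ))^[m + 1] x = x + (m + 1 : ℕ) * a := by
    simp only [add_zero]; exact hx
  set δ : ℝ := (m + 1 : ℕ) * a - p with hδ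
  rcases le_total 0 δ with h | h
  · have h1 : (fun y => G y + -δ)^[m + 1] x ≤ x + p := by
      rw [Function.iterate_succ_apply']
      have := hG.strictMono.monotone (hmono m (-δ) (by linarith))
      rw [← Function.iterate_succ_apply' G, hx] at this
      linarith
    obtain ⟨t, ht, ht2⟩ := intermediate_value_Icc (a := -δ) (b := 0) (by linarith)
      (hcont (m + 1)).continuousOn (show x + p ∈ Set.Icc _ _ from ⟨h1, by rw [hx0]; linarith⟩)
    exact ⟨t, by rw [abs_of_nonneg h, abs_le]; exact ⟨ht.1, ht.2.trans h⟩, x, ht2⟩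
  · have h1 : x + p ≤ (fun y => G y + -δ)^[m + 1] x := by
      rw [Function.iterate_succ_apply']
      have := hG.strictMono.monotone (hmono' m (-δ) (by linarith))
      rw [← Function.iterate_succ_apply' G, hx] at this
      linarith
    obtain ⟨t, ht, ht2⟩ := intermediate_value_Icc (a := 0) (b := -δ) (by linarith)
      (hcont (m + 1)).continuousOn (show x + p ∈ Set.Icc _ _ from ⟨by rw [hx0]; linarith, h1⟩)
    exact ⟨t, by rw [abs_of_nonpos h, abs_le]; exact ⟨by linarith [ht.1], ht.2⟩, x, ht2⟩

lemma exists_max_of_periodic (φ : ℤ → ℝ) (q : ℕ) (hq : 0 < q) (hp : ∀ k, φ (k + q) = φ k) :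
    ∃ k0, ∀ k, φ k ≤ φ k0 := by
  have hp : Function.Periodic φ (q : ℤ) := hp
  obtain ⟨k0, -, h⟩ := Finset.exists_max_image (Finset.range q)
    (fun i : ℕ => φ i) ⟨0, by simpa using hq⟩
  refine ⟨k0, fun k => ?_⟩
  have hk : 0 ≤ k % q := Int.emod_nonneg _ (by omega)
  have h1 := h (k % q).toNat (by
    have := Int.emod_lt_of_pos k (show (0:ℤ) < q by omega)
    simp; omega)
  rw [Int.toNat_of_nonneg hk] at h1
  refine le_trans (le_of_eq ?_) h1
  have := hp.sub_int_mul_eq (x := k) (k / q)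
  rw [show k % (q:ℤ) = k - (k / q) * q by rw [Int.emod_def]; ring]
  exact this.symm

lemma exists_orb (G : Equiv.Perm ℝ) (hG : IsCircleDiffeoLift G) (a : ℝ)
    (ha : Tendsto (fun n : ℕ => (G ^ n) 0 / (n : ℝ)) atTop (nhds a)) :
    ∃ B : ℕ → ℝ, ∀ (p : ℤ) (q : ℕ), 0 < q → IsCoprime p (q : ℤ) → ∃ D : Orb B, D.p = p ∧ D.q = q ∧
      ∃ t : ℝ, |t| ≤ |q * a - p| ∧ ∀ x, D.f x = G x + t := by
  choose B hB0 hB using fun n => hG.sm_nl.exists_JB_of_periodic hG.nl_periodic n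
  choose B' hB'0 hB' using fun n => hG.inv.sm_nl.exists_JB_of_periodic hG.inv.nl_periodic n
  refine ⟨fun n => max (B n) (B' n), fun p q hq cop => ?_⟩
  obtain ⟨t, ht, x, hx⟩ := exists_shift_periodic G hG a ha p q hq
  set F : Equiv.Perm ℝ := Equiv.addRight t * G with hF
  have hFG : ∀ x, F x = G x + t := fun x => rfl
  have hFl : IsCircleDiffeoLift F := hG.add_const t
  have hFd : deriv F = deriv G := by
    ext x
    have : ⇑F = fun x => G x + t := funext hFG
    rw [this, deriv_add_const]
  have hnl : nl F = nl G := by ext x; rw [nl, nl, hFd]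
  have hFi : ⇑F⁻¹ = fun x => G⁻¹ (x - t) := by
    ext x
    rw [Equiv.Perm.inv_eq_iff_eq, hFG]
    have : G (G⁻¹ (x - t)) = x - t := G.apply_symm_apply _
    rw [this]; ring
  have hFid : deriv ⇑F⁻¹ = fun x => deriv ⇑G⁻¹ (x - t) := by
    ext x
    rw [hFi, deriv_comp_sub_const]
  have hnli : nl ⇑F⁻¹ = fun x => nl ⇑G⁻¹ (x - t) := by
    ext x; simp only [nl, hFid]; rw [deriv_comp_sub_const]
  have hx' : (F ^ q) x = x + p := by
    rw [← Equiv.Perm.iterate_eq_pow]; exact hx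
  obtain ⟨y, hy, hper, hsh⟩ := exists_orb_points F hFl p q cop x hx'
  obtain ⟨k0, hk0⟩ := exists_max_of_periodic (fun k => y (k + 1) - y k) q hq
    fun k => by simp only [hper, add_right_comm k (q : ℤ) 1]; ring
  refine ⟨⟨F, hFl, fun n x => ?_, fun n x => ?_, p, q, hq, cop, fun k => y (k + k0),
    fun k l h => hy (by omega), fun k => ?_, fun k => ?_, fun k => ?_⟩, rfl, rfl, t, ht, hFG⟩
  · rw [hnl]; exact (hB n x).mono le_rfl (le_max_left _ _)
  · rw [hnli]
    intro i hi
    rw [iteratedDeriv_comp_sub_const]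
    exact (hB' n (x - t) i hi).trans (le_max_right _ _)
  · simp only [← hper]; congr 1; ring
  · simp only [hsh]; congr 1; ring
  · have := hk0 (k + k0)
    simp only [add_right_comm k 1 k0, zero_add, add_comm 1 k0]; exact this

/-! ### Distortion of iterates -/

namespace IsCircleDiffeoLift

lemma deriv_pow_succ {F : Equiv.Perm ℝ} (hF : IsCircleDiffeoLift F) (n : ℕ) (x : ℝ) :
    deriv ⇑(F ^ (n + 1)) x = deriv F ((F ^ n) x) * deriv ⇑(F ^ n) x := by
  have h : HasDerivAt (fun y => F ((F ^ n) y)) _ x :=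
    (hF.sm.hasDerivAt ((F ^ n) x)).comp x ((hF.perm_pow n).sm.hasDerivAt x)
  have e : ⇑(F ^ (n + 1)) = fun y => F ((F ^ n) y) := by
    ext y; rw [pow_succ', Equiv.Perm.mul_apply]
  rw [e, h.deriv]

lemma log_deriv_pow {F : Equiv.Perm ℝ} (hF : IsCircleDiffeoLift F) (n : ℕ) (x : ℝ) :
    Real.log (deriv ⇑(F ^ n) x) = ∑ i ∈ Finset.range n, Real.log (deriv F ((F ^ i) x)) := by
  induction n with
  | zero => simp
  | succ n ih =>
    rw [hF.deriv_pow_succ, Real.log_mul (hF.deriv_ne _) ((hF.perm_pow n).deriv_ne x),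
      Finset.sum_range_succ, ih, add_comm]

lemma abs_log_deriv_sub_le {f : ℝ → ℝ} (hf : IsCircleDiffeoLift f) {V : ℝ}
    (hV : ∀ x, |nl f x| ≤ V) (x y : ℝ) :
    |Real.log (deriv f x) - Real.log (deriv f y)| ≤ V * |x - y| :=
  convex_univ.norm_image_sub_le_of_norm_hasDerivWithin_le
    (f := fun x => Real.log (deriv f x)) (C := V) (fun x _ => (hf.hasDerivAt_log x).hasDerivWithinAt)
    (fun x _ => hV x) (Set.mem_univ y) (Set.mem_univ x)

lemma abs_log_deriv_pow_sub_le {F : Equiv.Perm ℝ} (hF : IsCircleDiffeoLift F) {V : ℝ}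
    (hV : ∀ x, |nl F x| ≤ V) (n : ℕ) {a b x y : ℝ} (hx : x ∈ Set.Icc a b) (hy : y ∈ Set.Icc a b) :
    |Real.log (deriv ⇑(F ^ n) x) - Real.log (deriv ⇑(F ^ n) y)| ≤
      V * ∑ i ∈ Finset.range n, ((F ^ i) b - (F ^ i) a) := by
  rw [hF.log_deriv_pow, hF.log_deriv_pow, ← Finset.sum_sub_distrib, Finset.mul_sum]
  refine (Finset.abs_sum_le_sum_abs _ _).trans (Finset.sum_le_sum fun i _ => ?_)
  refine (hF.abs_log_deriv_sub_le hV _ _).trans ?_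
  have hV0 : 0 ≤ V := (abs_nonneg _).trans (hV 0)
  have hm := (hF.perm_pow i).strictMono.monotone
  refine mul_le_mul_of_nonneg_left ?_ hV0
  rw [abs_le]
  constructor <;> linarith [hm hx.1, hm hx.2, hm hy.1, hm hy.2]

/-- The slope of an iterate over an interval is attained by its derivative. -/
lemma exists_deriv_mul_eq {f : ℝ → ℝ} (hf : IsCircleDiffeoLift f) {a b : ℝ} (h : a < b) :
    ∃ c ∈ Set.Ioo a b, deriv f c * (b - a) = f b - f a := by
  obtain ⟨c, hc, hc1⟩ := exists_deriv_eq_slope f h hf.sm.continuous.continuousOn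
    hf.sm.differentiable'.differentiableOn
  refine ⟨c, hc, ?_⟩
  rw [hc1]; field_simp [sub_ne_zero.2 h.ne']

end IsCircleDiffeoLift

namespace Orb
variable {B : ℕ → ℝ} (D : Orb B)

lemma abs_nl_le (x : ℝ) : |nl D.f x| ≤ B 0 := (D.bd 0 x).apply

lemma B_nonneg {B : ℕ → ℝ} (D : Orb B) (n : ℕ) : 0 ≤ B n := (D.bd n 0).nonneg

/-- If the iterates of `[y k, y (k + s)]` before time `j` have total length at most `W`, then the
derivative of the iterate of order `j` has bounded distortion there. -/
lemma abs_log_deriv_pow_sub_le (j : ℕ) {k : ℤ} {s : ℕ} {W : ℝ}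
    (hW : ∑ i ∈ Finset.range j, (D.y (k + s + i * D.p) - D.y (k + i * D.p)) ≤ W)
    {x y : ℝ} (hx : x ∈ Set.Icc (D.y k) (D.y (k + s))) (hy : y ∈ Set.Icc (D.y k) (D.y (k + s))) :
    |Real.log (deriv ⇑(D.f ^ j) x) - Real.log (deriv ⇑(D.f ^ j) y)| ≤ B 0 * W := by
  refine (D.lift.abs_log_deriv_pow_sub_le D.abs_nl_le j hx hy).trans ?_
  refine mul_le_mul_of_nonneg_left ?_ (D.B_nonneg 0)
  simpa only [D.iter_y] using hW

lemma sum_orbit_le (k : ℤ) (s : ℕ) {j : ℕ} (hj : j ≤ D.q) :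
    ∑ i ∈ Finset.range j, (D.y (k + s + i * D.p) - D.y (k + i * D.p)) ≤ s := by
  have : ∀ i : ℕ, D.y (k + s + i * D.p) - D.y (k + i * D.p) =
      ∑ l ∈ Finset.range s, D.gap (k + l + i * D.p) := fun i => by
    have := D.sum_gap s (k + i * D.p)
    rw [add_right_comm k (s:ℤ), ← this]
    refine Finset.sum_congr rfl fun l _ => ?_
    congr 1; ring
  simp_rw [this]
  rw [Finset.sum_comm]
  calc _ ≤ ∑ l ∈ Finset.range s, (1 : ℝ) :=
        Finset.sum_le_sum fun l _ => D.sum_orbit_gap_le (k + l) hj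
    _ = s := by simp

lemma exists_deriv_pow_mul_gap (j : ℕ) (k : ℤ) : ∃ c ∈ Set.Icc (D.y k) (D.y (k + 1)),
    deriv ⇑(D.f ^ j) c * D.gap k = D.gap (k + j * D.p) := by
  obtain ⟨c, hc, h⟩ := (D.lift.perm_pow j).exists_deriv_mul_eq (D.mono (lt_add_one k))
  refine ⟨c, Set.Ioo_subset_Icc_self hc, ?_⟩
  rw [gap, h, D.iter_y, D.iter_y, gap]
  congr 2; ring

end Orb

/-- The times at which the multiples of `a` come closer to the integers than ever before. -/
def recordTimes (a : ℝ) : Set ℕ :=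
  {j | 0 < j ∧ ∀ i : ℕ, 0 < i → i < j → |j * a - round (j * a)| < |i * a - round (i * a)|}

lemma recordTimes_infinite {a : ℝ} (ha : Irrational a) : (recordTimes a).Infinite := by
  rw [Set.infinite_iff_exists_gt]
  intro N
  have hpos : ∀ i : ℕ, 0 < i → 0 < |i * a - round (i * a)| := by
    intro i hi
    rw [abs_pos, sub_ne_zero]
    exact (ha.natCast_mul hi.ne').ne_int _
  obtain ⟨δ, hδ, hδN⟩ : ∃ δ > 0, ∀ i : ℕ, 0 < i → i ≤ N → δ ≤ |i * a - round (i * a)| := by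
    have hne : (Finset.Icc 1 (N + 1)).Nonempty := ⟨1, by simp⟩
    obtain ⟨i0, hi0, h⟩ := Finset.exists_min_image (Finset.Icc 1 (N + 1))
      (fun i : ℕ => |i * a - round (i * a)|) hne
    rw [Finset.mem_Icc] at hi0
    exact ⟨_, hpos i0 (by omega), fun i h1 h2 => h i (by rw [Finset.mem_Icc]; omega)⟩
  obtain ⟨n, hn⟩ := exists_nat_one_div_lt hδ
  have hex : ∃ k : ℕ, 0 < k ∧ |k * a - round (k * a)| < δ := by
    obtain ⟨k, hk, -, h⟩ := Real.exists_nat_abs_mul_sub_round_le a (n := n + 1) (by omega)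
    refine ⟨k, hk, h.trans_lt (lt_of_le_of_lt ?_ hn)⟩
    push_cast
    gcongr
    linarith
  classical
  refine ⟨Nat.find hex, ⟨(Nat.find_spec hex).1, fun i h0 hi => ?_⟩, ?_⟩
  · have := Nat.find_min hex hi
    push Not at this
    exact (Nat.find_spec hex).2.trans_le (this h0)
  · by_contra! h
    exact absurd (Nat.find_spec hex).2 (not_lt.2 (hδN _ (Nat.find_spec hex).1 h))

namespace Orb
variable {B : ℕ → ℝ} (D : Orb B)

lemma M_le_of_separated (j : ℕ) (b k : ℤ) (hk : k = j * D.p - b * D.q) (hkq : |k| < D.q)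
    (hsep : ∀ i : ℕ, 0 < i → i < j → ∀ c : ℤ, |k| < |i * D.p - c * D.q|) :
    D.M ≤ Real.exp (B 0) * D.gap (j * D.p) := by
  set k1 : ℤ := min 0 (-k) with hk1
  set s : ℕ := k.natAbs + 1 with hs
  have hW : ∑ i ∈ Finset.range j, (D.y (k1 + s + i * D.p) - D.y (k1 + i * D.p)) ≤ 1 := by
    have h1 : ∀ i : ℕ, D.y (k1 + s + i * D.p) - D.y (k1 + i * D.p) =
        ∑ l ∈ Finset.range s, D.gap (k1 + i * D.p + l) := fun i => by
      rw [D.sum_gap]; congr 2; ring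
    simp_rw [h1]
    rw [← Finset.sum_product' (f := fun i l : ℕ => D.gap (k1 + i * D.p + l))]
    refine D.sum_gap_le_one _ (fun x : ℕ × ℕ => k1 + x.1 * D.p + x.2) ?_
    rintro ⟨i, l⟩ hil ⟨i', l'⟩ hil' h
    simp only [Finset.coe_product, Finset.coe_range, Set.mem_prod, Set.mem_Iio] at hil hil'
    dsimp only at h
    rw [ZMod.intCast_eq_intCast_iff_dvd_sub] at h
    obtain ⟨c, hc⟩ := h
    have key : ∀ (i l i' l' : ℕ) (c : ℤ), i < j → l < s → l' < s → i' < i →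
        (k1 + i' * D.p + l') - (k1 + i * D.p + l) = D.q * c → False := by
      intro i l i' l' c hi hl hl' hii hc
      have h2 := hsep (i - i') (by omega) (by omega) (-c)
      rw [Nat.cast_sub hii.le] at h2
      rw [show ((i:ℤ) - i') * D.p - -c * D.q = l' - l by linarith] at h2
      have hk2 := Int.abs_eq_natAbs k
      rcases abs_cases ((l':ℤ) - l) with h | h <;> omega
    rcases lt_trichotomy i i' with h3 | h3 | h3
    · exact (key i' l' i l (-c) hil'.1 hil'.2 hil.2 h3 (by linarith)).elim
    · subst h3
      have h4 : (l':ℤ) - l = D.q * c := by linarith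
      have h5 : |(l':ℤ) - l| < D.q := by
        refine lt_of_le_of_lt ?_ hkq
        have hk2 := Int.abs_eq_natAbs k
        rcases abs_cases ((l':ℤ) - l) with h | h <;> omega
      have h6 : (l':ℤ) - l = 0 := Int.eq_zero_of_abs_lt_dvd ⟨c, h4⟩ h5
      simp only [Prod.mk.injEq, true_and]; omega
    · exact (key i l i' l' c hil.1 hil.2 hil'.2 h3 hc).elim
  obtain ⟨c1, hc1, e1⟩ := D.exists_deriv_pow_mul_gap j (-k)
  obtain ⟨c2, hc2, e2⟩ := D.exists_deriv_pow_mul_gap j 0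
  have hm := D.mono.monotone
  have hI : ∀ l, k1 ≤ l → l + 1 ≤ k1 + s → Set.Icc (D.y l) (D.y (l + 1)) ⊆
      Set.Icc (D.y k1) (D.y (k1 + s)) := fun l h1 h2 => Set.Icc_subset_Icc (hm h1) (hm h2)
  have hd := D.abs_log_deriv_pow_sub_le j hW (hI _ (by omega) (by omega) hc1)
    (hI _ (by omega) (by omega) hc2)
  have p1 := (D.lift.perm_pow j).deriv_pos c1
  have p2 := (D.lift.perm_pow j).deriv_pos c2
  rw [mul_one] at hd
  have h7 : deriv ⇑(D.f ^ j) c1 ≤ Real.exp (B 0) * deriv ⇑(D.f ^ j) c2 := by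
    rw [← Real.log_le_log_iff p1 (by positivity), Real.log_mul (by positivity) p2.ne', Real.log_exp]
    linarith [(abs_le.1 hd).2]
  rw [show -k + j * D.p = 0 + b * D.q by linarith, D.gap_per, D.gap_zero] at e1
  rw [D.gap_zero, zero_add] at e2
  calc D.M = deriv ⇑(D.f ^ j) c1 * D.gap (-k) := e1.symm
    _ ≤ Real.exp (B 0) * deriv ⇑(D.f ^ j) c2 * D.M :=
      mul_le_mul h7 (D.gap_le _) (D.gap_pos _).le (by positivity)
    _ = _ := by rw [← e2]; ring

end Orb

/-- The gaps of periodic orbits tend to zero as the rotation numbers tend to an irrational. -/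
lemma exists_M_lt (B : ℕ → ℝ) (a : ℝ) (ha : Irrational a) (ε : ℝ) (hε : 0 < ε) :
    ∃ δ > 0, ∃ N : ℕ, ∀ D : Orb B, N ≤ D.q → |a - D.p / D.q| < δ → D.M < ε := by
  obtain ⟨R, hR⟩ := exists_nat_gt (Real.exp (B 0) / ε)
  obtain ⟨s, hs, hsR⟩ := (recordTimes_infinite ha).exists_subset_card_eq R
  obtain ⟨J, hJ⟩ : ∃ J : ℕ, ∀ j ∈ s, j < J :=
    ⟨s.sup id + 1, fun j hj => Nat.lt_succ_of_le (Finset.le_sup (f := id) hj)⟩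
  -- a margin for all the strict inequalities involved
  obtain ⟨m, hm, hmm⟩ : ∃ m > 0, ∀ x ∈ (Finset.range J ×ˢ Finset.range J).filter
      (fun x : ℕ × ℕ => |x.1 * a - round (x.1 * a)| < |x.2 * a - round (x.2 * a)|),
      m ≤ |x.2 * a - round (x.2 * a)| - |x.1 * a - round (x.1 * a)| := by
    rcases Finset.eq_empty_or_nonempty ((Finset.range J ×ˢ Finset.range J).filter
      (fun x : ℕ × ℕ => |x.1 * a - round (x.1 * a)| < |x.2 * a - round (x.2 * a)|)) with h | h
    · exact ⟨1, one_pos, by rw [h]; simp⟩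
    · obtain ⟨x, hx, hmin⟩ := Finset.exists_min_image _ (fun x : ℕ × ℕ =>
        |x.2 * a - round (x.2 * a)| - |x.1 * a - round (x.1 * a)|) h
      exact ⟨_, sub_pos.2 (Finset.mem_filter.1 hx).2, hmin⟩
  refine ⟨min m (1 / 2) / (2 * (J + 1)), by positivity, J, fun D hq hD => ?_⟩
  have hq0 : (0:ℝ) < D.q := by exact_mod_cast D.hq
  have hclose : ∀ i < J, |i * a - i * (D.p / D.q)| < min m (1/2) / 2 := by
    intro i hi
    rw [← mul_sub, abs_mul, Nat.abs_cast]
    have : (i:ℝ) < J := by exact_mod_cast hi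
    calc (i:ℝ) * |a - D.p / D.q| ≤ J * |a - D.p / D.q| := by gcongr
      _ ≤ J * (min m (1 / 2) / (2 * (J + 1))) := by gcongr
      _ < (J + 1) * (min m (1 / 2) / (2 * (J + 1))) := by
        have : 0 < min m (1 / 2) / (2 * ((J:ℝ) + 1)) := by positivity
        nlinarith
      _ = _ := by field_simp
  have hgap : ∀ j ∈ s, D.M ≤ Real.exp (B 0) * D.gap (0 + j * D.p) := by
    intro j hj
    obtain ⟨hj0, hrec⟩ := hs hj
    have hjJ := hJ j hj
    rw [zero_add]
    set b := round (j * a) with hb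
    have hkr : |((j * D.p - b * D.q : ℤ) : ℝ)| = |j * ((D.p : ℝ) / D.q) - b| * D.q := by
      rw [← abs_of_pos hq0, ← abs_mul, abs_of_pos hq0]
      congr 1; push_cast; field_simp
    have h1 : |j * ((D.p : ℝ) / D.q) - b| < |j * a - b| + min m (1/2) / 2 := by
      have := abs_sub_abs_le_abs_sub (j * ((D.p : ℝ) / D.q) - b) (j * a - b)
      have h2 := hclose j hjJ
      rw [abs_sub_comm] at h2
      rw [sub_sub_sub_cancel_right] at this
      linarith
    refine D.M_le_of_separated j b _ rfl ?_ ?_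
    · have h2 := abs_sub_round (j * a)
      have h3 : |j * ((D.p : ℝ) / D.q) - b| < 1 := by
        have := min_le_right m (1/2)
        linarith
      have : ((|j * D.p - b * D.q| : ℤ) : ℝ) < (D.q : ℤ) := by
        rw [Int.cast_abs, hkr, Int.cast_natCast]
        nlinarith
      exact_mod_cast this
    · intro i hi0 hij c
      have h2 := hmm (j, i) (by
        simp only [Finset.mem_filter, Finset.mem_product, Finset.mem_range]
        exact ⟨⟨hjJ, by omega⟩, hrec i hi0 hij⟩)
      dsimp only at h2
      have h3 := round_le (i * a) c
      have h4 : |i * a - c| - min m (1/2) / 2 < |i * ((D.p : ℝ) / D.q) - c| := by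
        have := abs_sub_abs_le_abs_sub (i * a - c) (i * ((D.p : ℝ) / D.q) - c)
        rw [sub_sub_sub_cancel_right] at this
        linarith [hclose i (by omega)]
      have h5 : |((i * D.p - c * D.q : ℤ) : ℝ)| = |i * ((D.p : ℝ) / D.q) - c| * D.q := by
        rw [← abs_of_pos hq0, ← abs_mul, abs_of_pos hq0]
        congr 1; push_cast; field_simp
      have h6 : ((|j * D.p - b * D.q| : ℤ) : ℝ) < (|i * D.p - c * D.q| : ℤ) := by
        rw [Int.cast_abs, Int.cast_abs, hkr, h5]
        have := min_le_left m (1/2)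
        gcongr
        linarith
      exact_mod_cast h6
  have hsum := D.sum_gap_le_one s (fun j : ℕ => 0 + j * D.p) ((D.injOn_mul_p 0).mono fun j hj => by
    have := hJ j hj
    simp; omega)
  have h1 : R * D.M ≤ Real.exp (B 0) := by
    calc R * D.M = ∑ j ∈ s, D.M := by rw [Finset.sum_const, hsR, nsmul_eq_mul]
      _ ≤ ∑ j ∈ s, Real.exp (B 0) * D.gap (0 + j * D.p) := Finset.sum_le_sum hgap
      _ = Real.exp (B 0) * ∑ j ∈ s, D.gap (0 + j * D.p) := by rw [Finset.mul_sum]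
      _ ≤ Real.exp (B 0) * 1 := by gcongr
      _ = _ := mul_one _
  rw [div_lt_iff₀ hε] at hR
  by_contra! h
  have : (R:ℝ) * ε ≤ R * D.M := by gcongr
  linarith

/-! ### Distortion of cross-ratios -/

/-- The cross-ratio of four points on a line. -/
def crossRatio (a b c d : ℝ) : ℝ := (b - a) * (d - c) / ((c - a) * (d - b))

namespace IsCircleDiffeoLift
variable {f : ℝ → ℝ} {V W : ℝ}

lemma deriv_deriv (hf : IsCircleDiffeoLift f) : deriv (deriv f) = fun x => nl f x * deriv f x := by
  ext x
  rw [nl, inv_mul_cancel_right₀ (hf.deriv_ne x)]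

lemma abs_deriv3_le (hf : IsCircleDiffeoLift f) (hV : ∀ x, |nl f x| ≤ V)
    (hW : ∀ x, |deriv (nl f) x| ≤ W) (x : ℝ) :
    |deriv (deriv (deriv f)) x| ≤ (W + V * V) * Real.exp V := by
  rw [hf.deriv_deriv, ((hf.sm_nl.hasDerivAt x).fun_mul (hf.sm.deriv.hasDerivAt x)).deriv,
    hf.deriv_deriv]
  have h0 := hf.deriv_pos x
  rw [show deriv (nl f) x * deriv f x + nl f x * (nl f x * deriv f x) =
    (deriv (nl f) x + nl f x * nl f x) * deriv f x by ring, abs_mul, abs_of_pos h0]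
  have hV0 : 0 ≤ V := (abs_nonneg _).trans (hV x)
  have hW0 : 0 ≤ W := (abs_nonneg _).trans (hW x)
  refine mul_le_mul ((abs_add_le _ _).trans (add_le_add (hW x) ?_)) (hf.deriv_le_exp hV x) h0.le
    (by positivity)
  rw [abs_mul]
  exact mul_le_mul (hV x) (hV x) (abs_nonneg _) hV0

end IsCircleDiffeoLift

/-- Second order Taylor expansion. -/
lemma abs_taylor_two_le {f : ℝ → ℝ} (hf : Sm f) {K : ℝ}
    (hK : ∀ x, |deriv (deriv (deriv f)) x| ≤ K) (y h : ℝ) :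
    |f y - f (y - h) - (deriv f y * h - deriv (deriv f) y * h ^ 2 / 2)| ≤ K * |h| ^ 3 := by
  have hK0 : 0 ≤ K := (abs_nonneg _).trans (hK 0)
  have e : ∀ s, HasDerivAt (fun s : ℝ => y - s) (-1) s := fun s => by
    simpa using (hasDerivAt_id s).const_sub y
  have d0 : ∀ s, HasDerivAt (fun s => f (y - s)) (-deriv f (y - s)) s := fun s => by
    exact (HasDerivAt.comp (h₂ := f) s (hf.hasDerivAt (y - s)) (e s)).congr_deriv (by ring)
  have d1 : ∀ s, HasDerivAt (fun s => deriv f (y - s)) (-deriv (deriv f) (y - s)) s := fun s => by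
    exact (HasDerivAt.comp (h₂ := deriv f) s (hf.deriv.hasDerivAt (y - s)) (e s)).congr_deriv (by ring)
  have hs : ∀ s ∈ Set.uIcc 0 h, |s| ≤ |h| := fun s hs => by
    rcases Set.mem_uIcc.1 hs with h1 | h1 <;> rw [abs_le] <;>
      rcases abs_cases h with h2 | h2 <;> constructor <;> linarith [h1.1, h1.2]
  have b2 : ∀ s ∈ Set.uIcc 0 h, |deriv (deriv f) (y - s) - deriv (deriv f) y| ≤ K * |h| := by
    intro s hs'
    have := convex_univ.norm_image_sub_le_of_norm_hasDerivWithin_le (f := deriv (deriv f)) (C := K)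
      (fun x _ => (hf.deriv.deriv.hasDerivAt x).hasDerivWithinAt) (fun x _ => hK x)
      (Set.mem_univ y) (Set.mem_univ (y - s))
    refine this.trans ?_
    rw [sub_sub_cancel_left, norm_neg]
    exact mul_le_mul_of_nonneg_left (hs s hs') hK0
  have b1 : ∀ s ∈ Set.uIcc 0 h,
      |deriv f y - deriv f (y - s) - deriv (deriv f) y * s| ≤ K * |h| * |h| := by
    intro s hs'
    have := (convex_uIcc 0 h).norm_image_sub_le_of_norm_hasDerivWithin_le (C := K * |h|)
      (f := fun s => deriv f y - deriv f (y - s) - deriv (deriv f) y * s)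
      (f' := fun s => deriv (deriv f) (y - s) - deriv (deriv f) y)
      (fun s _ => ((((d1 s).const_sub _).fun_sub
        ((hasDerivAt_id s).const_mul _)).congr_deriv (by ring)).hasDerivWithinAt)
      b2 (Set.left_mem_uIcc) hs'
    simp only [sub_zero, sub_self, mul_zero, Real.norm_eq_abs] at this
    exact this.trans (mul_le_mul_of_nonneg_left (hs s hs') (by positivity))
  have := (convex_uIcc 0 h).norm_image_sub_le_of_norm_hasDerivWithin_le (C := K * |h| * |h|)
      (f := fun s => f y - f (y - s) - (deriv f y * s - deriv (deriv f) y * s ^ 2 / 2))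
      (f' := fun s => -(deriv f y - deriv f (y - s) - deriv (deriv f) y * s))
      (fun s _ => ((((d0 s).const_sub _).fun_sub (((hasDerivAt_id s).const_mul _).fun_sub
        ((((hasDerivAt_id s).pow 2).const_mul (deriv (deriv f) y)).div_const 2))).congr_deriv
          (by simp; ring)).hasDerivWithinAt)
      (fun s hs => by rw [norm_neg]; exact b1 s hs) (Set.left_mem_uIcc) (Set.right_mem_uIcc)
  simp only [sub_zero, sub_self, mul_zero, Real.norm_eq_abs] at this
  have h3 : K * |h| * |h| * |h| = K * |h| ^ 3 := by ring
  rw [← h3]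
  simpa using this

namespace IsCircleDiffeoLift
variable {f : ℝ → ℝ} {V W : ℝ}

lemma exp_mul_le_sub (hf : IsCircleDiffeoLift f) (hV : ∀ x, |nl f x| ≤ V) (y h : ℝ) :
    Real.exp (-V) * |h| ≤ |f y - f (y - h)| := by
  rcases lt_trichotomy h 0 with h0 | h0 | h0
  · obtain ⟨c, -, hc⟩ := hf.exists_deriv_mul_eq (show y < y - h by linarith)
    rw [abs_sub_comm, ← hc, abs_mul, abs_of_pos (hf.deriv_pos c), sub_sub_cancel_left, abs_neg]
    exact mul_le_mul_of_nonneg_right (hf.exp_le_deriv hV c) (abs_nonneg _)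
  · simp [h0]
  · obtain ⟨c, -, hc⟩ := hf.exists_deriv_mul_eq (show y - h < y by linarith)
    rw [← hc, abs_mul, abs_of_pos (hf.deriv_pos c), sub_sub_cancel]
    exact mul_le_mul_of_nonneg_right (hf.exp_le_deriv hV c) (abs_nonneg _)

end IsCircleDiffeoLift

lemma exists_deriv_log_slope_bound (V W : ℝ) : ∃ C, 0 ≤ C ∧ ∀ f : ℝ → ℝ, IsCircleDiffeoLift f →
    (∀ x, |nl f x| ≤ V) → (∀ x, |deriv (nl f) x| ≤ W) → ∀ y h : ℝ, h ≠ 0 → |h| ≤ 1 →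
    |deriv f y / (f y - f (y - h)) - 1 / h - nl f y / 2| ≤ C * |h| := by
  set K := (|W| + V * V) * Real.exp V * Real.exp V with hK
  have hK0 : 0 ≤ K := by have := mul_self_nonneg V; positivity
  refine ⟨(|V| * (|V| + K) + K) * (Real.exp V * Real.exp V), by positivity,
    fun f hf hV hW y h h0 h1 => ?_⟩
  have hW0 : 0 ≤ W := (abs_nonneg _).trans (hW 0)
  have hV0 : 0 ≤ V := (abs_nonneg _).trans (hV 0)
  rw [abs_of_nonneg hW0] at hK
  rw [abs_of_nonneg hV0]
  have hd := hf.deriv_pos y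
  set u := (f y - f (y - h)) / deriv f y with hu
  have ht := abs_taylor_two_le hf.sm (hf.abs_deriv3_le hV hW) y h
  have hfu : f y - f (y - h) = deriv f y * u := by rw [hu]; field_simp
  have hR : |u - (h - nl f y * h ^ 2 / 2)| ≤ K * |h| ^ 3 := by
    rw [hfu, hf.deriv_deriv] at ht
    rw [show deriv f y * u - (deriv f y * h - nl f y * deriv f y * h ^ 2 / 2) =
      deriv f y * (u - (h - nl f y * h ^ 2 / 2)) by ring, abs_mul, abs_of_pos hd] at ht
    have h5 := mul_le_mul_of_nonneg_right (hf.exp_le_deriv hV y)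
      (abs_nonneg (u - (h - nl f y * h ^ 2 / 2)))
    have h6 : Real.exp V * Real.exp (-V) = 1 := by rw [← Real.exp_add]; simp
    calc _ = Real.exp V * (Real.exp (-V) * |u - (h - nl f y * h ^ 2 / 2)|) := by
          rw [← mul_assoc, h6, one_mul]
      _ ≤ Real.exp V * ((W + V * V) * Real.exp V * |h| ^ 3) := by
          exact mul_le_mul_of_nonneg_left (h5.trans ht) (Real.exp_pos V).le
      _ = _ := by rw [hK]; ring
  have hul : |h| ≤ Real.exp V * Real.exp V * |u| := by
    have h7 := hf.exp_mul_le_sub hV y h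
    rw [hfu, abs_mul, abs_of_pos hd] at h7
    have h6 : Real.exp V * Real.exp (-V) = 1 := by rw [← Real.exp_add]; simp
    calc |h| = Real.exp V * (Real.exp (-V) * |h|) := by rw [← mul_assoc, h6, one_mul]
      _ ≤ Real.exp V * (deriv f y * |u|) := by gcongr
      _ ≤ Real.exp V * (Real.exp V * |u|) := by gcongr; exact hf.deriv_le_exp hV y
      _ = _ := by ring
  have hh : 0 < |h| := abs_pos.2 h0
  have hu0 : u ≠ 0 := by
    rintro h8
    rw [h8, abs_zero, mul_zero] at hul
    linarith
  have hu1 : 0 < |u| := abs_pos.2 hu0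
  set R := u - (h - nl f y * h ^ 2 / 2) with hRd
  have huh : |h - u| ≤ (V + K) * |h| ^ 2 := by
    have : h - u = nl f y * h ^ 2 / 2 - R := by rw [hRd]; ring
    rw [this]
    refine (abs_sub _ _).trans ?_
    rw [abs_div, abs_mul, abs_pow, abs_two]
    have h9 : |nl f y| * |h| ^ 2 / 2 ≤ V * |h| ^ 2 := by
      have : |nl f y| * |h| ^ 2 ≤ V * |h| ^ 2 := by gcongr; exact hV y
      have : 0 ≤ |nl f y| * |h| ^ 2 := by positivity
      linarith
    have h10 : K * |h| ^ 3 ≤ K * |h| ^ 2 :=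
      mul_le_mul_of_nonneg_left (pow_le_pow_of_le_one hh.le h1 (by norm_num)) hK0
    linarith
  have key : deriv f y / (f y - f (y - h)) - 1 / h - nl f y / 2 =
      (nl f y / 2 * (h * (h - u)) - R) / (u * h) := by
    rw [hfu, hRd]
    field_simp
    ring
  rw [key, abs_div, abs_mul u h, div_le_iff₀ (by positivity)]
  calc |nl f y / 2 * (h * (h - u)) - R| ≤ |nl f y / 2| * (|h| * |h - u|) + |R| := by
        refine (abs_sub _ _).trans ?_
        rw [abs_mul, abs_mul]
    _ ≤ V * (|h| * ((V + K) * |h| ^ 2)) + K * |h| ^ 3 := by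
        have : |nl f y / 2| ≤ V := by
          rw [abs_div, abs_two]; linarith [hV y, abs_nonneg (nl f y)]
        gcongr
    _ = (V * (V + K) + K) * |h| ^ 2 * |h| := by ring
    _ ≤ (V * (V + K) + K) * |h| ^ 2 * (Real.exp V * Real.exp V * |u|) := by gcongr
    _ = _ := by ring

/-- Diffeomorphisms distort cross-ratios by little. -/
lemma exists_crossRatio_bound (V W : ℝ) : ∃ C, 0 ≤ C ∧ ∀ f : ℝ → ℝ, IsCircleDiffeoLift f →
    (∀ x, |nl f x| ≤ V) → (∀ x, |deriv (nl f) x| ≤ W) → ∀ a b c d : ℝ, a < b → b < c → c < d →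
    d - a ≤ 1 → |Real.log (crossRatio (f a) (f b) (f c) (f d)) - Real.log (crossRatio a b c d)| ≤
      C * (d - a) * (c - b) := by
  obtain ⟨C, hC0, hC⟩ := exists_deriv_log_slope_bound V W
  refine ⟨C, hC0, fun f hf hV hW a b c d hab hbc hcd hda => ?_⟩
  have hm := hf.strictMono
  have key : ∀ f : ℝ → ℝ, StrictMono f → Real.log (crossRatio (f a) (f b) (f c) (f d)) =
      Real.log (f b - f a) - Real.log (f d - f b) - (Real.log (f c - f a) - Real.log (f d - f c)) := by
    intro f hm
    have h1 := sub_pos.2 (hm hab)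
    have h2 := sub_pos.2 (hm hcd)
    have h3 := sub_pos.2 (hm (hab.trans hbc))
    have h4 := sub_pos.2 (hm (hbc.trans hcd))
    rw [crossRatio, Real.log_div (by positivity) (by positivity), Real.log_mul h1.ne' h2.ne',
      Real.log_mul h3.ne' h4.ne']
    ring
  have key2 := key (fun x => x) strictMono_id
  rw [key f hm, key2]
  set Ψ : ℝ → ℝ := fun y => (Real.log (f y - f a) - Real.log (f d - f y)) -
    (Real.log (y - a) - Real.log (d - y)) with hΨ
  have hd : ∀ y ∈ Set.Icc b c, HasDerivWithinAt Ψ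
      ((deriv f y / (f y - f (y - (y - a))) - 1 / (y - a) - nl f y / 2) -
        (deriv f y / (f y - f (y - (y - d))) - 1 / (y - d) - nl f y / 2)) (Set.Icc b c) y := by
    intro y hy
    have l1 := sub_pos.2 (hm (hab.trans_le hy.1))
    have l2 := sub_pos.2 (hm (hy.2.trans_lt hcd))
    have l3 := sub_pos.2 (hab.trans_le hy.1)
    have l4 := sub_pos.2 (hy.2.trans_lt hcd)
    have d1 := ((hf.sm.hasDerivAt y).sub_const (f a)).log l1.ne'
    have d2 := ((hf.sm.hasDerivAt y).const_sub (f d)).log l2.ne'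
    have d3 := ((hasDerivAt_id y).sub_const a).log l3.ne'
    have d4 := ((hasDerivAt_id y).const_sub d).log l4.ne'
    refine (((d1.fun_sub d2).fun_sub (d3.fun_sub d4)).congr_deriv ?_).hasDerivWithinAt
    rw [sub_sub_cancel, sub_sub_cancel]
    rw [← neg_sub (f d) (f y), ← neg_sub d y, div_neg, div_neg, neg_div]
    simp only [id]
    ring
  have hb : ∀ y ∈ Set.Icc b c, ‖(deriv f y / (f y - f (y - (y - a))) - 1 / (y - a) - nl f y / 2) -
        (deriv f y / (f y - f (y - (y - d))) - 1 / (y - d) - nl f y / 2)‖ ≤ C * (d - a) := by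
    intro y hy
    have l3 := sub_pos.2 (hab.trans_le hy.1)
    have l4 := sub_pos.2 (hy.2.trans_lt hcd)
    have e1 := hC f hf hV hW y (y - a) l3.ne' (by rw [abs_of_pos l3]; linarith)
    have e2 := hC f hf hV hW y (y - d) (by linarith) (by rw [abs_sub_comm, abs_of_pos l4]; linarith)
    rw [abs_of_pos l3] at e1
    rw [abs_sub_comm y d, abs_of_pos l4] at e2
    refine (norm_sub_le _ _).trans ((add_le_add e1 e2).trans ?_)
    exact le_of_eq (by ring)
  have := (convex_Icc b c).norm_image_sub_le_of_norm_hasDerivWithin_le hd hb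
    (Set.right_mem_Icc.2 hbc.le) (Set.left_mem_Icc.2 hbc.le)
  rw [Real.norm_eq_abs, Real.norm_eq_abs, abs_sub_comm b c, abs_of_pos (sub_pos.2 hbc)] at this
  refine le_trans (le_of_eq ?_) this
  congr 1
  simp only [hΨ]; ring

namespace Orb
variable {B : ℕ → ℝ} (D : Orb B)

/-- The cross-ratio of four consecutive points of the orbit. -/
def cr (k : ℤ) : ℝ := crossRatio (D.y (k - 1)) (D.y k) (D.y (k + 1)) (D.y (k + 2))

/-- The position of `y (k + 1)` inside `[y k, y (k + 2)]`. -/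
def pos (k : ℤ) : ℝ := D.gap k / (D.gap k + D.gap (k + 1))

lemma cr_eq (k : ℤ) : D.cr k = D.pos (k - 1) * (1 - D.pos k) := by
  have h0 := D.gap_pos (k - 1)
  have h1 := D.gap_pos k
  have h2 := D.gap_pos (k + 1)
  have e0 : D.y k - D.y (k - 1) = D.gap (k - 1) := by rw [gap, sub_add_cancel]
  have e1 : D.y (k + 2) - D.y (k + 1) = D.gap (k + 1) := by rw [gap]; ring_nf
  have e2 : D.y (k + 1) - D.y (k - 1) = D.gap (k - 1) + D.gap k := by rw [← e0, gap]; ring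
  have e3 : D.y (k + 2) - D.y k = D.gap k + D.gap (k + 1) := by rw [← e1, gap]; ring
  rw [cr, crossRatio, e0, e1, e2, e3, pos, pos, sub_add_cancel]
  field_simp
  ring

lemma pos_congr {k l : ℤ} (h : (k : ZMod D.q) = l) : D.pos k = D.pos l := by
  rw [pos, pos, D.gap_congr h, D.gap_congr (k := k + 1) (l := l + 1) (by push_cast; rw [h])]

lemma cr_congr {k l : ℤ} (h : (k : ZMod D.q) = l) : D.cr k = D.cr l := by
  rw [cr_eq, cr_eq, D.pos_congr h, D.pos_congr (k := k - 1) (l := l - 1) (by push_cast; rw [h])]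

lemma pos_pos (k : ℤ) : 0 < D.pos k := by
  have h1 := D.gap_pos k
  have h2 := D.gap_pos (k + 1)
  rw [pos]; positivity

lemma pos_lt_one (k : ℤ) : D.pos k < 1 := by
  have h1 := D.gap_pos k
  have h2 := D.gap_pos (k + 1)
  rw [pos, div_lt_one (by positivity)]; linarith

lemma cr_pos (k : ℤ) : 0 < D.cr k := by
  rw [cr_eq]; exact mul_pos (D.pos_pos _) (sub_pos.2 (D.pos_lt_one _))

lemma log_cr_shift {C : ℝ} (hM : 3 * D.M ≤ 1)
    (hC : ∀ a b c d : ℝ, a < b → b < c → c < d → d - a ≤ 1 →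
      |Real.log (crossRatio (D.f a) (D.f b) (D.f c) (D.f d)) - Real.log (crossRatio a b c d)| ≤
      C * (d - a) * (c - b)) (hC0 : 0 ≤ C) (k : ℤ) (j : ℕ) :
    |Real.log (D.cr (k + j * D.p)) - Real.log (D.cr k)| ≤
      3 * C * D.M * ∑ i ∈ Finset.range j, D.gap (k + i * D.p) := by
  induction j with
  | zero => simp
  | succ j ih =>
    rw [Finset.sum_range_succ, mul_add]
    set l := k + j * D.p with hl
    have h3 : D.y (l + 2) - D.y (l - 1) ≤ 3 * D.M := by
      have h0 := D.gap_le (l - 1)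
      have h1 := D.gap_le l
      have h2 := D.gap_le (l + 1)
      rw [gap] at h0 h1 h2
      rw [sub_add_cancel] at h0
      rw [add_assoc, show (1:ℤ) + 1 = 2 by norm_num] at h2
      linarith
    have h := hC (D.y (l - 1)) (D.y l) (D.y (l + 1)) (D.y (l + 2)) (D.mono (by omega))
      (D.mono (by omega)) (D.mono (by omega)) (h3.trans hM)
    rw [D.shift, D.shift, D.shift, D.shift] at h
    have e : D.cr (k + (j + 1 : ℕ) * D.p) = crossRatio (D.y (l - 1 + D.p)) (D.y (l + D.p))
        (D.y (l + 1 + D.p)) (D.y (l + 2 + D.p)) := by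
      rw [cr, hl]; push_cast; congr 2 <;> ring
    rw [← e] at h
    have h4 : C * (D.y (l + 2) - D.y (l - 1)) * (D.y (l + 1) - D.y l) ≤
        3 * C * D.M * D.gap l := by
      rw [gap]
      refine mul_le_mul_of_nonneg_right ?_ (D.gap_pos l).le
      nlinarith
    have h5 := abs_sub_le (Real.log (D.cr (k + (j + 1 : ℕ) * D.p))) (Real.log (D.cr l))
      (Real.log (D.cr k))
    rw [cr] at h5
    rw [cr] at h
    unfold cr at *
    linarith

lemma exists_cr_ge (B : ℕ → ℝ) : ∃ C, 0 ≤ C ∧ ∀ D : Orb B, 3 * D.M ≤ 1 → ∀ k,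
    1 / 4 - C * D.M ≤ D.cr k := by
  obtain ⟨C, hC0, hC⟩ := exists_crossRatio_bound (B 0) (B 1)
  refine ⟨3 * C / 4, by positivity, fun D hM l => ?_⟩
  obtain ⟨k, hk⟩ := exists_max_of_periodic (fun k => -D.gap k) D.q D.hq
    fun k => by have := D.gap_per k 1; rw [one_mul] at this; rw [this]
  simp only [neg_le_neg_iff] at hk
  have h1 : 1 / 4 ≤ D.cr k := by
    have a1 := D.gap_pos k
    have a2 := D.gap_pos (k - 1)
    have a3 := D.gap_pos (k + 1)
    have b1 : 1 / 2 ≤ D.pos (k - 1) := by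
      rw [pos, sub_add_cancel, div_le_div_iff₀ (by positivity) (by positivity)]
      linarith [hk (k - 1)]
    have b2 : D.pos k ≤ 1 / 2 := by
      rw [pos, div_le_div_iff₀ (by positivity) (by positivity)]
      linarith [hk (k + 1)]
    rw [cr_eq]; nlinarith
  obtain ⟨j, hj, hj2⟩ := D.exists_mul_p k l
  have h2 := D.log_cr_shift hM (hC D.f D.lift D.abs_nl_le
    fun x => by simpa using D.bd 1 x 1 le_rfl) hC0 k j
  rw [D.cr_congr hj2] at h2
  have h3 := D.sum_orbit_gap_le k hj.le
  have hM0 := D.M_pos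
  have h4 : 3 * C * D.M * ∑ i ∈ Finset.range j, D.gap (k + i * D.p) ≤ 3 * C * D.M :=
    mul_le_of_le_one_right (by positivity) h3
  have h5 : Real.log (D.cr k) - 3 * C * D.M ≤ Real.log (D.cr l) := by
    linarith [neg_abs_le (Real.log (D.cr l) - Real.log (D.cr k))]
  have h6 := Real.exp_le_exp.2 h5
  rw [Real.exp_log (D.cr_pos l), sub_eq_add_neg, Real.exp_add, Real.exp_log (D.cr_pos k)] at h6
  have h7 := Real.add_one_le_exp (-(3 * C * D.M))
  have h8 := Real.exp_pos (-(3 * C * D.M))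
  nlinarith

/-- Neighbouring gaps are almost equal. -/
lemma exists_gap_ratio (B : ℕ → ℝ) : ∃ C M₀, 0 ≤ C ∧ 0 < M₀ ∧ ∀ D : Orb B, D.M ≤ M₀ → ∀ k,
    |D.gap (k + 1) - D.gap k| ≤ C * √D.M * D.gap k ∧
    |D.gap (k + 1) - D.gap k| ≤ C * √D.M * D.gap (k + 1) := by
  obtain ⟨C, hC0, hC⟩ := exists_cr_ge B
  set S := √C with hS
  have hS0 : 0 ≤ S := Real.sqrt_nonneg _
  refine ⟨6 * S, min (1 / 3) (1 / (64 * (C + 1))), by positivity, by positivity, fun D hM k => ?_⟩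
  have hM0 := D.M_pos
  have hM1 : 3 * D.M ≤ 1 := by linarith [hM.trans (min_le_left _ _)]
  have hM2 := hM.trans (min_le_right _ _)
  rw [le_div_iff₀ (by positivity)] at hM2
  have hσ : √D.M ^ 2 = D.M := Real.sq_sqrt hM0.le
  have hσ0 : 0 ≤ √D.M := Real.sqrt_nonneg _
  set σ := √D.M with hσd
  have hS2 : S ^ 2 = C := Real.sq_sqrt hC0
  have hSσ0 : 0 ≤ S * σ := by positivity
  have hSσ : S * σ ≤ 1 / 8 := by
    refine abs_le_of_sq_le_sq' ?_ (by norm_num) |>.2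
    rw [mul_pow, hS2, hσ]; nlinarith
  have per : ∀ k, D.pos (k + D.q) = D.pos k := fun k => D.pos_congr (by simp)
  obtain ⟨k1, hk1⟩ := exists_max_of_periodic D.pos D.q D.hq per
  obtain ⟨k2, hk2⟩ := exists_max_of_periodic (fun k => -D.pos k) D.q D.hq
    fun k => by rw [per]
  simp only [neg_le_neg_iff] at hk2
  have key : ∀ x : ℝ, 1 / 4 - C * D.M ≤ x * (1 - x) → |x - 1 / 2| ≤ S * σ := by
    intro x hx
    refine abs_le_of_sq_le_sq ?_ hSσ0
    rw [mul_pow, hS2, hσ]; nlinarith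
  have c1 := hC D hM1 k1
  have c2 := hC D hM1 (k2 + 1)
  rw [cr_eq] at c1 c2
  rw [add_sub_cancel_right] at c2
  have u1 := key (D.pos k1) (c1.trans (mul_le_mul_of_nonneg_right (hk1 _)
    (sub_pos.2 (D.pos_lt_one _)).le))
  have u2 := key (D.pos k2) (c2.trans (mul_le_mul_of_nonneg_left (by linarith [hk2 (k2 + 1)])
    (D.pos_pos _).le))
  have hp : |D.pos k - 1 / 2| ≤ S * σ := by
    rw [abs_le] at u1 u2 ⊢
    constructor <;> linarith [hk1 k, hk2 k]
  have g1 := D.gap_pos k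
  have g2 := D.gap_pos (k + 1)
  have e : D.gap (k + 1) - D.gap k = -(D.gap k + D.gap (k + 1)) * (2 * (D.pos k - 1 / 2)) := by
    rw [pos]; field_simp; ring
  have hb : |D.gap (k + 1) - D.gap k| ≤ (D.gap k + D.gap (k + 1)) * (2 * (S * σ)) := by
    rw [e, abs_mul, abs_neg, abs_mul, abs_two, abs_of_pos (by positivity)]
    gcongr
  have hb2 : |D.gap (k + 1) - D.gap k| ≤ (D.gap k + D.gap (k + 1)) / 4 := by nlinarith
  rw [abs_le] at hb2
  constructor
  · refine hb.trans ?_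
    nlinarith
  · refine hb.trans ?_
    nlinarith

end Orb

namespace Orb
variable {B : ℕ → ℝ} (D : Orb B)

/-- The square root of the largest gap. -/
def sig : ℝ := √D.M

lemma sig_pos : 0 < D.sig := Real.sqrt_pos.2 D.M_pos

lemma sig_sq : D.sig ^ 2 = D.M := Real.sq_sqrt D.M_pos.le

lemma sig_le {s : ℝ} (hs : 0 ≤ s) (h : D.M ≤ s ^ 2) : D.sig ≤ s :=
  (Real.sqrt_le_sqrt h).trans_eq (Real.sqrt_sq hs)

lemma exists_gap_near (B : ℕ → ℝ) (R : ℕ) : ∃ C M₀, 0 ≤ C ∧ 0 < M₀ ∧ ∀ D : Orb B, D.M ≤ M₀ →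
    ∀ k d : ℤ, |d| ≤ R → |D.gap (k + d) - D.gap k| ≤ C * D.sig * D.gap k := by
  obtain ⟨C, M0, hC, hM0, h⟩ := exists_gap_ratio B
  suffices hn : ∃ C', 0 ≤ C' ∧ ∀ D : Orb B, D.M ≤ min M0 1 → ∀ (n : ℕ), n ≤ R → ∀ k : ℤ,
      |D.gap (k + n) - D.gap k| ≤ C' * D.sig * D.gap k ∧
      |D.gap (k - n) - D.gap k| ≤ C' * D.sig * D.gap k by
    obtain ⟨C', hC', hh⟩ := hn
    refine ⟨C', min M0 1, hC', by positivity, fun D hM k d hd => ?_⟩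
    rcases Int.eq_nat_or_neg d with ⟨n, rfl | rfl⟩
    · exact (hh D hM n (by simpa using hd) k).1
    · exact (hh D hM n (by simpa using hd) k).2
  induction R with
  | zero =>
    refine ⟨0, le_rfl, fun D _ n hn k => ?_⟩
    obtain rfl : n = 0 := by omega
    simp
  | succ R ih =>
    obtain ⟨C', hC', hh⟩ := ih
    refine ⟨C' + C * (1 + C'), by positivity, fun D hM n hn k => ?_⟩
    have g := D.gap_pos k
    have s0 := D.sig_pos
    have s1 : D.sig ≤ 1 := D.sig_le zero_le_one (by simpa using hM.trans (min_le_right _ _))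
    have hr := h D (hM.trans (min_le_left _ _))
    change ∀ k, |D.gap (k + 1) - D.gap k| ≤ C * D.sig * D.gap k ∧
      |D.gap (k + 1) - D.gap k| ≤ C * D.sig * D.gap (k + 1) at hr
    have step : ∀ u v : ℝ, |v - D.gap k| ≤ C' * D.sig * D.gap k → |u - v| ≤ C * D.sig * v →
        |u - D.gap k| ≤ (C' + C * (1 + C')) * D.sig * D.gap k := by
      intro u v h1 h2
      have h3 : v ≤ (1 + C') * D.gap k := by
        have h4 : C' * D.sig * D.gap k ≤ C' * 1 * D.gap k := by gcongr
        linarith [le_abs_self (v - D.gap k)]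
      have h5 : C * D.sig * v ≤ C * D.sig * ((1 + C') * D.gap k) := by gcongr
      calc _ ≤ |u - v| + |v - D.gap k| := abs_sub_le _ _ _
        _ ≤ C * D.sig * ((1 + C') * D.gap k) + C' * D.sig * D.gap k := by linarith
        _ = _ := by ring
    rcases Nat.eq_zero_or_pos n with rfl | hn0
    · simp; positivity
    · obtain ⟨m, rfl⟩ : ∃ m, n = m + 1 := ⟨n - 1, by omega⟩
      have hm := hh D hM m (by omega) k
      constructor
      · refine step _ _ hm.1 ?_
        have := (hr (k + m)).1
        push_cast; rw [← add_assoc]; exact this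
      · refine step _ _ hm.2 ?_
        have := (hr (k - m - 1)).2
        rw [sub_add_cancel] at this
        push_cast; rw [← sub_sub, abs_sub_comm]; exact this

lemma exists_y_near (B : ℕ → ℝ) (R : ℕ) : ∃ C M₀, 0 ≤ C ∧ 0 < M₀ ∧ ∀ D : Orb B, D.M ≤ M₀ →
    ∀ d : ℤ, |d| ≤ R → |D.gap d - D.M| ≤ C * D.sig * D.M ∧
      |D.y d - D.y 0 - d * D.M| ≤ C * D.sig * D.M := by
  obtain ⟨C, M0, hC, hM0, h⟩ := exists_gap_near B R
  refine ⟨C * (R + 1), M0, by positivity, hM0, fun D hM => ?_⟩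
  have hg : ∀ d : ℤ, |d| ≤ R → |D.gap d - D.M| ≤ C * D.sig * D.M := fun d hd => by
    have := h D hM 0 d hd
    rwa [zero_add, D.gap_zero] at this
  have s0 := D.sig_pos
  have m0 := D.M_pos
  have e0 : 0 ≤ C * D.sig * D.M := by positivity
  have hy : ∀ n : ℕ, n ≤ R → |D.y n - D.y 0 - n * D.M| ≤ n * (C * D.sig * D.M) ∧
      |D.y (-n) - D.y 0 + n * D.M| ≤ n * (C * D.sig * D.M) := by
    intro n hn
    induction n with
    | zero => simp
    | succ n ih =>
      have ih := ih (by omega)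
      have g1 := hg n (by simp; omega)
      have g2 := hg (-n - 1) (by
        rw [show -(n:ℤ) - 1 = -((n + 1 : ℕ) : ℤ) by push_cast; ring, abs_neg, Nat.abs_cast]; omega)
      rw [gap] at g1 g2
      rw [sub_add_cancel] at g2
      push_cast
      rw [neg_add, ← sub_eq_add_neg]
      constructor
      · have := abs_add_le (D.y n - D.y 0 - n * D.M) (D.y (n + 1) - D.y n - D.M)
        rw [show D.y n - D.y 0 - n * D.M + (D.y (n + 1) - D.y n - D.M) =
          D.y (n + 1) - D.y 0 - (n + 1) * D.M by ring] at this
        linarith [ih.1]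
      · have := abs_sub (D.y (-n) - D.y 0 + n * D.M) (D.y (-n) - D.y (-n - 1) - D.M)
        rw [show D.y (-n) - D.y 0 + n * D.M - (D.y (-n) - D.y (-n - 1) - D.M) =
          D.y (-n - 1) - D.y 0 + (n + 1) * D.M by ring] at this
        linarith [ih.2]
  intro d hd
  constructor
  · refine (hg d hd).trans ?_
    have : (0:ℝ) ≤ R := by positivity
    nlinarith
  · have key : ∀ n : ℕ, n ≤ R → n * (C * D.sig * D.M) ≤ C * (R + 1) * D.sig * D.M := by
      intro n hn
      have : (n:ℝ) ≤ R := by exact_mod_cast hn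
      nlinarith
    rcases Int.eq_nat_or_neg d with ⟨n, rfl | rfl⟩
    · have hn : n ≤ R := by simpa using hd
      exact_mod_cast (hy n hn).1.trans (key n hn)
    · have hn : n ≤ R := by simpa using hd
      have := (hy n hn).2.trans (key n hn)
      push_cast
      rwa [neg_mul, sub_neg_eq_add]

/-- The interval `[y (-R), y R]`. -/
def J (R : ℕ) : Set ℝ := Set.Icc (D.y (-R)) (D.y R)

lemma gap_subset_J {R : ℕ} {k : ℤ} (h1 : -R ≤ k) (h2 : k + 1 ≤ R) :
    Set.Icc (D.y k) (D.y (k + 1)) ⊆ D.J R :=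
  Set.Icc_subset_Icc (D.mono.monotone h1) (D.mono.monotone h2)

lemma J_length (R : ℕ) {x y : ℝ} (hx : x ∈ D.J R) (hy : y ∈ D.J R) :
    |x - y| ≤ 2 * R * D.M := by
  have h := D.sum_gap (2 * R) (-R)
  have h2 : ∑ i ∈ Finset.range (2 * R), D.gap (-R + i) ≤ ∑ i ∈ Finset.range (2 * R), D.M :=
    Finset.sum_le_sum fun i _ => D.gap_le _
  rw [h] at h2
  simp only [Finset.sum_const, Finset.card_range, nsmul_eq_mul] at h2
  push_cast at h2
  rw [show -(R:ℤ) + 2 * R = R by ring] at h2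
  rw [abs_le]
  constructor <;> linarith [hx.1, hx.2, hy.1, hy.2]

lemma abs_log_deriv_pow_sub_le_of_J {R j : ℕ} (hj : j ≤ D.q) {x y : ℝ} (hx : x ∈ D.J R)
    (hy : y ∈ D.J R) : |Real.log (deriv ⇑(D.f ^ j) x) - Real.log (deriv ⇑(D.f ^ j) y)| ≤
      B 0 * (2 * R) := by
  have h := D.sum_orbit_le (-R) (2 * R) hj
  have e : (-R : ℤ) + (2 * R : ℕ) = R := by push_cast; ring
  push_cast at h
  refine D.abs_log_deriv_pow_sub_le j (k := -R) (s := 2 * R) (W := 2 * R) (by exact_mod_cast h) ?_ ?_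
  · rw [e]; exact hx
  · rw [e]; exact hy

lemma deriv_pow_le {R j : ℕ} (hR : 1 ≤ R) (hj : j ≤ D.q) {x : ℝ} (hx : x ∈ D.J R) :
    deriv ⇑(D.f ^ j) x ≤ Real.exp (B 0 * (2 * R)) * (D.gap (j * D.p) / D.M) := by
  obtain ⟨c, hc, h⟩ := D.exists_deriv_pow_mul_gap j 0
  rw [zero_add, D.gap_zero] at h
  have hcJ : c ∈ D.J R := D.gap_subset_J (by omega) (by omega) hc
  have h1 := D.abs_log_deriv_pow_sub_le_of_J hj hx hcJ
  have hp := (D.lift.perm_pow j).deriv_pos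
  have h2 : Real.log (deriv ⇑(D.f ^ j) x) ≤ B 0 * (2 * R) + Real.log (deriv ⇑(D.f ^ j) c) := by
    linarith [le_abs_self (Real.log (deriv ⇑(D.f ^ j) x) - Real.log (deriv ⇑(D.f ^ j) c))]
  have h3 := Real.exp_le_exp.2 h2
  rw [Real.exp_add, Real.exp_log (hp x), Real.exp_log (hp c)] at h3
  rwa [← h, mul_div_assoc, div_self D.M_pos.ne', mul_one]

lemma deriv_pow_le_const {R j : ℕ} (hR : 1 ≤ R) (hj : j ≤ D.q) {x : ℝ} (hx : x ∈ D.J R) :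
    deriv ⇑(D.f ^ j) x ≤ Real.exp (B 0 * (2 * R)) :=
  (D.deriv_pow_le hR hj hx).trans (mul_le_of_le_one_right (Real.exp_pos _).le
    (div_le_one_of_le₀ (D.gap_le _) D.M_pos.le))

lemma sum_deriv_pow_sq_le {R j : ℕ} (hR : 1 ≤ R) (hj : j ≤ D.q) {x : ℝ} (hx : x ∈ D.J R) :
    ∑ i ∈ Finset.range j, deriv ⇑(D.f ^ i) x ^ 2 ≤ Real.exp (B 0 * (2 * R)) ^ 2 / D.M := by
  have m0 := D.M_pos
  calc _ ≤ ∑ i ∈ Finset.range j, Real.exp (B 0 * (2 * R)) ^ 2 / D.M * D.gap (0 + i * D.p) := by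
        refine Finset.sum_le_sum fun i hi => ?_
        have hi : i < j := Finset.mem_range.1 hi
        have h1 := D.deriv_pow_le_const hR (hi.le.trans hj) hx
        have h2 := D.deriv_pow_le hR (hi.le.trans hj) hx
        have hp := (D.lift.perm_pow i).deriv_pos x
        rw [zero_add]
        calc _ = deriv ⇑(D.f ^ i) x * deriv ⇑(D.f ^ i) x := sq _
          _ ≤ Real.exp (B 0 * (2 * R)) * (Real.exp (B 0 * (2 * R)) * (D.gap (i * D.p) / D.M)) := by
            gcongr
          _ = _ := by ring
    _ ≤ _ := by
        rw [← Finset.mul_sum]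
        exact mul_le_of_le_one_right (by positivity) (D.sum_orbit_gap_le 0 hj)

end Orb

namespace IsCircleDiffeoLift

lemma nl_pow_succ {F : Equiv.Perm ℝ} (hF : IsCircleDiffeoLift F) (n : ℕ) (x : ℝ) :
    nl ⇑(F ^ (n + 1)) x = nl ⇑(F ^ n) x + nl F ((F ^ n) x) * deriv ⇑(F ^ n) x := by
  have h1 := (hF.perm_pow (n + 1)).hasDerivAt_log x
  have h2 : HasDerivAt (fun y => Real.log (deriv F ((F ^ n) y))) _ x :=
    (hF.hasDerivAt_log ((F ^ n) x)).comp x ((hF.perm_pow n).sm.hasDerivAt x)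
  have h3 := (hF.perm_pow n).hasDerivAt_log x
  refine h1.unique ((h3.add h2).congr_of_eventuallyEq (Eventually.of_forall fun y => ?_))
  show Real.log _ = Real.log _ + Real.log _
  rw [hF.deriv_pow_succ, Real.log_mul (hF.deriv_ne _) ((hF.perm_pow n).deriv_ne y), add_comm]

/-- The Schwarzian derivative, up to composition. -/
lemma hasDerivAt_nl_pow {F : Equiv.Perm ℝ} (hF : IsCircleDiffeoLift F) (n : ℕ) (x : ℝ) :
    HasDerivAt (nl ⇑(F ^ n)) (nl ⇑(F ^ n) x * nl ⇑(F ^ n) x / 2 + ∑ i ∈ Finset.range n,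
      (deriv (nl F) ((F ^ i) x) - nl F ((F ^ i) x) * nl F ((F ^ i) x) / 2) *
        (deriv ⇑(F ^ i) x * deriv ⇑(F ^ i) x)) x := by
  induction n with
  | zero =>
    have : nl ⇑(F ^ 0) = fun _ => 0 := by
      ext x
      have h1 : ⇑(F ^ 0) = _root_.id := by ext; simp
      have h2 : deriv (_root_.id : ℝ → ℝ) = fun _ => 1 := by ext; simp
      rw [nl, h1, h2]; simp
    rw [this]
    simpa using hasDerivAt_const x (0:ℝ)
  | succ n ih =>
    have h1 : nl ⇑(F ^ (n + 1)) = fun x => nl ⇑(F ^ n) x + nl F ((F ^ n) x) * deriv ⇑(F ^ n) x :=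
      funext (hF.nl_pow_succ n)
    have hn := hF.perm_pow n
    have h2 : HasDerivAt (fun y => nl F ((F ^ n) y)) _ x :=
      (hF.sm_nl.hasDerivAt ((F ^ n) x)).comp x (hn.sm.hasDerivAt x)
    rw [h1]
    refine (ih.add (h2.fun_mul (hn.sm.deriv.hasDerivAt x))).congr_deriv ?_
    rw [Finset.sum_range_succ, hn.deriv_deriv]
    ring

end IsCircleDiffeoLift

lemma abs_log_sub_log_le {a b ε : ℝ} (hb : 0 < b) (h : |a - b| ≤ ε * b) (hε : ε ≤ 1 / 2) :
    |Real.log a - Real.log b| ≤ 2 * ε := by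
  obtain ⟨h1, h2⟩ := abs_le.1 h
  have ha : 0 < a := by nlinarith
  rw [← Real.log_div ha.ne' hb.ne', abs_le]
  have e1 := Real.log_le_sub_one_of_pos (show 0 < a / b by positivity)
  have e2 := Real.one_sub_inv_le_log_of_pos (show 0 < a / b by positivity)
  rw [inv_div] at e2
  have e3 : a / b ≤ 1 + ε := by rw [div_le_iff₀ hb]; linarith
  have hε0 : 0 ≤ ε := by
    by_contra! h0
    nlinarith [abs_nonneg (a - b)]
  have e4 : b / a ≤ 1 + 2 * ε := by
    rw [div_le_iff₀ ha]
    have h3 : 0 ≤ ε * (1 - 2 * ε) * b := by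
      have : 0 ≤ 1 - 2 * ε := by linarith
      positivity
    have h4 : (1 + 2 * ε) * (b - ε * b) ≤ (1 + 2 * ε) * a :=
      mul_le_mul_of_nonneg_left (by linarith) (by linarith)
    nlinarith
  constructor <;> linarith

namespace Orb
variable {B : ℕ → ℝ}

lemma exists_nl_pow_small (B : ℕ → ℝ) : ∃ C M₀, 0 ≤ C ∧ 0 < M₀ ∧ ∀ D : Orb B, D.M ≤ M₀ →
    ∀ (j : ℕ) (R : ℕ), 3 ≤ R → ∃ c ∈ D.J R, |D.sig * nl ⇑(D.f ^ j) c| ≤ C := by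
  obtain ⟨C, M0, hC, hM0, h⟩ := exists_gap_near B 2
  refine ⟨8 * C, min M0 ((1 / (2 * (C + 1))) ^ 2), by positivity, by positivity,
    fun D hM j R hR => ?_⟩
  have h := h D (hM.trans (min_le_left _ _))
  have s1 : D.sig ≤ 1 / (2 * (C + 1)) := D.sig_le (by positivity) (hM.trans (min_le_right _ _))
  have s0 := D.sig_pos
  have m0 := D.M_pos
  rw [le_div_iff₀ (by positivity)] at s1
  have sC : C * D.sig ≤ 1 / 2 := by nlinarith
  obtain ⟨c0, hc0, e0⟩ := D.exists_deriv_pow_mul_gap j 0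
  obtain ⟨c2, hc2, e2⟩ := D.exists_deriv_pow_mul_gap j 2
  have hp := (D.lift.perm_pow j).deriv_pos
  have l1 := abs_log_sub_log_le (D.gap_pos (j * D.p)) (h (j * D.p) 2 (by norm_num)) sC
  have l2 := abs_log_sub_log_le (D.gap_pos 0) (h 0 2 (by norm_num)) sC
  rw [zero_add] at l2 e0
  rw [add_comm, ← e0, ← e2, Real.log_mul (hp _).ne' (D.gap_pos _).ne',
    Real.log_mul (hp _).ne' (D.gap_pos _).ne'] at l1
  have hv : |Real.log (deriv ⇑(D.f ^ j) c2) - Real.log (deriv ⇑(D.f ^ j) c0)| ≤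
        4 * (C * D.sig) := by
    rw [abs_le] at l1 l2 ⊢
    constructor <;> linarith [l1.1, l1.2, l2.1, l2.2]
  have hg1 : D.M / 2 ≤ D.gap 1 := by
    have := h 0 1 (by norm_num)
    rw [zero_add, D.gap_zero] at this
    nlinarith [neg_abs_le (D.gap 1 - D.M)]
  rw [gap] at hg1
  have hcc : D.M / 2 ≤ c2 - c0 := by
    have a1 := hc0.2
    have a2 := hc2.1
    norm_num at a1 hg1
    linarith
  obtain ⟨c, hc, hcd⟩ := exists_hasDerivAt_eq_slope
    (fun x => Real.log (deriv ⇑(D.f ^ j) x)) (nl ⇑(D.f ^ j)) (show c0 < c2 by linarith)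
    (fun x _ => ((D.lift.perm_pow j).hasDerivAt_log x).continuousAt.continuousWithinAt)
    (fun x _ => (D.lift.perm_pow j).hasDerivAt_log x)
  have hR1 : D.y (2 + 1) ≤ D.y R := D.mono.monotone (by omega)
  have hR0 : D.y (-R) ≤ D.y 0 := D.mono.monotone (by omega)
  refine ⟨c, ⟨by linarith [hc.1, hc0.1], by linarith [hc.2, hc2.2]⟩, ?_⟩
  rw [hcd, abs_mul, abs_div, abs_of_pos s0, abs_of_pos (show 0 < c2 - c0 by linarith),
    ← mul_div_assoc, div_le_iff₀ (by linarith)]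
  calc _ ≤ D.sig * (4 * (C * D.sig)) := by gcongr
    _ = 8 * C * (D.M / 2) := by rw [← D.sig_sq]; ring
    _ ≤ _ := by gcongr

/-- A priori bound of Denjoy–Yoccoz type for the nonlinearity of the iterates. -/
lemma exists_nl_pow_le (B : ℕ → ℝ) (R : ℕ) (hR : 3 ≤ R) : ∃ C M₀, 0 ≤ C ∧ 0 < M₀ ∧
    ∀ D : Orb B, D.M ≤ M₀ → ∀ j ≤ D.q, ∀ x ∈ D.J R, |D.sig * nl ⇑(D.f ^ j) x| ≤ C := by
  obtain ⟨C, M0, hC, hM0, h⟩ := exists_nl_pow_small B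
  set K : ℝ := (|B 1| + |B 0| * |B 0|) * Real.exp (B 0 * (2 * R)) ^ 2 + 1 / 2 with hK
  have hK0 : 0 ≤ K := by positivity
  set τ : ℝ := Real.arctan (C + 1) - Real.arctan C with hτ
  have hτ0 : 0 < τ := sub_pos.2 (Real.arctan_strictMono (by linarith))
  refine ⟨C + 1, min M0 ((τ / (K * (2 * R) + 1)) ^ 2), by positivity, by positivity,
    fun D hM j hj x hx => ?_⟩
  have s0 := D.sig_pos
  have m0 := D.M_pos
  have s1 : D.sig ≤ τ / (K * (2 * R) + 1) := D.sig_le (by positivity) (hM.trans (min_le_right _ _))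
  rw [le_div_iff₀ (by positivity)] at s1
  obtain ⟨c, hc, hcb⟩ := h D (hM.trans (min_le_left _ _)) j R hR
  have hS : ∀ x ∈ D.J R, |∑ i ∈ Finset.range j,
      (deriv (nl D.f) ((D.f ^ i) x) - nl D.f ((D.f ^ i) x) * nl D.f ((D.f ^ i) x) / 2) *
        (deriv ⇑(D.f ^ i) x * deriv ⇑(D.f ^ i) x)| ≤ (K - 1 / 2) / D.M := by
    intro x hx
    have h1 := D.sum_deriv_pow_sq_le (by omega) hj hx
    refine (Finset.abs_sum_le_sum_abs _ _).trans ?_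
    calc _ ≤ ∑ i ∈ Finset.range j, (|B 1| + |B 0| * |B 0|) * deriv ⇑(D.f ^ i) x ^ 2 := by
          refine Finset.sum_le_sum fun i _ => ?_
          rw [abs_mul, ← sq (deriv ⇑(D.f ^ i) x), abs_of_nonneg (sq_nonneg (deriv ⇑(D.f ^ i) x))]
          refine mul_le_mul_of_nonneg_right ?_ (sq_nonneg _)
          have b1 : |deriv (nl D.f) ((D.f ^ i) x)| ≤ B 1 := by
            simpa using D.bd 1 ((D.f ^ i) x) 1 le_rfl
          have b0 := D.abs_nl_le ((D.f ^ i) x)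
          refine (abs_sub _ _).trans (add_le_add (b1.trans (le_abs_self _)) ?_)
          rw [abs_div, abs_mul, abs_two]
          have b0' := b0.trans (le_abs_self _)
          have := mul_le_mul b0' b0' (abs_nonneg _) (abs_nonneg _)
          have := mul_nonneg (abs_nonneg (nl D.f ((D.f ^ i) x))) (abs_nonneg (nl D.f ((D.f ^ i) x)))
          linarith
      _ ≤ _ := by
          rw [← Finset.mul_sum, hK, add_sub_cancel_right, mul_div_assoc]
          gcongr
  have hd : ∀ x ∈ D.J R, ∃ θ, HasDerivAt (fun x => Real.arctan (D.sig * nl ⇑(D.f ^ j) x)) θ x ∧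
      |θ| ≤ K / D.sig := by
    intro x hx
    have h1 := ((D.lift.hasDerivAt_nl_pow j x).const_mul D.sig).arctan
    refine ⟨_, h1, ?_⟩
    have h2 := hS x hx
    set S := ∑ i ∈ Finset.range j,
      (deriv (nl D.f) ((D.f ^ i) x) - nl D.f ((D.f ^ i) x) * nl D.f ((D.f ^ i) x) / 2) *
        (deriv ⇑(D.f ^ i) x * deriv ⇑(D.f ^ i) x)
    set l := nl ⇑(D.f ^ j) x
    rw [abs_mul, abs_mul, abs_of_pos s0, abs_of_pos (by positivity), div_mul_eq_mul_div, one_mul,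
      div_le_iff₀ (by positivity)]
    have h3 : |l * l / 2 + S| ≤ l * l / 2 + (K - 1 / 2) / D.M := by
      refine (abs_add_le _ _).trans (add_le_add (le_of_eq (abs_of_nonneg ?_)) h2)
      nlinarith [mul_self_nonneg l]
    calc _ ≤ D.sig * (l * l / 2 + (K - 1 / 2) / D.M) := by gcongr
      _ = (1 / 2 * (D.sig * l) ^ 2 + (K - 1 / 2)) / D.sig := by
        rw [← D.sig_sq]; field_simp
      _ ≤ (K * (1 + (D.sig * l) ^ 2)) / D.sig := by
        have hK2 : 1 / 2 ≤ K := by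
          have : 0 ≤ (|B 1| + |B 0| * |B 0|) * Real.exp (B 0 * (2 * R)) ^ 2 := by positivity
          linarith
        gcongr
        nlinarith [sq_nonneg (D.sig * l)]
      _ = _ := by ring
  choose! θ hθ hθb using hd
  have hb := (convex_Icc (D.y (-R)) (D.y R)).norm_image_sub_le_of_norm_hasDerivWithin_le
    (fun x hx => (hθ x hx).hasDerivWithinAt) (fun x hx => hθb x hx) hc hx
  rw [Real.norm_eq_abs, Real.norm_eq_abs] at hb
  have hlen : K / D.sig * |x - c| ≤ τ := by
    calc _ ≤ K / D.sig * (2 * R * D.M) := by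
          have := D.J_length R hx hc
          gcongr
      _ = D.sig * (K * (2 * R)) := by rw [← D.sig_sq]; field_simp
      _ ≤ _ := by nlinarith
  have hb := hb.trans hlen
  rw [abs_le] at hcb hb ⊢
  have m1 := Real.arctan_mono hcb.1
  have m2 := Real.arctan_mono hcb.2
  rw [Real.arctan_neg] at m1
  constructor
  · rw [← Real.arctan_le_arctan_iff, Real.arctan_neg]; linarith [hb.1]
  · rw [← Real.arctan_le_arctan_iff]; linarith [hb.2]

end Orb

lemma Sm.comp_affine {f : ℝ → ℝ} (hf : Sm f) (o s : ℝ) : Sm fun t => f (o + s * t) := by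
  have : Sm fun t : ℝ => o + s * t := by unfold Sm; fun_prop
  exact hf.comp this

lemma Sm.hasDerivAt_comp_affine {f : ℝ → ℝ} (hf : Sm f) (o s t : ℝ) :
    HasDerivAt (fun t => f (o + s * t)) (s * _root_.deriv f (o + s * t)) t := by
  have h1 : HasDerivAt (fun t : ℝ => o + s * t) s t := by
    simpa using ((hasDerivAt_id t).const_mul s).const_add o
  exact (HasDerivAt.comp (h₂ := f) t (hf.hasDerivAt _) h1).congr_deriv (mul_comm _ _)

lemma iteratedDeriv_comp_affine {f : ℝ → ℝ} (hf : Sm f) (n : ℕ) (o s t : ℝ) :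
    iteratedDeriv n (fun t => f (o + s * t)) t = s ^ n * iteratedDeriv n f (o + s * t) := by
  induction n generalizing t with
  | zero => simp
  | succ n ih =>
    rw [iteratedDeriv_succ, funext ih,
      (((hf.iteratedDeriv n).hasDerivAt_comp_affine o s t).const_mul _).deriv, iteratedDeriv_succ]
    ring

/-- Derivative bounds for the solution of a linear differential equation. -/
lemma JB_of_deriv_eq_mul (n : ℕ) (C : ℝ) : ∃ K, 0 ≤ K ∧ ∀ (w l : ℝ → ℝ) (t : ℝ), Sm w → Sm l →
    (∀ t, deriv w t = l t * w t) → JB n C l t → JB (n + 1) (K * |w t|) w t := by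
  have main : ∃ K, 0 ≤ K ∧ ∀ (w l : ℝ → ℝ) (t : ℝ), Sm w → Sm l →
      (∀ t, deriv w t = l t * w t) → JB n |C| l t → JB n (K * |w t|) w t := by
    induction n with
    | zero => exact ⟨1, zero_le_one, fun w l t _ _ _ _ => by rw [JB_zero, one_mul]⟩
    | succ n ih =>
      obtain ⟨K, hK, h⟩ := ih
      refine ⟨max 1 (2 ^ n * (|C| * K)), by positivity, fun w l t hw hl hd hb => ?_⟩
      rw [JB_succ, funext hd]
      refine ⟨le_mul_of_one_le_left (abs_nonneg _) (le_max_left _ _), ?_⟩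
      have hb' := hb.mono (Nat.le_succ n) le_rfl
      refine (hb'.mul hl hw (h w l t hw hl hd hb')).mono le_rfl ?_
      calc _ = 2 ^ n * (|C| * K) * |w t| := by ring
        _ ≤ _ := by gcongr; exact le_max_right _ _
  obtain ⟨K, hK, h⟩ := main
  refine ⟨max 1 (2 ^ n * (|C| * K)), by positivity, fun w l t hw hl hd hb => ?_⟩
  rw [JB_succ, funext hd]
  refine ⟨le_mul_of_one_le_left (abs_nonneg _) (le_max_left _ _), ?_⟩
  have hb' := hb.mono le_rfl (le_abs_self C)
  refine (hb'.mul hl hw (h w l t hw hl hd hb')).mono le_rfl ?_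
  calc _ = 2 ^ n * (|C| * K) * |w t| := by ring
    _ ≤ _ := by gcongr; exact le_max_right _ _

namespace Orb
variable {B : ℕ → ℝ} (D : Orb B)

/-- The derivative of an iterate at the scale `sig`. -/
def sw (j : ℕ) (t : ℝ) : ℝ := deriv ⇑(D.f ^ j) (D.y 0 + D.sig * t)

/-- The nonlinearity of an iterate at the scale `sig`. -/
def sl (j : ℕ) (t : ℝ) : ℝ := D.sig * nl ⇑(D.f ^ j) (D.y 0 + D.sig * t)

/-- The source term of the Riccati equation satisfied by the nonlinearity of the iterates. -/
def sz (x : ℝ) : ℝ := deriv (nl D.f) x - nl D.f x * nl D.f x / 2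

lemma sm_sw (j : ℕ) : Sm (D.sw j) := (D.lift.perm_pow j).sm.deriv.comp_affine _ _

lemma sm_sl (j : ℕ) : Sm (D.sl j) :=
  contDiff_const.mul ((D.lift.perm_pow j).sm_nl.comp_affine _ _)

lemma sm_sz : Sm D.sz :=
  D.lift.sm_nl.deriv.sub ((D.lift.sm_nl.mul D.lift.sm_nl).div_const _)

lemma sw_pos (j : ℕ) (t : ℝ) : 0 < D.sw j t := (D.lift.perm_pow j).deriv_pos _

lemma deriv_sw (j : ℕ) (t : ℝ) : deriv (D.sw j) t = D.sl j t * D.sw j t := by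
  have h := (D.lift.perm_pow j).sm.deriv.hasDerivAt_comp_affine (D.y 0) D.sig t
  refine h.deriv.trans ?_
  rw [(D.lift.perm_pow j).deriv_deriv, sl, sw]; ring

lemma deriv_sl (j : ℕ) (t : ℝ) : deriv (D.sl j) t = 1 / 2 * (D.sl j t * D.sl j t) +
    ∑ i ∈ Finset.range j, D.sig ^ 2 *
      (D.sz ((D.f ^ i) (D.y 0 + D.sig * t)) * (D.sw i t * D.sw i t)) := by
  have h := ((D.lift.perm_pow j).sm_nl.hasDerivAt_comp_affine (D.y 0) D.sig t).const_mul D.sig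
  refine h.deriv.trans ?_
  rw [(D.lift.hasDerivAt_nl_pow j _).deriv, mul_add, mul_add, sl, Finset.mul_sum, Finset.mul_sum]
  congr 1
  · ring
  · refine Finset.sum_congr rfl fun i _ => ?_
    rw [sz, sw]; ring

lemma JB_sz (n : ℕ) (x : ℝ) : JB n (B (n + 1) + 1 / 2 * (2 ^ n * (B n * B n))) D.sz x := by
  have h1 := (JB_succ.1 (D.bd (n + 1) x)).2
  have h2 := ((D.bd n x).mul D.lift.sm_nl D.lift.sm_nl (D.bd n x)).const_mul
    (c := 1 / 2) (D := 1 / 2) (by norm_num)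
  have h3 := h1.sub D.lift.sm_nl.deriv (contDiff_const.mul (D.lift.sm_nl.mul D.lift.sm_nl)) h2
  have e : D.sz = fun y => deriv (nl D.f) y - 1 / 2 * (nl D.f y * nl D.f y) := by
    ext y; rw [sz]; ring
  rw [e]; exact h3

lemma exists_JB_sl (B : ℕ → ℝ) (R : ℕ) (hR : 3 ≤ R) (n : ℕ) : ∃ C M₀, 0 ≤ C ∧ 0 < M₀ ∧
    ∀ D : Orb B, D.M ≤ M₀ → ∀ j ≤ D.q, ∀ t, D.y 0 + D.sig * t ∈ D.J R → JB n C (D.sl j) t := by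
  induction n with
  | zero =>
    obtain ⟨C, M0, hC, hM0, h⟩ := exists_nl_pow_le B R hR
    exact ⟨C, M0, hC, hM0, fun D hM j hj t ht => JB_zero.2 (h D hM j hj _ ht)⟩
  | succ n ih =>
    obtain ⟨C, M0, hC, hM0, h⟩ := ih
    obtain ⟨K, hK, hw⟩ := JB_of_deriv_eq_mul n C
    set E := Real.exp (B 0 * (2 * R)) with hE
    have hE0 : 0 < E := Real.exp_pos _
    set Z := |B (n + 1)| + 1 / 2 * (2 ^ n * (|B n| * |B n|)) with hZ
    set Dc := max 1 (K * E) with hDc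
    have hDc1 : 1 ≤ Dc := le_max_left _ _
    set Q : ℝ := 2 ^ n * ((n.factorial * Z * Dc ^ n) * (2 ^ n * (K * K))) with hQ
    refine ⟨C + 1 / 2 * (2 ^ n * (C * C)) + Q * E ^ 2, min M0 1, by positivity, by positivity,
      fun D hM j hj t ht => ?_⟩
    have h := h D (hM.trans (min_le_left _ _))
    have s0 := D.sig_pos
    have s1 : D.sig ≤ 1 := D.sig_le zero_le_one (by simpa using hM.trans (min_le_right _ _))
    have m0 := D.M_pos
    have hlj := h j hj t ht
    have hC1 : 0 ≤ 1 / 2 * (2 ^ n * (C * C)) + Q * E ^ 2 := by positivity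
    rw [JB_succ]
    refine ⟨hlj.apply.trans (by linarith), ?_⟩
    rw [funext (D.deriv_sl j)]
    have smu : ∀ i : ℕ, Sm fun t => (D.f ^ i) (D.y 0 + D.sig * t) := fun i =>
      (D.lift.perm_pow i).sm.comp_affine _ _
    have smzu : ∀ i : ℕ, Sm fun t => D.sz ((D.f ^ i) (D.y 0 + D.sig * t)) := fun i =>
      D.sm_sz.comp (smu i)
    have smww : ∀ i : ℕ, Sm fun t => D.sw i t * D.sw i t := fun i => (D.sm_sw i).mul (D.sm_sw i)
    have smt : ∀ i : ℕ, Sm fun t => D.sig ^ 2 *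
      (D.sz ((D.f ^ i) (D.y 0 + D.sig * t)) * (D.sw i t * D.sw i t)) := fun i =>
      contDiff_const.mul ((smzu i).mul (smww i))
    have hterm : ∀ i ∈ Finset.range j, JB n (D.sig ^ 2 * (Q * D.sw i t ^ 2)) (fun t => D.sig ^ 2 *
        (D.sz ((D.f ^ i) (D.y 0 + D.sig * t)) * (D.sw i t * D.sw i t))) t := by
      intro i hi
      have hi : i ≤ D.q := (Finset.mem_range.1 hi).le.trans hj
      have hwi := hw (D.sw i) (D.sl i) t (D.sm_sw i) (D.sm_sl i) (D.deriv_sw i) (h i hi t ht)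
      rw [abs_of_pos (D.sw_pos i t)] at hwi
      have hwi' := hwi.mono (Nat.le_succ n) le_rfl
      have hwE : D.sw i t ≤ E := D.deriv_pow_le_const (by omega) hi ht
      have hu : ∀ k, 1 ≤ k → k ≤ n →
          |iteratedDeriv k (fun t => (D.f ^ i) (D.y 0 + D.sig * t)) t| ≤ Dc := by
        intro k hk1 hk
        obtain ⟨m, rfl⟩ : ∃ m, k = m + 1 := ⟨k - 1, by omega⟩
        have e : deriv (fun t => (D.f ^ i) (D.y 0 + D.sig * t)) = fun t => D.sig * D.sw i t :=
          funext fun t => ((D.lift.perm_pow i).sm.hasDerivAt_comp_affine _ _ t).deriv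
        rw [iteratedDeriv_succ', e]
        refine ((hwi.const_mul (c := D.sig) (D := 1) (by rwa [abs_of_pos s0])) m
          (by omega)).trans ?_
        rw [one_mul]
        exact le_trans (by gcongr) (le_max_right _ _)
      have hz : JB n Z D.sz ((D.f ^ i) (D.y 0 + D.sig * t)) := by
        refine (D.JB_sz n _).mono le_rfl ?_
        have a := D.B_nonneg (n + 1)
        have b := D.B_nonneg n
        rw [hZ, abs_of_nonneg a, abs_of_nonneg b]
      have h1 := hz.comp D.sm_sz (smu i) hDc1 hu
      have h2 := (h1.mul (smzu i) (smww i) (hwi'.mul (D.sm_sw i) (D.sm_sw i) hwi')).const_mul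
        (c := D.sig ^ 2) (D := D.sig ^ 2) (by rw [abs_of_nonneg (sq_nonneg _)])
      refine h2.mono le_rfl (le_of_eq ?_)
      rw [hQ]; ring
    have hsum := JB.sum (fun i _ => smt i) hterm
    have hsq := (hlj.mul (D.sm_sl j) (D.sm_sl j) hlj).const_mul
      (c := 1 / 2) (D := 1 / 2) (by norm_num)
    refine (hsq.add (contDiff_const.mul ((D.sm_sl j).mul (D.sm_sl j)))
      (ContDiff.sum fun i _ => smt i) hsum).mono le_rfl ?_
    rw [← Finset.mul_sum, ← Finset.mul_sum]
    have hss := D.sum_deriv_pow_sq_le (by omega) hj ht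
    have : D.sig ^ 2 * (Q * ∑ i ∈ Finset.range j, D.sw i t ^ 2) ≤ Q * E ^ 2 := by
      calc _ ≤ D.sig ^ 2 * (Q * (E ^ 2 / D.M)) := by
            have : 0 ≤ Q := by positivity
            gcongr
            exact hss
        _ = _ := by rw [D.sig_sq]; field_simp
    linarith

lemma exists_JB_sw (B : ℕ → ℝ) (R : ℕ) (hR : 3 ≤ R) (n : ℕ) : ∃ C M₀, 0 ≤ C ∧ 0 < M₀ ∧
    ∀ D : Orb B, D.M ≤ M₀ → ∀ j ≤ D.q, ∀ t, D.y 0 + D.sig * t ∈ D.J R → JB n C (D.sw j) t := by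
  obtain ⟨C, M0, hC, hM0, h⟩ := exists_JB_sl B R hR n
  obtain ⟨K, hK, hw⟩ := JB_of_deriv_eq_mul n C
  refine ⟨K * Real.exp (B 0 * (2 * R)), M0, by positivity, hM0, fun D hM j hj t ht => ?_⟩
  have hwj := hw (D.sw j) (D.sl j) t (D.sm_sw j) (D.sm_sl j) (D.deriv_sw j) (h D hM j hj t ht)
  rw [abs_of_pos (D.sw_pos j t)] at hwj
  refine hwj.mono (Nat.le_succ n) ?_
  have hwE : D.sw j t ≤ Real.exp (B 0 * (2 * R)) := D.deriv_pow_le_const (by omega) hj ht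
  gcongr

end Orb

/-- A function with many zeros is controlled, with its first derivatives, by a derivative of higher
order. -/
lemma JB_of_zeros (n : ℕ) {e : ℝ → ℝ} (he : Sm e) {a b K : ℝ} (hab : 1 ≤ b - a) (z : ℕ → ℝ)
    (hz : ∀ i ≤ n, z i ∈ Set.Icc a b) (hmono : ∀ i < n, z i < z (i + 1))
    (hzero : ∀ i ≤ n, e (z i) = 0)
    (hK : ∀ x ∈ Set.Icc a b, |iteratedDeriv (n + 1) e x| ≤ K) :
    ∀ x ∈ Set.Icc a b, JB (n + 1) (K * (b - a) ^ (n + 1)) e x := by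
  have mvt : ∀ (e : ℝ → ℝ), Sm e → ∀ L, (∀ x ∈ Set.Icc a b, |deriv e x| ≤ L) →
      ∀ y ∈ Set.Icc a b, e y = 0 → ∀ x ∈ Set.Icc a b, |e x| ≤ L * (b - a) := by
    intro e he L hL y hy hy0 x hx
    have h := (convex_Icc a b).norm_image_sub_le_of_norm_hasDerivWithin_le
      (fun x _ => (he.hasDerivAt x).hasDerivWithinAt) hL hy hx
    rw [hy0, sub_zero] at h
    refine h.trans (mul_le_mul_of_nonneg_left ?_ ((abs_nonneg _).trans (hL x hx)))
    rw [Real.norm_eq_abs, abs_le]; constructor <;> linarith [hx.1, hx.2, hy.1, hy.2]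
  have hone : ∀ m : ℕ, (1 : ℝ) ≤ (b - a) ^ m := fun m => one_le_pow₀ hab
  induction n generalizing e z with
  | zero =>
    intro x hx
    have hK0 : 0 ≤ K := (abs_nonneg _).trans (hK x hx)
    simp only [zero_add, iteratedDeriv_one, pow_one] at hK ⊢
    rw [← zero_add 1, JB_succ, JB_zero]
    exact ⟨mvt e he K hK (z 0) (hz 0 le_rfl) (hzero 0 le_rfl) x hx,
      (hK x hx).trans (le_mul_of_one_le_right hK0 hab)⟩
  | succ n ih =>
    have hc : ∀ i, ∃ c, i ≤ n → c ∈ Set.Ioo (z i) (z (i + 1)) ∧ deriv e c = 0 := by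
      intro i
      by_cases hi : i ≤ n
      · obtain ⟨c, hc, h⟩ := exists_deriv_eq_zero (f := e) (hmono i (by omega))
          he.continuous.continuousOn (by rw [hzero i (by omega), hzero (i + 1) (by omega)])
        exact ⟨c, fun _ => ⟨hc, h⟩⟩
      · exact ⟨0, fun h => absurd h hi⟩
    choose c hc using hc
    have h := ih he.deriv c
      (fun i hi => ⟨(hz i (by omega)).1.trans (hc i hi).1.1.le,
        (hc i hi).1.2.le.trans (hz (i + 1) (by omega)).2⟩)
      (fun i hi => (hc i hi.le).1.2.trans (hc (i + 1) hi).1.1)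
      (fun i hi => (hc i hi).2)
      (fun x hx => by have := hK x hx; rwa [iteratedDeriv_succ'] at this)
    intro x hx
    have hK0 : 0 ≤ K := (abs_nonneg _).trans (hK x hx)
    rw [JB_succ]
    have := mvt e he _ (fun x hx => (h x hx).apply) (z 0) (hz 0 (by omega)) (hzero 0 (by omega)) x hx
    refine ⟨by rw [pow_succ _ (n + 1), ← mul_assoc]; exact this, (h x hx).mono le_rfl ?_⟩
    exact mul_le_mul_of_nonneg_left (pow_le_pow_right₀ hab (by omega)) hK0

namespace Orb
variable {B : ℕ → ℝ} (D : Orb B)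

lemma exists_mem_J (B : ℕ → ℝ) (R : ℕ) : ∃ M₀, 0 < M₀ ∧ ∀ D : Orb B, D.M ≤ M₀ →
    (∀ ξ : ℝ, |ξ| ≤ R → D.y 0 + D.M * ξ ∈ D.J (R + 1)) ∧
    ∀ d : ℤ, |d| ≤ R → |(D.y d - D.y 0) / D.M - d| ≤ 1 / 2 := by
  obtain ⟨C, M0, hC, hM0, h⟩ := exists_y_near B (R + 1)
  refine ⟨min M0 ((1 / (2 * (C + 1))) ^ 2), by positivity, fun D hM => ?_⟩
  have m0 := D.M_pos
  have s0 := D.sig_pos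
  have s1 : D.sig ≤ 1 / (2 * (C + 1)) := D.sig_le (by positivity) (hM.trans (min_le_right _ _))
  rw [le_div_iff₀ (by positivity)] at s1
  have h' : ∀ d : ℤ, |d| ≤ (R + 1 : ℕ) → |(D.y d - D.y 0) / D.M - d| ≤ 1 / 2 := by
    intro d hd
    have := (h D (hM.trans (min_le_left _ _)) d hd).2
    rw [show (D.y d - D.y 0) / D.M - d = (D.y d - D.y 0 - d * D.M) / D.M by field_simp,
      abs_div, abs_of_pos m0, div_le_iff₀ m0]
    refine this.trans ?_
    gcongr
    linarith
  refine ⟨fun ξ hξ => ?_, fun d hd => h' d (hd.trans (by simp))⟩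
  have h1 := h' (R + 1 : ℕ) (by rw [Nat.abs_cast])
  have h2 := h' (-(R + 1 : ℕ)) (by rw [abs_neg, Nat.abs_cast])
  rw [abs_le] at h1 h2 hξ
  have h1' := h1.1
  have h2' := h2.2
  rw [le_sub_iff_add_le, le_div_iff₀ m0] at h1'
  rw [sub_le_iff_le_add, div_le_iff₀ m0] at h2'
  push_cast at h1' h2'
  constructor
  · push_cast
    nlinarith [hξ.1]
  · push_cast
    nlinarith [hξ.2]

/-- The displacement of an iterate of order `j`, seen as a return map of index shift `d`, in the
coordinate `ξ = (x - y 0) / M`. -/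
def ret (j : ℕ) (c d : ℤ) (ξ : ℝ) : ℝ := ((D.f ^ j) (D.y 0 + D.M * ξ) - c - D.y 0) / D.M - ξ - d

lemma sm_ret (j : ℕ) (c d : ℤ) : Sm (D.ret j c d) := by
  have h := (D.lift.perm_pow j).sm.comp_affine (D.y 0) D.M
  have : Sm fun ξ : ℝ => ξ := contDiff_id
  exact ((((h.sub contDiff_const).sub contDiff_const).div_const _).sub this).sub contDiff_const

lemma deriv_ret (j : ℕ) (c d : ℤ) (ξ : ℝ) : deriv (D.ret j c d) ξ = D.sw j (D.sig * ξ) - 1 := by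
  have h := (D.lift.perm_pow j).sm.hasDerivAt_comp_affine (D.y 0) D.M ξ
  have h2 := (((h.sub_const (c : ℝ)).sub_const (D.y 0)).div_const D.M).fun_sub (hasDerivAt_id ξ)
  refine (h2.sub_const (d : ℝ)).deriv.trans ?_
  rw [mul_div_cancel_left₀ _ D.M_pos.ne', sw, ← mul_assoc, ← sq, D.sig_sq]

lemma iteratedDeriv_sw_comp (j n : ℕ) (ξ : ℝ) :
    iteratedDeriv n (fun ξ => D.sw j (D.sig * ξ)) ξ =
      D.sig ^ n * iteratedDeriv n (D.sw j) (D.sig * ξ) := by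
  simpa using iteratedDeriv_comp_affine (D.sm_sw j) n 0 D.sig ξ

lemma iteratedDeriv_ret (j : ℕ) (c d : ℤ) (n : ℕ) (hn : 1 ≤ n) (ξ : ℝ) :
    iteratedDeriv (n + 1) (D.ret j c d) ξ = D.sig ^ n * iteratedDeriv n (D.sw j) (D.sig * ξ) := by
  rw [iteratedDeriv_succ', funext (D.deriv_ret j c d), ← D.iteratedDeriv_sw_comp]
  obtain ⟨m, rfl⟩ : ∃ m, n = m + 1 := ⟨n - 1, by omega⟩
  rw [iteratedDeriv_succ', iteratedDeriv_succ']
  congr 1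
  ext y
  rw [deriv_sub_const]

/-- The return maps are close to translations. -/
lemma exists_JB_ret (B : ℕ → ℝ) (R n : ℕ) (hR : 3 ≤ R) : ∃ C M₀, 0 ≤ C ∧ 0 < M₀ ∧
    ∀ D : Orb B, D.M ≤ M₀ → ∀ j ≤ D.q, ∀ c d : ℤ, |d| ≤ R → j * D.p = d + c * D.q →
      ∀ ξ : ℝ, |ξ| ≤ R → JB n (C * D.sig) (D.ret j c d) ξ := by
  obtain ⟨C1, M1, hC1, hM1, h1⟩ := exists_y_near B R
  obtain ⟨C2, M2, hC2, hM2, h2⟩ := exists_JB_sw B (R + 1) (by omega) (n + 1)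
  obtain ⟨M3, hM3, h3⟩ := exists_mem_J B R
  set C4 := C1 + C2 * (2 * R) + C2 with hC4
  refine ⟨C1 + C4 * R + C4, min (min M1 M2) (min M3 1), by positivity, by positivity,
    fun D hM j hj c d hd hjd => ?_⟩
  obtain ⟨hdg, hdy⟩ := h1 D (hM.trans ((min_le_left _ _).trans (min_le_left _ _))) d hd
  have h2 := h2 D (hM.trans ((min_le_left _ _).trans (min_le_right _ _))) j hj
  have h3 := (h3 D (hM.trans ((min_le_right _ _).trans (min_le_left _ _)))).1
  have m0 := D.M_pos
  have s0 := D.sig_pos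
  have s1 : D.sig ≤ 1 := D.sig_le zero_le_one
    (by simpa using hM.trans ((min_le_right _ _).trans (min_le_right _ _)))
  have hR' : (3 : ℝ) ≤ R := by exact_mod_cast hR
  have hs : ∀ ξ : ℝ, |ξ| ≤ R → JB (n + 1) C2 (D.sw j) (D.sig * ξ) := fun ξ hξ => by
    refine h2 _ ?_
    rw [← mul_assoc, ← sq, D.sig_sq]; exact h3 ξ hξ
  have hw1 : ∀ ξ : ℝ, |ξ| ≤ R → |D.sw j (D.sig * ξ) - 1| ≤ C4 * D.sig := by
    intro ξ hξ
    obtain ⟨x, hx, hxd⟩ := D.exists_deriv_pow_mul_gap j 0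
    rw [zero_add, D.gap_zero, D.gap_congr (k := j * D.p) (l := d) (by simp [hjd])] at hxd
    set ξ0 := (x - D.y 0) / D.M with hξ0
    have hx0 : 0 ≤ ξ0 := div_nonneg (sub_nonneg.2 hx.1) m0.le
    have hx1 : ξ0 ≤ 1 := by
      rw [hξ0, div_le_one m0, M]; rw [zero_add] at hx; linarith [hx.2]
    have hx2 : |ξ0| ≤ R := by rw [abs_of_nonneg hx0]; linarith
    have e0 : D.sw j (D.sig * ξ0) = D.gap d / D.M := by
      rw [← hxd, mul_div_cancel_right₀ _ m0.ne', sw, ← mul_assoc, ← sq, D.sig_sq, hξ0,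
        mul_div_cancel₀ _ m0.ne', add_sub_cancel]
    have d0 : ∀ y : ℝ, HasDerivAt (fun y => D.sw j (D.sig * y))
        (D.sig * deriv (D.sw j) (D.sig * y)) y := fun y => by
      simpa using (D.sm_sw j).hasDerivAt_comp_affine 0 D.sig y
    have hmv := (convex_Icc (-(R : ℝ)) R).norm_image_sub_le_of_norm_hasDerivWithin_le
      (C := D.sig * C2) (fun y _ => (d0 y).hasDerivWithinAt) (fun y hy => by
        rw [Real.norm_eq_abs, abs_mul, abs_of_pos s0]
        have := (JB_succ.1 (hs y (abs_le.2 hy))).2.apply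
        gcongr) (abs_le.1 hx2) (abs_le.1 hξ)
    rw [e0] at hmv
    have hl : |ξ - ξ0| ≤ 2 * R := (abs_sub _ _).trans (by linarith)
    have hg : |D.gap d / D.M - 1| ≤ C1 * D.sig := by
      rw [div_sub_one m0.ne', abs_div, abs_of_pos m0, div_le_iff₀ m0]; exact hdg
    have := abs_sub_le (D.sw j (D.sig * ξ)) (D.gap d / D.M) 1
    have h5 : D.sig * C2 * |ξ - ξ0| ≤ D.sig * C2 * (2 * R) := by gcongr
    rw [Real.norm_eq_abs, Real.norm_eq_abs] at hmv
    have : 0 ≤ C2 * D.sig := by positivity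
    rw [hC4]
    linarith
  have hC40 : 0 ≤ C4 := by positivity
  have he0 : |D.ret j c d 0| ≤ C1 * D.sig := by
    have : D.ret j c d 0 = (D.y d - D.y 0 - d * D.M) / D.M := by
      rw [ret, mul_zero, add_zero, D.iter_y, zero_add, hjd, D.per_mul]
      field_simp
      ring
    rw [this, abs_div, abs_of_pos m0, div_le_iff₀ m0]; exact hdy
  intro ξ hξ
  have hmv := (convex_Icc (-(R : ℝ)) R).norm_image_sub_le_of_norm_hasDerivWithin_le
      (C := C4 * D.sig) (fun y _ => ((D.sm_ret j c d).hasDerivAt y).hasDerivWithinAt) (fun y hy => by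
        rw [D.deriv_ret]; exact hw1 y (abs_le.2 hy))
      (show (0:ℝ) ∈ _ from ⟨by linarith, by linarith⟩) (abs_le.1 hξ)
  rw [sub_zero, Real.norm_eq_abs, Real.norm_eq_abs] at hmv
  have he : |D.ret j c d ξ| ≤ (C1 + C4 * R) * D.sig := by
    have h6 : C4 * D.sig * |ξ| ≤ C4 * D.sig * R := by gcongr
    have := abs_sub_abs_le_abs_sub (D.ret j c d ξ) (D.ret j c d 0)
    linarith
  have p1 : 0 ≤ C1 * D.sig := by positivity
  have p2 : 0 ≤ C4 * R * D.sig := by positivity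
  have p3 : 0 ≤ C4 * D.sig := by positivity
  intro i hi
  rcases i with _ | _ | i
  · rw [iteratedDeriv_zero]; linarith
  · rw [zero_add, iteratedDeriv_one, D.deriv_ret]; linarith [hw1 ξ hξ]
  · rw [D.iteratedDeriv_ret j c d (i + 1) (by omega), abs_mul, abs_pow, abs_of_pos s0]
    have := hs ξ hξ (i + 1) (by omega)
    have hp : D.sig ^ (i + 1) ≤ D.sig := by
      rw [pow_succ]; exact mul_le_of_le_one_left s0.le (pow_le_one₀ s0.le s1)
    have p4 : 0 ≤ C1 + C2 * (2 * R) := by positivity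
    calc _ ≤ D.sig * C2 := by gcongr
      _ ≤ C4 * D.sig := by rw [hC4]; nlinarith
      _ ≤ _ := by linarith

/-- The first return map is extremely close to the identity. -/
lemma exists_JB_close (B : ℕ → ℝ) (R n : ℕ) (hR : 3 ≤ R) (hn : 1 ≤ n) (hnR : n + 1 ≤ R) :
    ∃ C M₀, 0 ≤ C ∧ 0 < M₀ ∧ ∀ D : Orb B, D.M ≤ M₀ → ∀ ξ : ℝ, |ξ| ≤ R →
      JB n (C * D.M ^ n) (D.ret D.q D.p 0) ξ := by
  obtain ⟨C2, M2, hC2, hM2, h2⟩ := exists_JB_sw B (R + 1) (by omega) (2 * n)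
  obtain ⟨M3, hM3, h3⟩ := exists_mem_J B R
  refine ⟨C2 * (R - -R) ^ (2 * n + 1), min M2 M3, ?_, by positivity, fun D hM ξ hξ => ?_⟩
  · have : (0:ℝ) ≤ R - -R := by rw [sub_neg_eq_add]; positivity
    positivity
  obtain ⟨h3, h3'⟩ := h3 D (hM.trans (min_le_right _ _))
  have h2 := h2 D (hM.trans (min_le_left _ _)) D.q le_rfl
  have m0 := D.M_pos
  have s0 := D.sig_pos
  have hR' : (3 : ℝ) ≤ R := by exact_mod_cast hR
  have hnR' : (n + 1 : ℝ) ≤ R := by exact_mod_cast hnR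
  have h := JB_of_zeros (2 * n) (D.sm_ret D.q D.p 0) (a := -R) (b := R) (K := C2 * D.M ^ n)
    (by linarith) (fun i => (D.y (i - n) - D.y 0) / D.M) ?_ ?_ ?_ ?_ ξ (abs_le.1 hξ)
  · refine h.mono (by omega) (le_of_eq (by ring))
  · intro i hi
    have hin : |(i - n : ℤ)| ≤ n := abs_le.2 ⟨by omega, by omega⟩
    have := abs_le.1 (h3' (i - n) (hin.trans (by omega)))
    have hin' : |((i - n : ℤ) : ℝ)| ≤ n := by exact_mod_cast hin
    rw [abs_le] at hin'
    constructor <;> linarith [this.1, this.2, hin'.1, hin'.2]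
  · intro i hi
    have := D.mono (show (i - n : ℤ) < (i + 1 : ℕ) - n by push_cast; omega)
    gcongr
  · intro i hi
    rw [ret, mul_div_cancel₀ _ m0.ne', add_sub_cancel, D.iter_y, mul_comm, D.per_mul]
    simp
  · intro x hx
    have hs : JB (2 * n) C2 (D.sw D.q) (D.sig * x) := by
      refine h2 _ ?_
      rw [← mul_assoc, ← sq, D.sig_sq]; exact h3 x (abs_le.2 hx)
    rw [D.iteratedDeriv_ret _ _ _ (2 * n) (by omega), abs_mul, abs_pow, abs_of_pos s0, pow_mul,
      D.sig_sq, mul_comm]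
    exact mul_le_mul_of_nonneg_right (hs _ le_rfl) (by positivity)

end Orb

namespace Orb
variable {B : ℕ → ℝ} (D : Orb B)

lemma exists_rep (k : ℤ) : ∃ j : ℕ, ∃ m : ℤ, j < D.q ∧ j * D.p + m * D.q = k := by
  obtain ⟨j, hj, h⟩ := D.exists_mul_p 0 k
  rw [zero_add, eq_comm, ZMod.intCast_eq_intCast_iff_dvd_sub, dvd_sub_comm] at h
  obtain ⟨m, hm⟩ := h
  exact ⟨j, m, hj, by linarith⟩

/-- The number of iterates of `f` taking `y 0` to `y k`, modulo integer translations. -/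
def jj (k : ℤ) : ℕ := (D.exists_rep k).choose

/-- The integer translation in the map taking `y 0` to `y k`. -/
def mm (k : ℤ) : ℤ := (D.exists_rep k).choose_spec.choose

lemma jj_lt (k : ℤ) : D.jj k < D.q := (D.exists_rep k).choose_spec.choose_spec.1

lemma jj_mm (k : ℤ) : D.jj k * D.p + D.mm k * D.q = k :=
  (D.exists_rep k).choose_spec.choose_spec.2

lemma rep_unique {k : ℤ} {j : ℕ} {m : ℤ} (hj : j < D.q) (h : j * D.p + m * D.q = k) :
    j = D.jj k ∧ m = D.mm k := by
  have h1 := D.jj_mm k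
  have hq : (0 : ℤ) < D.q := by exact_mod_cast D.hq
  have h2 : (D.q : ℤ) ∣ (j - D.jj k : ℤ) :=
    D.cop.symm.dvd_of_dvd_mul_right ⟨D.mm k - m, by linarith⟩
  have h3 := D.jj_lt k
  have h4 : (j - D.jj k : ℤ) = 0 :=
    Int.eq_zero_of_abs_lt_dvd h2 (abs_lt.2 ⟨by omega, by omega⟩)
  have h5 : j = D.jj k := by omega
  refine ⟨h5, ?_⟩
  rw [h5] at h
  exact mul_right_cancel₀ hq.ne' (by linarith)

lemma jj_add_q (k : ℤ) : D.jj (k + D.q) = D.jj k ∧ D.mm (k + D.q) = D.mm k + 1 := by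
  have := D.rep_unique (k := k + D.q) (m := D.mm k + 1) (D.jj_lt k)
    (by have := D.jj_mm k; linarith)
  exact ⟨this.1.symm, this.2.symm⟩

lemma jj_zero : D.jj 0 = 0 ∧ D.mm 0 = 0 := by
  have := D.rep_unique (k := 0) (j := 0) (m := 0) D.hq (by simp)
  exact ⟨this.1.symm, this.2.symm⟩

lemma jj_sub_p {k : ℤ} (hk : ¬ (D.q : ℤ) ∣ k) :
    D.jj (k - D.p) + 1 = D.jj k ∧ D.mm (k - D.p) = D.mm k := by
  have h := D.jj_mm k
  have h0 : D.jj k ≠ 0 := fun h0 => hk ⟨D.mm k, by rw [h0] at h; push_cast at h; linarith⟩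
  have := D.rep_unique (k := k - D.p) (j := D.jj k - 1) (m := D.mm k)
    (by have := D.jj_lt k; omega) (by push_cast [Nat.one_le_iff_ne_zero.2 h0]; linarith)
  exact ⟨by omega, this.2.symm⟩

lemma jj_neg_p : D.jj (0 - D.p) + 1 = D.q ∧ D.mm (0 - D.p) = - D.p := by
  have hq := D.hq
  have := D.rep_unique (k := 0 - D.p) (j := D.q - 1) (m := - D.p) (by omega)
    (by push_cast [Nat.one_le_iff_ne_zero.2 hq.ne']; ring)
  exact ⟨by omega, this.2.symm⟩

/-- The map taking `y 0` to `y k`. -/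
def T (k : ℤ) (x : ℝ) : ℝ := (D.f ^ D.jj k) x + D.mm k

/-- The chart at the interval between `y k` and `y (k+1)`. -/
def ch (k : ℤ) (x : ℝ) : ℝ := ((D.f ^ (-(D.jj k : ℤ))) x - D.mm k - D.y 0) / D.M

lemma lift_T (k : ℤ) : IsCircleDiffeoLift (D.T k) := (D.lift.perm_pow _).add_const _

lemma T_y (k l : ℤ) : D.T k (D.y l) = D.y (k + l) := by
  rw [T, D.iter_y, ← D.per_mul]
  congr 1
  linarith [D.jj_mm k]

lemma ch_T (k i : ℤ) (x : ℝ) : D.ch k (D.T i x) =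
    ((D.f ^ (D.jj i - D.jj k : ℤ)) x - (D.mm k - D.mm i : ℤ) - D.y 0) / D.M := by
  rw [ch, T, (D.lift.perm_zpow _).add_int, sub_eq_neg_add (D.jj i : ℤ), zpow_add,
    Equiv.Perm.mul_apply, zpow_natCast]
  push_cast; ring

lemma ch_self (k : ℤ) (ξ : ℝ) : D.ch k (D.T k (D.y 0 + D.M * ξ)) = ξ := by
  have := D.M_pos
  rw [ch_T, sub_self, sub_self, zpow_zero, Equiv.Perm.one_apply]
  field_simp
  simp

lemma T_ch (k : ℤ) (x : ℝ) : D.T k (D.y 0 + D.M * D.ch k x) = x := by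
  obtain ⟨z, rfl⟩ := (D.lift_T k).surjective x
  have : z = D.y 0 + D.M * ((z - D.y 0) / D.M) := by
    rw [mul_div_cancel₀ _ D.M_pos.ne']; ring
  rw [this, ch_self]

lemma sm_ch (k : ℤ) : Sm (D.ch k) :=
  (((D.lift.perm_zpow _).sm.sub contDiff_const).sub contDiff_const).div_const _

lemma ch_add_q (k : ℤ) (x : ℝ) : D.ch (k + D.q) (x + 1) = D.ch k x := by
  rw [ch, ch, (D.jj_add_q k).1, (D.jj_add_q k).2, (D.lift.perm_zpow _).add_one]
  push_cast; ring

lemma ch_zero (x : ℝ) : D.ch 0 x = (x - D.y 0) / D.M := by simp [ch, D.jj_zero]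

lemma ch_sub_p {k : ℤ} (hk : ¬ (D.q : ℤ) ∣ k) (x : ℝ) : D.ch (k - D.p) (D.f⁻¹ x) = D.ch k x := by
  rw [ch, ch, (D.jj_sub_p hk).2, ← (D.jj_sub_p hk).1]
  push_cast
  rw [neg_add, zpow_add, zpow_neg_one, Equiv.Perm.mul_apply]

lemma ch_neg_p (x : ℝ) :
    D.ch (0 - D.p) (D.f⁻¹ x) = ((D.f⁻¹ ^ D.q) x + D.p - D.y 0) / D.M := by
  have : (D.f ^ (-(D.jj (0 - D.p) : ℤ))) (D.f⁻¹ x) = (D.f⁻¹ ^ D.q) x := by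
    rw [← D.jj_neg_p.1, pow_succ, Equiv.Perm.mul_apply, zpow_neg, zpow_natCast, inv_pow]
  rw [ch, this, D.jj_neg_p.2]
  push_cast; ring

/-- The two-sided version of the estimate on return maps, in charts. -/
lemma exists_JB_ch (B : ℕ → ℝ) (R n : ℕ) (hR : 3 ≤ R) : ∃ C M₀, 0 ≤ C ∧ 0 < M₀ ∧
    ∀ D : Orb B, D.M ≤ M₀ → ∀ k i : ℤ, |i - k| ≤ R → ∀ ξ : ℝ, |ξ| ≤ R →
      JB n (C * D.sig) (fun ξ => D.ch k (D.T i (D.y 0 + D.M * ξ)) - ξ - (i - k)) ξ := by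
  obtain ⟨C, M0, hC, hM0, h⟩ := exists_JB_ret B R n hR
  refine ⟨C, M0, hC, hM0, fun D hM k i hik ξ hξ => ?_⟩
  have hi := D.jj_mm i
  have hk := D.jj_mm k
  have h1 := D.jj_lt i
  have h2 := D.jj_lt k
  rcases le_total (D.jj k) (D.jj i) with hl | hl
  · have := h D hM (D.jj i - D.jj k) (by omega) (D.mm k - D.mm i) (i - k) hik
      (by push_cast [hl]; linarith) ξ hξ
    convert this using 2 with x
    rw [ch_T, ret, ← zpow_natCast]
    push_cast [hl]
    rfl
  · have : JB n (C * D.sig) _ ξ := h D.inv hM (D.jj k - D.jj i)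
      (show _ ≤ D.q by omega) (D.mm k - D.mm i) (i - k) hik
      (by push_cast [hl]; change _ * -D.p = _ + _ * (D.q : ℤ); linarith) ξ hξ
    convert this using 2 with x
    rw [ch_T, ret]
    have e : D.f ^ (D.jj i - D.jj k : ℤ) = D.inv.f ^ (D.jj k - D.jj i) := by
      change _ = D.f⁻¹ ^ _
      rw [← zpow_natCast, inv_zpow', Nat.cast_sub hl, neg_sub]
    rw [e]
    push_cast
    rfl

end Orb

lemma JB.congr {n : ℕ} {C : ℝ} {f g : ℝ → ℝ} {x : ℝ} (hg : JB n C g x) (h : f =ᶠ[nhds x] g) :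
    JB n C f x := fun i hi => by rw [h.iteratedDeriv_eq]; exact hg i hi

/-- A bump function equal to one on `[0, 1]` and supported in `(-1/4, 5/4)`. -/
def bmp : ContDiffBump (1 / 2 : ℝ) := ⟨1 / 2, 3 / 4, by norm_num, by norm_num⟩

lemma sm_bmp : Sm bmp := bmp.contDiff

lemma bmp_eq_one {x : ℝ} (h0 : 0 ≤ x) (h1 : x ≤ 1) : bmp x = 1 :=
  bmp.one_of_mem_closedBall (by
    rw [Real.closedBall_eq_Icc]
    exact ⟨by norm_num [bmp]; exact h0, by norm_num [bmp]; exact h1⟩)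

lemma bmp_ne_zero {x : ℝ} (h : bmp x ≠ 0) : -(1 / 4) < x ∧ x < 5 / 4 := by
  have : x ∈ Function.support bmp := h
  rw [bmp.support_eq, Real.ball_eq_Ioo] at this
  have h1 := this.1
  have h2 := this.2
  norm_num [bmp] at h1 h2
  exact ⟨by linarith, by linarith⟩

lemma exists_JB_bmp (n : ℕ) : ∃ C, 0 ≤ C ∧ ∀ x, JB n C bmp x := by
  have h : ∀ i, ∃ C, ∀ x, |iteratedDeriv i bmp x| ≤ C := fun i => by
    have hc : HasCompactSupport (iteratedDeriv i bmp) := by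
      induction i with
      | zero => simpa using bmp.hasCompactSupport
      | succ i ih => rw [iteratedDeriv_succ]; exact ih.deriv
    exact hc.exists_bound_of_continuous (sm_bmp.iteratedDeriv i).continuous
  choose C hC using h
  refine ⟨∑ i ∈ Finset.range (n + 1), |C i|, by positivity, fun x i hi => ?_⟩
  exact ((hC i x).trans (le_abs_self _)).trans
    (Finset.single_le_sum (f := fun i => |C i|) (fun _ _ => abs_nonneg _)
      (Finset.mem_range.2 (by omega)))

namespace Orb
variable {B : ℕ → ℝ} (D : Orb B)

/-- The gaps next to the largest one have comparable length. -/
def Wide : Prop := D.y (-1) < D.y 0 - D.M * (3 / 4) ∧ D.y 0 + D.M * (7 / 4) < D.y 2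

lemma exists_wide (B : ℕ → ℝ) : ∃ M₀, 0 < M₀ ∧ ∀ D : Orb B, D.M ≤ M₀ → D.Wide := by
  obtain ⟨C, M0, hC, hM0, h⟩ := exists_y_near B 2
  refine ⟨min M0 ((1 / (8 * (C + 1))) ^ 2), by positivity, fun D hM => ?_⟩
  have m0 := D.M_pos
  have s0 := D.sig_pos
  have s1 : D.sig ≤ 1 / (8 * (C + 1)) := D.sig_le (by positivity) (hM.trans (min_le_right _ _))
  rw [le_div_iff₀ (by positivity)] at s1
  have h := fun d hd => (h D (hM.trans (min_le_left _ _)) d hd).2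
  have h1 := abs_le.1 (h (-1) (by norm_num))
  have h2 := abs_le.1 (h 2 (by norm_num))
  have h3 : C * D.sig * D.M ≤ 1 / 8 * D.M := by gcongr; linarith
  push_cast at h1 h2
  constructor <;> linarith [h1.2, h2.1]

lemma exists_index (x : ℝ) : ∃ i, D.y i ≤ x ∧ x < D.y (i + 1) := by
  have hper : ∀ m : ℤ, D.y (m * D.q) = D.y 0 + m := fun m => by rw [← D.per_mul, zero_add]
  obtain ⟨i, hi, h⟩ := Int.exists_greatest_of_bdd (P := fun i => D.y i ≤ x)
    ⟨(⌊x - D.y 0⌋ + 1) * D.q, fun z hz => by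
      refine (D.mono.lt_iff_lt.1 (hz.trans_lt ?_)).le
      rw [hper]; push_cast; linarith [Int.lt_floor_add_one (x - D.y 0)]⟩
    ⟨⌊x - D.y 0⌋ * D.q, by rw [hper]; linarith [Int.floor_le (x - D.y 0)]⟩
  exact ⟨i, hi, not_le.1 fun h' => by have := h _ h'; omega⟩

/-- A family of functions supported near the corresponding gaps. -/
def Loc (φ : ℤ → ℝ → ℝ) : Prop := ∀ k x, φ k x ≠ 0 → D.y (k - 1) < x ∧ x < D.y (k + 2)

variable {D}

lemma Loc.eq_zero {φ : ℤ → ℝ → ℝ} (hφ : D.Loc φ) {i : ℤ} {x : ℝ} (h1 : D.y (i - 1) < x)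
    (h2 : x < D.y (i + 2)) (k : ℤ) (hk : k ∉ Finset.Icc (i - 2) (i + 2)) : φ k x = 0 := by
  by_contra h
  obtain ⟨h3, h4⟩ := hφ k x h
  have h5 := D.mono.lt_iff_lt.1 (h3.trans h2)
  have h6 := D.mono.lt_iff_lt.1 (h1.trans h4)
  exact hk (Finset.mem_Icc.2 ⟨by omega, by omega⟩)

lemma Loc.tsum_eq {φ : ℤ → ℝ → ℝ} (hφ : D.Loc φ) {i : ℤ} {x : ℝ} (h1 : D.y (i - 1) < x)
    (h2 : x < D.y (i + 2)) : ∑' k, φ k x = ∑ k ∈ Finset.Icc (i - 2) (i + 2), φ k x :=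
  tsum_eq_sum (hφ.eq_zero h1 h2)

lemma Loc.summable {φ : ℤ → ℝ → ℝ} (hφ : D.Loc φ) (x : ℝ) : Summable fun k => φ k x := by
  obtain ⟨i, h1, h2⟩ := D.exists_index x
  exact summable_of_ne_finset_zero (hφ.eq_zero (i := i) ((D.mono (by omega)).trans_le h1)
    (h2.trans (D.mono (by omega))))

lemma Loc.sm {φ : ℤ → ℝ → ℝ} (hφ : D.Loc φ) (h : ∀ k, Sm (φ k)) : Sm fun x => ∑' k, φ k x := by
  refine contDiff_iff_contDiffAt.2 fun x => ?_
  obtain ⟨i, h1, h2⟩ := D.exists_index x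
  have hs : Sm fun x => ∑ k ∈ Finset.Icc (i - 2) (i + 2), φ k x := ContDiff.sum fun k _ => h k
  refine hs.contDiffAt.congr_of_eventuallyEq ?_
  filter_upwards [Ioo_mem_nhds ((D.mono (show i - 1 < i by omega)).trans_le h1)
    (h2.trans (D.mono (show i + 1 < i + 2 by omega)))] with z hz
  exact hφ.tsum_eq hz.1 hz.2

variable (D)

lemma ch_lt (hW : D.Wide) {k : ℤ} {x : ℝ} (h1 : -(3 / 4) < D.ch k x) (h2 : D.ch k x < 7 / 4) :
    D.y (k - 1) < x ∧ x < D.y (k + 2) := by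
  have m0 := D.M_pos
  have h3 := (D.lift_T k).strictMono (show D.y (-1) < D.y 0 + D.M * D.ch k x by nlinarith [hW.1])
  have h4 := (D.lift_T k).strictMono (show D.y 0 + D.M * D.ch k x < D.y 2 by nlinarith [hW.2])
  rw [T_ch, T_y] at h3 h4
  exact ⟨h3, h4⟩

lemma bmp_ch_ne_zero (hW : D.Wide) {k : ℤ} {x : ℝ} (h : bmp (D.ch k x) ≠ 0) :
    D.y (k - 1) < x ∧ x < D.y (k + 2) := by
  obtain ⟨h1, h2⟩ := bmp_ne_zero h
  exact D.ch_lt hW (by linarith) (by linarith)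

lemma loc_den (hW : D.Wide) : D.Loc fun k x => bmp (D.ch k x) :=
  fun _ _ h => D.bmp_ch_ne_zero hW h

lemma loc_num (hW : D.Wide) (δ : ℝ) :
    D.Loc fun k x => bmp (D.ch k x) * (D.ch k x + k + D.jj k * δ) :=
  fun _ _ h => D.bmp_ch_ne_zero hW (left_ne_zero_of_mul h)

lemma sm_bmp_ch (k : ℤ) : Sm fun x => bmp (D.ch k x) := sm_bmp.comp (D.sm_ch k)

/-- The denominator of the weighted average of the charts. -/
def den (x : ℝ) : ℝ := ∑' k, bmp (D.ch k x)

/-- The numerator of the weighted average of the charts. -/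
def num (δ x : ℝ) : ℝ := ∑' k : ℤ, bmp (D.ch k x) * (D.ch k x + k + D.jj k * δ)

lemma sm_den (hW : D.Wide) : Sm D.den := (D.loc_den hW).sm D.sm_bmp_ch

lemma sm_num (hW : D.Wide) (δ : ℝ) : Sm (D.num δ) :=
  (D.loc_num hW δ).sm fun k => (D.sm_bmp_ch k).mul
    (((D.sm_ch k).add contDiff_const).add contDiff_const)

lemma one_le_den (hW : D.Wide) (x : ℝ) : 1 ≤ D.den x := by
  obtain ⟨i, h1, h2⟩ := D.exists_index x
  have h3 : bmp (D.ch i x) = 1 := by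
    have m0 := D.M_pos
    rw [← D.T_ch i x] at h1 h2
    nth_rw 1 [← add_zero i] at h1
    rw [← D.T_y, (D.lift_T i).strictMono.le_iff_le] at h1
    rw [← D.T_y, (D.lift_T i).strictMono.lt_iff_lt] at h2
    have e : D.y 1 = D.y 0 + D.M := by rw [M]; ring
    rw [e] at h2
    exact bmp_eq_one (by nlinarith) (by nlinarith)
  rw [← h3]
  exact ((D.loc_den hW).summable x).le_tsum i fun _ _ => bmp.nonneg

lemma den_pos (hW : D.Wide) (x : ℝ) : 0 < D.den x := one_pos.trans_le (D.one_le_den hW x)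

lemma den_add_one (x : ℝ) : D.den (x + 1) = D.den x := by
  rw [den, ← (Equiv.addRight (D.q : ℤ)).tsum_eq]
  simp [ch_add_q, den]

lemma num_add_one (hW : D.Wide) (δ x : ℝ) : D.num δ (x + 1) = D.num δ x + D.q * D.den x := by
  rw [num, ← (Equiv.addRight (D.q : ℤ)).tsum_eq, num, den, ← tsum_mul_left,
    ← ((D.loc_num hW δ).summable x).tsum_add (((D.loc_den hW).summable x).mul_left _)]
  congr 1
  ext k
  rw [Equiv.coe_addRight, ch_add_q, (D.jj_add_q k).1]
  push_cast; ring

/-- The approximate linearization, scaled by `q`. -/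
def H (δ x : ℝ) : ℝ := D.num δ x / D.den x

lemma sm_H (hW : D.Wide) (δ : ℝ) : Sm (D.H δ) :=
  (D.sm_num hW δ).div (D.sm_den hW) fun x => (D.den_pos hW x).ne'

lemma H_add_one (hW : D.Wide) (δ x : ℝ) : D.H δ (x + 1) = D.H δ x + D.q := by
  rw [H, H, den_add_one, D.num_add_one hW, add_div, mul_div_cancel_right₀ _ (D.den_pos hW x).ne']

lemma T_mem (hW : D.Wide) (i : ℤ) {ξ : ℝ} (hξ : ξ ∈ Set.Ioo (-(3 / 4) : ℝ) (7 / 4)) :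
    D.y (i - 1) < D.T i (D.y 0 + D.M * ξ) ∧ D.T i (D.y 0 + D.M * ξ) < D.y (i + 2) :=
  D.ch_lt hW (by rw [ch_self]; exact hξ.1) (by rw [ch_self]; exact hξ.2)

/-- The derivatives of the terms of the average. -/
lemma exists_JB_bmp_ch (B : ℕ → ℝ) (n : ℕ) : ∃ C M₀, 0 ≤ C ∧ 0 < M₀ ∧
    ∀ D : Orb B, D.M ≤ M₀ → ∀ k i : ℤ, |i - k| ≤ 3 → ∀ ξ : ℝ, |ξ| ≤ 3 →
      JB n C (fun ξ => bmp (D.ch k (D.T i (D.y 0 + D.M * ξ)))) ξ := by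
  obtain ⟨C1, M1, hC1, hM1, h1⟩ := exists_JB_ch B 3 n le_rfl
  obtain ⟨C2, hC2, h2⟩ := exists_JB_bmp n
  refine ⟨n.factorial * C2 * (C1 + 4) ^ n, min M1 1, by positivity, by positivity,
    fun D hM k i hik ξ hξ => ?_⟩
  have h1 := h1 D (hM.trans (min_le_left _ _)) k i (by simpa using hik) ξ (by simpa using hξ)
  have s0 := D.sig_pos
  have s1 : D.sig ≤ 1 := D.sig_le zero_le_one (by simpa using hM.trans (min_le_right _ _))
  have sU : Sm fun ξ => D.ch k (D.T i (D.y 0 + D.M * ξ)) :=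
    (D.sm_ch k).comp ((D.lift_T i).sm.comp_affine (D.y 0) D.M)
  have sid : Sm fun ξ : ℝ => ξ := contDiff_id
  have hid : JB n 3 (fun ξ : ℝ => ξ) ξ := fun j hj => by
    rcases j with _ | j
    · rw [iteratedDeriv_zero]; exact hξ
    · exact (abs_iteratedDeriv_id_le _ (by omega) _).trans (by norm_num)
  refine JB.comp sm_bmp sU (by linarith) (h2 _) fun j hj hjn => ?_
  have h3 : JB n (C1 * D.sig + 3)
      (fun ξ => (D.ch k (D.T i (D.y 0 + D.M * ξ)) - ξ - (i - k)) + ξ) ξ :=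
    h1.add ((sU.sub sid).sub contDiff_const) sid hid
  have h4 := h3 j hjn
  have e : (fun ξ => (D.ch k (D.T i (D.y 0 + D.M * ξ)) - ξ - (i - k)) + ξ) =
      fun ξ => D.ch k (D.T i (D.y 0 + D.M * ξ)) - (i - k) := by ext; ring
  obtain ⟨l, rfl⟩ : ∃ l, j = l + 1 := ⟨j - 1, by omega⟩
  rw [e, iteratedDeriv_succ'] at h4
  rw [iteratedDeriv_succ']
  rw [show (deriv fun ξ => D.ch k (D.T i (D.y 0 + D.M * ξ)) - (i - k : ℝ)) =
    deriv fun ξ => D.ch k (D.T i (D.y 0 + D.M * ξ)) by ext; rw [deriv_sub_const]] at h4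
  refine h4.trans ?_
  nlinarith

/-- In charts, the approximate linearization is close to a translation. -/
lemma exists_JB_H (B : ℕ → ℝ) (n : ℕ) : ∃ C M₀, 0 ≤ C ∧ 0 < M₀ ∧
    ∀ D : Orb B, D.M ≤ M₀ → D.Wide → ∀ δ : ℝ, D.q * |δ| ≤ D.sig → ∀ i : ℤ,
      ∀ ξ ∈ Set.Ioo (-(3 / 4) : ℝ) (7 / 4),
      JB n (C * D.sig) (fun ξ => D.H δ (D.T i (D.y 0 + D.M * ξ)) - ξ - i) ξ ∧
      JB n C (fun ξ => D.den (D.T i (D.y 0 + D.M * ξ))) ξ := by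
  obtain ⟨C1, M1, hC1, hM1, h1⟩ := exists_JB_ch B 3 n le_rfl
  obtain ⟨C2, M2, hC2, hM2, h2⟩ := exists_JB_bmp_ch B n
  obtain ⟨C3, hC3, h3⟩ := JB_inv n 1 (5 * C2) one_pos
  refine ⟨2 ^ n * (5 * (2 ^ n * (C2 * (C1 + 1))) * C3) + 5 * C2, min M1 M2, by positivity,
    by positivity, fun D hM hW δ hδ i ξ hξ => ?_⟩
  have h1 := h1 D (hM.trans (min_le_left _ _))
  have h2 := h2 D (hM.trans (min_le_right _ _))
  have s0 := D.sig_pos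
  set X : ℝ → ℝ := fun ξ => D.T i (D.y 0 + D.M * ξ) with hX
  have sX : Sm X := (D.lift_T i).sm.comp_affine (D.y 0) D.M
  have sid : Sm fun ξ : ℝ => ξ := contDiff_id
  have sw : ∀ k, Sm fun ξ => bmp (D.ch k (X ξ)) := fun k => (D.sm_bmp_ch k).comp sX
  have sr : ∀ k, Sm fun ξ => D.ch k (X ξ) - ξ - (i - k) := fun k =>
    (((D.sm_ch k).comp sX).sub sid).sub contDiff_const
  have hev : ∀ᶠ z in nhds ξ, D.y (i - 1) < X z ∧ X z < D.y (i + 2) := by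
    filter_upwards [Ioo_mem_nhds hξ.1 hξ.2] with z hz using D.T_mem hW i hz
  have hξ3 : |ξ| ≤ 3 := abs_le.2 ⟨by linarith [hξ.1], by linarith [hξ.2]⟩
  have hk : ∀ k ∈ Finset.Icc (i - 2) (i + 2), |i - k| ≤ 3 := fun k hk => by
    rw [Finset.mem_Icc] at hk; exact abs_le.2 ⟨by omega, by omega⟩
  have hcard : (Finset.Icc (i - 2) (i + 2)).card = 5 := by
    rw [Int.card_Icc]; omega
  have hden : JB n (5 * C2) (fun ξ => D.den (X ξ)) ξ := by
    refine (JB.sum (fun k _ => sw k) (fun k hk' => h2 k i (hk k hk') ξ hξ3)).congr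
      (f := fun ξ => D.den (X ξ)) ?_ |>.mono le_rfl ?_
    · filter_upwards [hev] with z hz using (D.loc_den hW).tsum_eq hz.1 hz.2
    · rw [Finset.sum_const, hcard]; simp
  have hinv : JB n C3 (fun ξ => (D.den (X ξ))⁻¹) ξ := by
    refine h3 (fun ξ => D.den (X ξ)) ξ ((D.sm_den hW).comp sX) (fun y => (D.den_pos hW _).ne')
      hden ?_
    exact (D.one_le_den hW _).trans (le_abs_self _)
  refine ⟨?_, hden.mono le_rfl (le_add_of_nonneg_left (by positivity))⟩
  have hR : JB n (5 * (2 ^ n * (C2 * ((C1 + 1) * D.sig))))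
      (fun ξ => D.num δ (X ξ) - (ξ + i) * D.den (X ξ)) ξ := by
    refine (JB.sum (f := fun k ξ => bmp (D.ch k (X ξ)) *
        ((D.ch k (X ξ) - ξ - (i - k)) + D.jj k * δ)) (fun k _ => (sw k).mul ((sr k).add contDiff_const))
      (fun k hk' => (h2 k i (hk k hk') ξ hξ3).mul (sw k) ((sr k).add contDiff_const)
        (((h1 k i (by exact_mod_cast hk k hk') ξ (by exact_mod_cast hξ3)).add (sr k) contDiff_const
          (JB_const n _ ξ)).mono le_rfl (D := (C1 + 1) * D.sig) ?_))).congr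
      (f := fun ξ => D.num δ (X ξ) - (ξ + i) * D.den (X ξ)) ?_ |>.mono le_rfl ?_
    · have : (D.jj k : ℝ) ≤ D.q := by exact_mod_cast (D.jj_lt k).le
      rw [abs_mul, Nat.abs_cast]
      have : (D.jj k : ℝ) * |δ| ≤ D.q * |δ| := by gcongr
      linarith
    · filter_upwards [hev] with z hz
      have e1 := (D.loc_den hW).tsum_eq hz.1 hz.2
      have e2 := (D.loc_num hW δ).tsum_eq hz.1 hz.2
      rw [num, den, e1, e2, Finset.mul_sum, ← Finset.sum_sub_distrib]
      refine Finset.sum_congr rfl fun k _ => ?_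
      ring
    · rw [Finset.sum_const, hcard]; simp
  have e : (fun ξ => D.H δ (X ξ) - ξ - i) =
      fun ξ => (D.num δ (X ξ) - (ξ + i) * D.den (X ξ)) * (D.den (X ξ))⁻¹ := by
    ext z
    rw [H]
    field_simp [(D.den_pos hW (X z)).ne']
    ring
  rw [e]
  have snum := (D.sm_num hW δ).comp sX
  have sden := (D.sm_den hW).comp sX
  refine (hR.mul (snum.sub ((sid.add contDiff_const).mul sden))
    (sden.inv fun y => (D.den_pos hW _).ne') hinv).mono le_rfl ?_
  have : 0 ≤ 5 * C2 * D.sig := by positivity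
  linarith

end Orb

namespace Orb
variable {B : ℕ → ℝ} (D : Orb B)

lemma T_zero (x : ℝ) : D.T 0 x = x := by simp [T, D.jj_zero]

lemma exists_lift_H (B : ℕ → ℝ) : ∃ M₀, 0 < M₀ ∧ ∀ D : Orb B, D.M ≤ M₀ → D.Wide → ∀ δ : ℝ,
    D.q * |δ| ≤ D.sig → IsCircleDiffeoLift fun x => D.H δ x / D.q := by
  obtain ⟨C, M1, hC, hM1, h⟩ := exists_JB_H B 1
  refine ⟨min M1 ((1 / (2 * (C + 1))) ^ 2), by positivity, fun D hM hW δ hδ => ?_⟩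
  have m0 := D.M_pos
  have s0 := D.sig_pos
  have hq : (0 : ℝ) < D.q := by exact_mod_cast D.hq
  have s1 : D.sig ≤ 1 / (2 * (C + 1)) := D.sig_le (by positivity) (hM.trans (min_le_right _ _))
  rw [le_div_iff₀ (by positivity)] at s1
  refine ⟨(D.sm_H hW δ).div_const _, fun x => ?_, fun x => ?_⟩
  · change D.H δ (x + 1) / D.q = D.H δ x / D.q + 1
    rw [D.H_add_one hW, add_div, div_self hq.ne']
  · rw [deriv_div_const]
    refine div_pos ?_ hq
    obtain ⟨i, h1, h2⟩ := D.exists_index x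
    rw [← D.T_ch i x] at h1 h2
    nth_rw 1 [← add_zero i] at h1
    rw [← D.T_y, (D.lift_T i).strictMono.le_iff_le] at h1
    rw [← D.T_y, (D.lift_T i).strictMono.lt_iff_lt] at h2
    rw [show D.y 1 = D.y 0 + D.M by rw [M]; ring] at h2
    have hξ : D.ch i x ∈ Set.Ioo (-(3 / 4) : ℝ) (7 / 4) := ⟨by nlinarith, by nlinarith⟩
    have h3 := (h D (hM.trans (min_le_left _ _)) hW δ hδ i _ hξ).1 1 le_rfl
    rw [iteratedDeriv_one] at h3
    have sX : Sm fun ξ => D.T i (D.y 0 + D.M * ξ) := (D.lift_T i).sm.comp_affine (D.y 0) D.M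
    have h4 : HasDerivAt (fun ξ => D.H δ (D.T i (D.y 0 + D.M * ξ)) - ξ - i)
        (deriv (D.H δ) x * (D.M * deriv (D.T i) (D.y 0 + D.M * D.ch i x)) - 1) (D.ch i x) := by
      have h5 := (D.sm_H hW δ).hasDerivAt x
      rw [← D.T_ch i x] at h5
      have h6 := h5.comp (D.ch i x) ((D.lift_T i).sm.hasDerivAt_comp_affine (D.y 0) D.M (D.ch i x))
      rw [D.T_ch i x] at h6
      exact (h6.sub (hasDerivAt_id _)).sub_const _
    rw [h4.deriv] at h3
    have h5 := (D.lift_T i).deriv_pos (D.y 0 + D.M * D.ch i x)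
    have h6 := (abs_le.1 h3).1
    have h7 : 0 < deriv (D.H δ) x * (D.M * deriv (D.T i) (D.y 0 + D.M * D.ch i x)) := by
      nlinarith
    exact pos_of_mul_pos_left h7 (by positivity)

/-- The defect of equivariance of the approximate linearization. -/
def defect (δ w : ℝ) : ℝ := D.H δ (D.f⁻¹ w) + (D.p + δ) - D.H δ w

lemma f_inv_y (k : ℤ) : D.f⁻¹ (D.y k) = D.y (k - D.p) := by
  rw [Equiv.Perm.inv_eq_iff_eq, D.shift, sub_add_cancel]

variable {D} in
lemma Loc.sub_p {φ : ℤ → ℝ → ℝ} (hφ : D.Loc φ) : D.Loc fun k w => φ (k - D.p) (D.f⁻¹ w) := by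
  intro k w h
  obtain ⟨h1, h2⟩ := hφ _ _ h
  rw [← sub_right_comm, ← f_inv_y, D.lift.inv.strictMono.lt_iff_lt] at h1
  rw [sub_add_eq_add_sub, ← f_inv_y, D.lift.inv.strictMono.lt_iff_lt] at h2
  exact ⟨h1, h2⟩

variable {D} in
lemma Loc.tsum_sub_tsum {φ ψ : ℤ → ℝ → ℝ} (hφ : D.Loc φ) (hψ : D.Loc ψ) (hq : 5 ≤ D.q) {w : ℝ}
    (h1 : D.y (-3) < w) (h2 : w < D.y (D.q - 2))
    (h : ∀ k, ¬ (D.q : ℤ) ∣ k → φ k w = ψ k w) :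
    ∑' k, φ k w - ∑' k, ψ k w = φ 0 w - ψ 0 w := by
  rw [← (hφ.summable w).tsum_sub (hψ.summable w), tsum_eq_single 0]
  intro k hk
  by_cases hd : (D.q : ℤ) ∣ k
  · have : ∀ φ : ℤ → ℝ → ℝ, D.Loc φ → φ k w = 0 := fun φ hφ => by
      by_contra h0
      obtain ⟨h3, h4⟩ := hφ k w h0
      have h5 := D.mono.lt_iff_lt.1 (h3.trans h2)
      have h6 := D.mono.lt_iff_lt.1 (h1.trans h4)
      exact hk (Int.eq_zero_of_abs_lt_dvd hd (abs_lt.2 ⟨by omega, by omega⟩))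
    rw [this φ hφ, this ψ hψ, sub_zero]
  · rw [h k hd, sub_self]

/-- The chart at `y 0` after a first return. -/
def vv (w : ℝ) : ℝ := D.ch (0 - D.p) (D.f⁻¹ w)

lemma den_sub (hW : D.Wide) (hq : 5 ≤ D.q) {w : ℝ} (h1 : D.y (-3) < w) (h2 : w < D.y (D.q - 2)) :
    D.den (D.f⁻¹ w) - D.den w = bmp (D.vv w) - bmp (D.ch 0 w) := by
  have e : D.den (D.f⁻¹ w) = ∑' k, bmp (D.ch (k - D.p) (D.f⁻¹ w)) := by
    rw [den, ← (Equiv.subRight (D.p : ℤ)).tsum_eq]; rfl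
  rw [e, den]
  exact (D.loc_den hW).sub_p.tsum_sub_tsum (D.loc_den hW) hq h1 h2
    fun k hk => by rw [D.ch_sub_p hk]

lemma num_sub (hW : D.Wide) (hq : 5 ≤ D.q) (δ : ℝ) {w : ℝ} (h1 : D.y (-3) < w)
    (h2 : w < D.y (D.q - 2)) :
    D.num δ (D.f⁻¹ w) + (D.p + δ) * D.den (D.f⁻¹ w) - D.num δ w =
      bmp (D.vv w) * (D.vv w + D.q * δ) - bmp (D.ch 0 w) * D.ch 0 w := by
  set φ : ℤ → ℝ → ℝ := fun k w => bmp (D.ch k w) * (D.ch k w + k + D.p + (D.jj k + 1) * δ) with hφ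
  have hl : D.Loc φ := fun _ _ h => D.bmp_ch_ne_zero hW (left_ne_zero_of_mul h)
  have e : D.num δ (D.f⁻¹ w) + (D.p + δ) * D.den (D.f⁻¹ w) =
      ∑' k, φ (k - D.p) (D.f⁻¹ w) := by
    rw [show ∑' k, φ (k - D.p) (D.f⁻¹ w) = ∑' k, φ k (D.f⁻¹ w) from
      (Equiv.subRight (D.p : ℤ)).tsum_eq (fun k => φ k (D.f⁻¹ w)), num, den, ← tsum_mul_left,
      ← ((D.loc_num hW δ).summable _).tsum_add (((D.loc_den hW).summable _).mul_left _)]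
    congr 1
    ext k
    rw [hφ]; ring
  rw [e, num, hl.sub_p.tsum_sub_tsum (D.loc_num hW δ) hq h1 h2]
  · simp only [hφ, vv]
    have : ((D.jj (0 - D.p) : ℝ) + 1) = D.q := by exact_mod_cast D.jj_neg_p.1
    rw [this, D.jj_zero.1]
    push_cast; ring
  · intro k hk
    have : ((D.jj (k - D.p) : ℝ) + 1) = D.jj k := by exact_mod_cast (D.jj_sub_p hk).1
    simp only [hφ]
    rw [this, D.ch_sub_p hk]
    push_cast; ring

lemma defect_eq (hW : D.Wide) (hq : 5 ≤ D.q) (δ : ℝ) {w : ℝ} (h1 : D.y (-3) < w)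
    (h2 : w < D.y (D.q - 2)) :
    D.defect δ w = (bmp (D.vv w) * (D.vv w + D.q * δ) - bmp (D.ch 0 w) * D.ch 0 w -
      D.H δ w * (bmp (D.vv w) - bmp (D.ch 0 w))) * (D.den (D.f⁻¹ w))⁻¹ := by
  rw [← D.num_sub hW hq δ h1 h2, ← D.den_sub hW hq h1 h2, defect, H, H]
  have := (D.den_pos hW w).ne'
  have := (D.den_pos hW (D.f⁻¹ w)).ne'
  field_simp
  ring

lemma vv_eq (w : ℝ) : D.vv w = D.ch 0 w + D.inv.ret D.q (-D.p) 0 (D.ch 0 w) := by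
  have : D.y 0 + D.M * D.ch 0 w = w := by
    rw [← D.T_zero (D.y 0 + _), T_ch]
  rw [vv, ch_neg_p, ret]
  change _ = _ + (((D.f⁻¹ ^ D.q) (D.y 0 + D.M * D.ch 0 w) - _ - D.y 0) / D.M - _ - _)
  rw [this]
  push_cast; ring

lemma ch_zero_eq (w : ℝ) : D.ch 0 w = D.vv w + D.ret D.q D.p 0 (D.vv w) := by
  have h : D.y 0 + D.M * D.vv w = (D.f⁻¹ ^ D.q) w + D.p := by
    rw [vv, ch_neg_p, mul_div_cancel₀ _ D.M_pos.ne']; ring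
  rw [ret, h, (D.lift.perm_pow _).add_int, ← Equiv.Perm.mul_apply, inv_pow,
    mul_inv_cancel, Equiv.Perm.one_apply, ch_zero]
  push_cast; ring

lemma defect_eq_zero (hW : D.Wide) (hq : 5 ≤ D.q) (δ : ℝ) {w : ℝ} (h1 : D.y (-3) < w)
    (h2 : w < D.y (D.q - 2)) (hr : ∀ ξ : ℝ, |ξ| ≤ 3 → |D.ret D.q D.p 0 ξ| ≤ 1 / 16)
    (h : D.ch 0 w ∉ Set.Icc (-(5 / 16) : ℝ) (21 / 16)) : D.defect δ w = 0 := by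
  have h3 : bmp (D.ch 0 w) = 0 := by
    by_contra h0
    obtain ⟨h3, h4⟩ := bmp_ne_zero h0
    exact h ⟨by linarith, by linarith⟩
  have h4 : bmp (D.vv w) = 0 := by
    by_contra h0
    obtain ⟨h3, h4⟩ := bmp_ne_zero h0
    have h5 := abs_le.1 (hr (D.vv w) (abs_le.2 ⟨by linarith, by linarith⟩))
    have h6 := D.ch_zero_eq w
    exact h ⟨by linarith, by linarith⟩
  rw [D.defect_eq hW hq δ h1 h2, h3, h4]
  ring

end Orb

lemma JB_id (n : ℕ) {C x : ℝ} (hC : 1 ≤ C) (hx : |x| ≤ C) : JB n C (fun y : ℝ => y) x := by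
  intro j _
  rcases j with _ | j
  · rw [iteratedDeriv_zero]; exact hx
  · exact (abs_iteratedDeriv_id_le _ (by omega) _).trans hC

namespace Orb
variable {B : ℕ → ℝ} (D : Orb B)

lemma inv_mem (hq : 5 ≤ D.q) (hW : D.Wide) {ξ : ℝ} (hξ : ξ ∈ Set.Ioo (-(3 / 4) : ℝ) (7 / 4)) :
    D.y (-3) < D.y 0 + D.M * ξ ∧ D.y 0 + D.M * ξ < D.y (D.q - 2) := by
  have h := D.T_mem hW 0 hξ
  rw [T_zero] at h
  exact ⟨(D.mono (by omega)).trans h.1, h.2.trans_le (D.mono.monotone (by omega))⟩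

/-- The defect of equivariance is tiny. -/
lemma exists_JB_defect (B : ℕ → ℝ) (n : ℕ) (hn : 1 ≤ n) : ∃ K M₀, 0 ≤ K ∧ 0 < M₀ ∧
    ∀ D : Orb B, D.M ≤ M₀ → D.Wide → 5 ≤ D.q → ∀ δ : ℝ, D.q * |δ| ≤ D.M ^ n →
      ∀ ξ ∈ Set.Ioo (-(3 / 4) : ℝ) (7 / 4),
      JB n (K * D.M ^ n) (fun ξ => D.defect δ (D.y 0 + D.M * ξ)) ξ := by
  obtain ⟨C1, M1, hC1, hM1, h1⟩ := exists_JB_close B (n + 3) n (by omega) hn (by omega)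
  obtain ⟨C2, hC2, h2⟩ := exists_JB_bmp (n + 1)
  obtain ⟨C5, M5, hC5, hM5, h5⟩ := exists_JB_H B n
  set C := C2 + 2 ^ (n + 1) * (C2 * 5) + 1 with hC
  have hCp : 0 ≤ 2 ^ (n + 1) * (C2 * 5) := by positivity
  obtain ⟨K4, hK4, h4⟩ := JB_comp_sub n C
  obtain ⟨K6, hK6, h6⟩ := JB_inv n 1 (C5 + K4) one_pos
  refine ⟨2 ^ n * ((K4 * C1 + (C2 + K4) + 2 ^ n * ((C5 + 3) * (K4 * C1))) * K6),
    min (min M1 M5) (min 1 (1 / (C1 + 1))), by positivity, by positivity,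
    fun D hM hW hq δ hδ ξ hξ => ?_⟩
  have m0 := D.M_pos
  have s0 := D.sig_pos
  have m1 : D.M ≤ 1 := hM.trans ((min_le_right _ _).trans (min_le_left _ _))
  have m2 : D.M ≤ 1 / (C1 + 1) := hM.trans ((min_le_right _ _).trans (min_le_right _ _))
  rw [le_div_iff₀ (by positivity)] at m2
  have s1 : D.sig ≤ 1 := D.sig_le zero_le_one (by simpa using m1)
  have mn : D.M ^ n ≤ D.M := pow_le_of_le_one m0.le m1 (by omega)
  have ms : D.M ≤ D.sig := by rw [← D.sig_sq, sq]; exact mul_le_of_le_one_left s0.le s1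
  have hξ3 : |ξ| ≤ 3 := abs_le.2 ⟨by linarith [hξ.1], by linarith [hξ.2]⟩
  set γ : ℝ → ℝ := D.inv.ret D.q (-D.p) 0 with hγ
  have sγ : Sm γ := D.inv.sm_ret _ _ _
  have sid : Sm fun ξ : ℝ => ξ := contDiff_id
  have hγJ : JB n (C1 * D.M ^ n) γ ξ :=
    h1 D.inv (hM.trans ((min_le_left _ _).trans (min_le_left _ _))) ξ
      (hξ3.trans (by push_cast; linarith [Nat.cast_nonneg (α := ℝ) n]))
  have hη : C1 * D.M ^ n ≤ 1 := by nlinarith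
  have harg : ∀ s ∈ Set.Icc (0 : ℝ) 1, |ξ + s * γ ξ| ≤ 5 := fun s hs => by
    have := hγJ.apply.trans hη
    have h7 : |s * γ ξ| ≤ 1 := by
      rw [abs_mul, abs_of_nonneg hs.1]; exact mul_le_one₀ hs.2 (abs_nonneg _) this
    exact (abs_add_le _ _).trans (by linarith)
  have hid : ∀ i, 1 ≤ i → i ≤ n → |iteratedDeriv i (fun ξ : ℝ => ξ) ξ| ≤ C := fun i hi _ =>
    (abs_iteratedDeriv_id_le i hi ξ).trans (by linarith)
  have hd1 : JB n (K4 * (C1 * D.M ^ n)) (fun ξ => bmp (ξ + γ ξ) - bmp ξ) ξ :=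
    h4 bmp (fun ξ => ξ) γ ξ _ sm_bmp sid sγ hη
      (fun s _ => ((JB_succ.1 (h2 _)).2).mono le_rfl (by linarith)) hid hγJ
  have hd2 : JB n (K4 * (C1 * D.M ^ n)) (fun ξ => bmp (ξ + γ ξ) * (ξ + γ ξ) - bmp ξ * ξ) ξ :=
    h4 (fun x => bmp x * x) (fun ξ => ξ) γ ξ _ (sm_bmp.mul sid) sid sγ hη
      (fun s hs => ((JB_succ.1 ((h2 _).mul sm_bmp sid
        (JB_id (n + 1) (by norm_num : (1:ℝ) ≤ 5) (harg s hs)))).2).mono le_rfl (by linarith))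
      hid hγJ
  have sbg : Sm fun ξ => bmp (ξ + γ ξ) := sm_bmp.comp (sid.add sγ)
  have sd1 : Sm fun ξ => bmp (ξ + γ ξ) - bmp ξ := sbg.sub sm_bmp
  have sd2 : Sm fun ξ => bmp (ξ + γ ξ) * (ξ + γ ξ) - bmp ξ * ξ :=
    (sbg.mul (sid.add sγ)).sub (sm_bmp.mul sid)
  have hK4η : K4 * (C1 * D.M ^ n) ≤ K4 := mul_le_of_le_one_right hK4 hη
  have hb : JB n (C2 + K4) (fun ξ => bmp (ξ + γ ξ)) ξ := by
    have : JB n (C2 + K4 * (C1 * D.M ^ n)) (fun ξ => bmp ξ + (bmp (ξ + γ ξ) - bmp ξ)) ξ :=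
      ((h2 ξ).mono (Nat.le_succ n) le_rfl).add sm_bmp sd1 hd1
    simp only [add_sub_cancel] at this
    exact this.mono le_rfl (by linarith)
  obtain ⟨h5H, h5d⟩ := h5 D (hM.trans ((min_le_left _ _).trans (min_le_right _ _))) hW δ
    (by linarith) 0 ξ hξ
  simp only [T_zero, Int.cast_zero, sub_zero] at h5H h5d
  set X : ℝ → ℝ := fun ξ => D.y 0 + D.M * ξ with hX
  have sX : Sm X := sid.comp_affine (D.y 0) D.M
  have sH : Sm fun ξ => D.H δ (X ξ) := (D.sm_H hW δ).comp sX
  have sdX : Sm fun ξ => D.den (X ξ) := (D.sm_den hW).comp sX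
  have sden : Sm fun ξ => D.den (D.f⁻¹ (X ξ)) := (D.sm_den hW).comp (D.lift.inv.sm.comp sX)
  have hHJ : JB n (C5 + 3) (fun ξ => D.H δ (X ξ)) ξ := by
    have : JB n (C5 * D.sig + 3) (fun ξ => (D.H δ (X ξ) - ξ) + ξ) ξ :=
      h5H.add (sH.sub sid) sid (JB_id n (by norm_num) hξ3)
    simp only [sub_add_cancel] at this
    exact this.mono le_rfl (by nlinarith)
  have hev : ∀ᶠ z in nhds ξ, D.y (-3) < X z ∧ X z < D.y (D.q - 2) := by
    filter_upwards [Ioo_mem_nhds hξ.1 hξ.2] with z hz using D.inv_mem hq hW hz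
  have hch : ∀ z, D.ch 0 (X z) = z := fun z => by
    rw [ch_zero, hX]; field_simp; ring
  have hvv : ∀ z, D.vv (X z) = z + γ z := fun z => by rw [vv_eq, hch]
  have hden : JB n (C5 + K4) (fun ξ => D.den (D.f⁻¹ (X ξ))) ξ := by
    refine ((h5d.add sdX sd1 hd1).mono le_rfl (by linarith)).congr ?_
    filter_upwards [hev] with z hz
    have := D.den_sub hW hq hz.1 hz.2
    rw [hvv, hch] at this
    linarith
  have hinv := h6 _ ξ sden (fun y => (D.den_pos hW _).ne') hden
    ((D.one_le_den hW _).trans (le_abs_self _))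
  have hqd : |D.q * δ| ≤ D.M ^ n := by rwa [abs_mul, Nat.abs_cast]
  have hz := (hd2.add sd2 (contDiff_const.mul sbg) (JB.const_mul hqd hb)).sub
    (sd2.add (contDiff_const.mul sbg)) (sH.mul sd1) (hHJ.mul sH sd1 hd1)
  refine ((hz.mul ((sd2.add (contDiff_const.mul sbg)).sub (sH.mul sd1))
    (sden.inv fun y => (D.den_pos hW _).ne') hinv).mono le_rfl (le_of_eq (by ring))).congr ?_
  filter_upwards [hev] with z hz
  rw [D.defect_eq hW hq δ hz.1 hz.2, hvv, hch]
  simp only [Pi.inv_apply]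
  ring

end Orb

namespace Orb
variable {B : ℕ → ℝ} (D : Orb B)

lemma exists_add_int_mem (w : ℝ) : ∃ m : ℤ, D.y (-2) ≤ w - m ∧ w - m < D.y (D.q - 2) := by
  have h := D.per (-2)
  rw [show (-2 : ℤ) + D.q = D.q - 2 by ring] at h
  refine ⟨⌊w - D.y (-2)⌋, ?_, ?_⟩
  · linarith [Int.floor_le (w - D.y (-2))]
  · linarith [Int.lt_floor_add_one (w - D.y (-2))]

set_option maxHeartbeats 1000000 in
/-- After the conjugacy `H / q`, the map is close to the rotation by `(p + δ) / q`. -/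
lemma exists_JB_conj (B : ℕ → ℝ) (n : ℕ) (hn : 1 ≤ n) : ∃ K M₀, 0 ≤ K ∧ 0 < M₀ ∧
    ∀ D : Orb B, D.M ≤ M₀ → ∀ δ : ℝ, D.q * |δ| ≤ D.M ^ n →
      ∃ h : Equiv.Perm ℝ, IsCircleDiffeoLift h ∧ ∃ Y : ℝ → ℝ, Sm Y ∧
        (∀ x, Y (D.f x) = h⁻¹ (h x + (D.p + δ) / D.q)) ∧
        ∀ w, JB n (K * D.M) (fun w => Y w - w) w := by
  obtain ⟨Mw, hMw, hw⟩ := exists_wide B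
  obtain ⟨ML, hML, hL⟩ := exists_lift_H B
  obtain ⟨C1, M1, hC1, hM1, h1⟩ := exists_JB_close B 3 1 le_rfl le_rfl (by norm_num)
  obtain ⟨Kd, Md, hKd, hMd, hd⟩ := exists_JB_defect B n hn
  obtain ⟨C5, M5, hC5, hM5, h5⟩ := exists_JB_H B (n + 1)
  obtain ⟨Ki, hKi, hi⟩ := JB_inverse n (1 / 2) (C5 + 2) (by norm_num)
  obtain ⟨Kc, hKc, hc⟩ := JB_comp_sub n (max Ki (C5 + 2))
  refine ⟨Kc * Kd, min (min (min Mw ML) (min M1 Md)) (min M5 (min ((1 / (64 * (C5 + 1))) ^ 2)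
    (min (1 / (16 * (Kd + 1))) (min (1 / (16 * (C1 + 1))) (1 / 5))))), by positivity, by positivity,
    fun D hM δ hδ => ?_⟩
  simp only [le_min_iff] at hM
  obtain ⟨⟨⟨m1, m2⟩, m3, m4⟩, m5, m6, m7, m8, m9⟩ := hM
  have m0 := D.M_pos
  have s0 := D.sig_pos
  have hW := hw D m1
  have hq0 : (0 : ℝ) < D.q := by exact_mod_cast D.hq
  have hq : 5 ≤ D.q := by
    have h2 := D.one_le_q_mul_M
    have h3 : (5 : ℝ) ≤ D.q := by nlinarith
    exact_mod_cast h3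
  have s1 : D.sig ≤ 1 / (64 * (C5 + 1)) := D.sig_le (by positivity) m6
  rw [le_div_iff₀ (by positivity)] at s1 m7 m8
  have sle1 : D.sig ≤ 1 := by nlinarith
  have hCs : C5 * D.sig ≤ 1 / 64 := by nlinarith
  have mle : D.M ≤ 1 := by linarith
  have mn : D.M ^ n ≤ D.M := pow_le_of_le_one m0.le mle (by omega)
  have ms : D.M ≤ D.sig := by rw [← D.sig_sq, sq]; exact mul_le_of_le_one_left s0.le sle1
  have hKdM : Kd * D.M ^ n ≤ 1 / 16 := by
    have := mul_le_mul_of_nonneg_left mn hKd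
    nlinarith
  have hδ' : D.q * |δ| ≤ D.sig := by linarith
  have hlift := hL D m2 hW δ hδ'
  set h : Equiv.Perm ℝ := hlift.toPerm with hh
  have hcoe : ⇑h = fun x => D.H δ x / D.q := hlift.coe_toPerm
  have lh : IsCircleDiffeoLift ⇑h := by rw [hcoe]; exact hlift
  have sid : Sm fun ξ : ℝ => ξ := contDiff_id
  set Y : ℝ → ℝ := fun w => h⁻¹ (h (D.f⁻¹ w) + (D.p + δ) / D.q) with hY
  have sY : Sm Y := lh.inv.sm.comp ((lh.sm.comp D.lift.inv.sm).add contDiff_const)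
  have hYd : ∀ w, Y w = h⁻¹ ((D.H δ w + D.defect δ w) / D.q) := fun w => by
    rw [hY]
    simp only [hcoe, defect]
    congr 1
    field_simp
    ring
  have hYper : ∀ x, Y (x + 1) - (x + 1) = Y x - x := fun x => by
    have : Y (x + 1) = Y x + 1 := by
      simp only [hY]
      rw [D.lift.inv.add_one, lh.add_one, add_right_comm, lh.inv.add_one]
    rw [this]; ring
  refine ⟨h, lh, Y, sY, fun x => by simp [hY], ?_⟩
  suffices H : ∀ w, D.y (-2) ≤ w → w < D.y (D.q - 2) →
      JB n (Kc * Kd * D.M) (fun w => Y w - w) w by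
    intro w i hi
    obtain ⟨m, hm1, hm2⟩ := D.exists_add_int_mem w
    have hp : Function.Periodic (iteratedDeriv i fun w => Y w - w) 1 :=
      periodic_iteratedDeriv hYper i
    have := hp.int_mul (-m) w
    simp only [mul_one, Int.cast_neg, ← sub_eq_add_neg] at this
    rw [← this]
    exact H _ hm1 hm2 i hi
  intro w hw1 hw2
  have hw1' : D.y (-3) < w := (D.mono (by norm_num)).trans_le hw1
  by_cases hcw : D.ch 0 w ∈ Set.Icc (-(5 / 16) : ℝ) (21 / 16)
  · set Hh : ℝ → ℝ := fun t => D.H δ (D.y 0 + D.M * t) with hHh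
    set e : ℝ → ℝ := fun t => D.defect δ (D.y 0 + D.M * t) with he
    set I : ℝ → ℝ := fun s => (h⁻¹ (s / D.q) - D.y 0) / D.M with hI
    have sHh : Sm Hh := (D.sm_H hW δ).comp_affine _ _
    have sdef : Sm (D.defect δ) :=
      (((D.sm_H hW δ).comp D.lift.inv.sm).add contDiff_const).sub (D.sm_H hW δ)
    have se : Sm e := sdef.comp_affine _ _
    have sI : Sm I :=
      ((lh.inv.sm.comp (contDiff_id.div_const _)).sub contDiff_const).div_const _
    have hHI : ∀ s, Hh (I s) = s := fun s => by
      have h3 : h (h⁻¹ (s / D.q)) = s / D.q := by simp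
      rw [hcoe] at h3
      simp only [hHh, hI]
      rw [mul_div_cancel₀ _ m0.ne', add_sub_cancel]
      exact (div_left_inj' hq0.ne').1 h3
    have hHq : ∀ x, D.H δ x = D.q * h x := fun x => by
      rw [hcoe]; field_simp
    have hmono : StrictMono Hh := fun a b hab => by
      simp only [hHh, hHq]
      have : h (D.y 0 + D.M * a) < h (D.y 0 + D.M * b) := lh.strictMono (by nlinarith)
      nlinarith
    have hIH : ∀ t, I (Hh t) = t := fun t => hmono.injective (hHI _)
    have hder : ∀ y, deriv Hh y ≠ 0 := fun y => by
      rw [((D.sm_H hW δ).hasDerivAt_comp_affine (D.y 0) D.M y).deriv]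
      have : D.H δ = fun x => D.q * h x := funext hHq
      rw [this, deriv_const_mul _ lh.sm.differentiable'.differentiableAt]
      have := lh.deriv_pos (D.y 0 + D.M * y)
      positivity
    have hH : ∀ ξ ∈ Set.Ioo (-(3 / 4) : ℝ) (7 / 4), JB (n + 1) (1 / 64) (fun ξ => Hh ξ - ξ) ξ := by
      intro ξ hξ
      have := (h5 D m5 hW δ hδ' 0 ξ hξ).1
      simp only [T_zero, Int.cast_zero, sub_zero] at this
      exact this.mono le_rfl hCs
    have hH2 : ∀ ξ ∈ Set.Ioo (-(3 / 4) : ℝ) (7 / 4), ∀ i, 1 ≤ i → i ≤ n + 1 →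
        |iteratedDeriv i Hh ξ| ≤ C5 + 2 := by
      intro ξ hξ i hi1 hi2
      have h7 := hH ξ hξ i hi2
      rw [iteratedDeriv_fun_sub (sHh.nat i).contDiffAt (sid.nat i).contDiffAt] at h7
      have h8 := abs_iteratedDeriv_id_le i hi1 ξ
      have h9 := abs_le.1 h7
      have h10 := abs_le.1 h8
      rw [abs_le]
      constructor <;> linarith [h9.1, h9.2, h10.1, h10.2]
    set ξ := D.ch 0 w with hξ
    have hwξ : ξ = -D.y 0 / D.M + D.M⁻¹ * w := by rw [hξ, ch_zero]; field_simp; ring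
    have hξm : ξ ∈ Set.Ioo (-(3 / 4) : ℝ) (7 / 4) := ⟨by linarith [hcw.1], by linarith [hcw.2]⟩
    have heJ : JB n (Kd * D.M ^ n) e ξ := hd D m4 hW hq δ hδ ξ hξm
    have hval : ∀ ξ ∈ Set.Ioo (-(3 / 4) : ℝ) (7 / 4), |Hh ξ - ξ| ≤ 1 / 64 := fun ξ hξ =>
      (hH ξ hξ).apply
    have hwin : ∀ s ∈ Set.Icc (0 : ℝ) 1, I (Hh ξ + s * e ξ) ∈ Set.Ioo (-(3 / 4) : ℝ) (7 / 4) := by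
      intro s hs
      have ha := abs_le.1 (hval ξ hξm)
      have h7 : |s * e ξ| ≤ 1 / 16 := by
        rw [abs_mul, abs_of_nonneg hs.1]
        have := heJ.apply.trans hKdM
        nlinarith [hs.2, abs_nonneg (e ξ)]
      have hb := abs_le.1 h7
      have hc1 := abs_le.1 (hval (-(5 / 8)) ⟨by norm_num, by norm_num⟩)
      have hc2 := abs_le.1 (hval (13 / 8) ⟨by norm_num, by norm_num⟩)
      have k1 : -(5 / 8) < I (Hh ξ + s * e ξ) := by
        rw [← hmono.lt_iff_lt, hHI]; linarith [ha.1, hb.1, hc1.2, hcw.1]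
      have k2 : I (Hh ξ + s * e ξ) < 13 / 8 := by
        rw [← hmono.lt_iff_lt, hHI]; linarith [ha.2, hb.2, hc2.1, hcw.2]
      exact ⟨by linarith, by linarith⟩
    have hΦ := hc I Hh e ξ (Kd * D.M ^ n) sI sHh se (by linarith) (fun s hs => by
        have hm := hwin s hs
        refine (hi Hh I _ sHh sI hHI hder ?_ ?_).mono le_rfl (le_max_left _ _)
        · have h7 := hH _ hm 1 (by omega)
          rw [iteratedDeriv_one, ((sHh.hasDerivAt _).fun_sub (hasDerivAt_id' _)).deriv] at h7
          have := (abs_le.1 h7).1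
          exact le_trans (by linarith) (le_abs_self _)
        · intro i hi
          rw [← iteratedDeriv_succ']
          exact hH2 _ hm _ (by omega) (by omega))
      (fun i hi1 hi2 => (hH2 ξ hξm i hi1 (by omega)).trans (le_max_right _ _)) heJ
    set Φ : ℝ → ℝ := fun y => I (Hh y + e y) - I (Hh y) with hΦd
    have sΦ : Sm Φ := (sI.comp (sHh.add se)).sub (sI.comp sHh)
    have hYΦ : (fun w => Y w - w) = fun w => D.M * Φ (-D.y 0 / D.M + D.M⁻¹ * w) := by
      funext z
      simp only [hΦd, hIH]
      have h7 : D.y 0 + D.M * (-D.y 0 / D.M + D.M⁻¹ * z) = z := by field_simp; ring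
      simp only [hI, hHh, he, h7, hYd]
      field_simp
      ring
    rw [hYΦ]
    intro i hi
    rw [iteratedDeriv_const_mul_field, iteratedDeriv_comp_affine sΦ, ← hwξ, abs_mul, abs_mul,
      abs_of_pos m0, abs_of_pos (by positivity : 0 < D.M⁻¹ ^ i)]
    have h8 := hΦ i hi
    have h9 : D.M⁻¹ ^ i * D.M ^ n ≤ 1 := by
      rw [inv_pow, inv_mul_le_one₀ (by positivity)]
      exact pow_le_pow_of_le_one m0.le mle hi
    calc D.M * (D.M⁻¹ ^ i * |iteratedDeriv i Φ ξ|)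
        ≤ D.M * (D.M⁻¹ ^ i * (Kc * (Kd * D.M ^ n))) := by gcongr
      _ = Kc * Kd * D.M * (D.M⁻¹ ^ i * D.M ^ n) := by ring
      _ ≤ Kc * Kd * D.M * 1 := by gcongr
      _ = Kc * Kd * D.M := mul_one _
  · have h0 : JB n (Kc * Kd * D.M) (fun _ : ℝ => (0 : ℝ)) w :=
      (JB_const n 0 w).mono le_rfl (by rw [abs_zero]; positivity)
    refine h0.congr ?_
    have hr : ∀ ξ : ℝ, |ξ| ≤ 3 → |D.ret D.q D.p 0 ξ| ≤ 1 / 16 := fun ξ hξ => by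
      refine (h1 D m3 ξ (by simpa using hξ)).apply.trans ?_
      rw [pow_one]; nlinarith
    have hopen := ((isClosed_Icc.isOpen_compl).preimage (D.sm_ch 0).continuous).mem_nhds
      (show w ∈ D.ch 0 ⁻¹' (Set.Icc (-(5 / 16) : ℝ) (21 / 16))ᶜ from hcw)
    filter_upwards [hopen, Ioo_mem_nhds hw1' hw2] with z hz hz2
    have := D.defect_eq_zero hW hq δ hz2.1 hz2.2 hr hz
    rw [hYd, this, add_zero]
    have h3 : D.H δ z / D.q = h z := by rw [hcoe]
    rw [h3]
    simp

end Orb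

/-- Liouville numbers have very good reduced rational approximations with large denominators. -/
lemma Liouville.exists_coprime {a : ℝ} (ha : Liouville a) (m N : ℕ) {δ : ℝ} (hδ : 0 < δ) :
    ∃ (p : ℤ) (q : ℕ), 0 < q ∧ N ≤ q ∧ IsCoprime p (q : ℤ) ∧ |a - p / q| < δ ∧
      |a - p / q| ≤ 1 / (q : ℝ) ^ m := by
  obtain ⟨ρ, hρ, h1⟩ := Metric.eventually_nhds_iff.1
    (ha.irrational.eventually_forall_le_dist_cast_rat_of_den_le N)
  have h2 := @h1 (ρ / 2) (by rw [Real.dist_eq, sub_zero, abs_of_pos] <;> linarith)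
  obtain ⟨k, hk⟩ := exists_pow_lt_of_lt_one (lt_min hδ (half_pos hρ))
    (by norm_num : (1 / 2 : ℝ) < 1)
  obtain ⟨p', q', hq', -, hlt⟩ := ha (max k m)
  set s : ℚ := (p' : ℚ) / (q' : ℚ) with hs
  have hs' : (s : ℝ) = p' / q' := by rw [hs]; push_cast; rfl
  have hnd : (s.num : ℝ) / (s.den : ℝ) = s := by exact_mod_cast s.num_div_den
  have hden : (s.den : ℤ) ≤ q' := by
    have : (s.den : ℤ) ∣ q' := by rw [hs, ← Rat.divInt_eq_div]; exact Rat.den_dvd p' q'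
    exact Int.le_of_dvd (by omega) this
  have hq2 : (2 : ℝ) ≤ q' := by exact_mod_cast hq'
  have hd0 : (0 : ℝ) < s.den := by exact_mod_cast s.den_pos
  have hlt2 : |a - s| < min δ (ρ / 2) := by
    rw [hs']
    refine hlt.trans_le (le_trans ?_ hk.le)
    rw [one_div_pow]
    refine one_div_le_one_div_of_le (by positivity) ?_
    calc (2 : ℝ) ^ k ≤ 2 ^ max k m := pow_le_pow_right₀ (by norm_num) (le_max_left _ _)
      _ ≤ _ := by gcongr
  refine ⟨s.num, s.den, s.den_pos, ?_, ?_, ?_, ?_⟩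
  · by_contra! h
    have h3 := h2 s h.le
    rw [Real.dist_eq] at h3
    linarith [min_le_right δ (ρ / 2)]
  · rw [Int.isCoprime_iff_gcd_eq_one]
    exact s.reduced
  · rw [hnd]; exact hlt2.trans_le (min_le_left _ _)
  · rw [hnd, hs']
    refine hlt.le.trans (one_div_le_one_div_of_le (by positivity) ?_)
    calc (s.den : ℝ) ^ m ≤ (q' : ℝ) ^ m := by
          gcongr; exact_mod_cast hden
      _ ≤ _ := pow_le_pow_right₀ (by linarith) (le_max_right _ _)

/-- A circle diffeomorphism with Liouville rotation number is approximated by conjugates of the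
rotation. -/
lemma exists_conj_near (G : Equiv.Perm ℝ) (hG : IsCircleDiffeoLift G) (a : ℝ)
    (ha : Tendsto (fun n : ℕ => (G ^ n) 0 / (n : ℝ)) atTop (nhds a)) (hL : Liouville a) (r : ℕ)
    {ε : ℝ} (hε : 0 < ε) :
    ∃ H : Equiv.Perm ℝ, IsCircleDiffeoLift H ∧
      ∀ x, JB r ε (fun x => H⁻¹ (H x + a) - G x) x := by
  obtain ⟨B, hB⟩ := exists_orb G hG a ha
  obtain ⟨K, M₀, hK, hM₀, hY⟩ := Orb.exists_JB_conj B (r + 1) (by omega)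
  obtain ⟨C, hC1, hC⟩ := JB_sub_id hG r
  set c : ℝ := r.factorial * K * C ^ r + 1 with hc
  have hc0 : 0 < c := by positivity
  obtain ⟨δ₀, hδ₀, N, hN⟩ := exists_M_lt B a hL.irrational
    (min M₀ (min 1 (ε / c))) (by positivity)
  obtain ⟨p, q, hq, hNq, hcop, h1, h2⟩ := hL.exists_coprime (r + 3) N hδ₀
  obtain ⟨D, rfl, rfl, t, ht, hf⟩ := hB p q hq hcop
  have hM := hN D hNq h1
  simp only [lt_min_iff] at hM
  obtain ⟨m1, m2, m3⟩ := hM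
  rw [lt_div_iff₀ hc0] at m3
  have m0 := D.M_pos
  have hq0 : (0 : ℝ) < D.q := by exact_mod_cast hq
  have hq1 : (1 : ℝ) ≤ D.q := by exact_mod_cast hq
  have hqM : (D.q : ℝ)⁻¹ ≤ D.M := by
    rw [inv_le_iff_one_le_mul₀' hq0]; exact D.one_le_q_mul_M
  have hδ : D.q * |D.q * a - D.p| ≤ D.M ^ (r + 1) := by
    have e : D.q * a - D.p = D.q * (a - D.p / D.q) := by field_simp
    rw [e, abs_mul, Nat.abs_cast]
    calc (D.q : ℝ) * (D.q * |a - D.p / D.q|) ≤ D.q * (D.q * (1 / (D.q : ℝ) ^ (r + 3))) := by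
          gcongr
      _ = (D.q : ℝ)⁻¹ ^ (r + 1) := by rw [inv_pow]; field_simp; ring
      _ ≤ _ := by gcongr
  obtain ⟨h, lh, Y, sY, hYf, hYJ⟩ := hY D m1.le _ hδ
  refine ⟨h, lh, fun x => ?_⟩
  have e : (D.p + (D.q * a - D.p)) / D.q = a := by field_simp; ring
  rw [e] at hYf
  have ht' : |t| ≤ D.M := by
    refine ht.trans (le_trans ?_ (pow_le_of_le_one m0.le m2.le (by omega : r + 1 ≠ 0)))
    nlinarith [abs_nonneg (D.q * a - D.p)]
  have hfx : ∀ i, 1 ≤ i → i ≤ r → |iteratedDeriv i D.f x| ≤ C := fun i hi1 hi2 => by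
    have : ⇑D.f = fun x => G x + t := funext hf
    rw [this, iteratedDeriv_fun_add (hG.sm.nat i).contDiffAt contDiffAt_const,
      iteratedDeriv_const, if_neg (by omega), add_zero]
    exact hC x i hi1 hi2
  have h3 := JB.comp (sY.sub contDiff_id) D.lift.sm hC1 ((hYJ (D.f x)).mono (Nat.le_succ r) le_rfl) hfx
  have h4 := h3.add ((sY.sub contDiff_id).comp D.lift.sm) contDiff_const (JB_const r t x)
  have h5 : (fun x => h⁻¹ (h x + a) - G x) = fun x => Y (D.f x) - D.f x + t := by
    funext z; rw [hYf, hf]; ring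
  rw [h5]
  refine h4.mono le_rfl ?_
  rw [hc] at m3
  nlinarith

lemma tendsto_integral_cos_pow :
    Tendsto (fun N : ℕ => ∫ x in (0 : ℝ)..1, ((1 + Real.cos (2 * Real.pi * x)) / 2) ^ N) atTop
      (nhds 0) := by
  have h := intervalIntegral.tendsto_integral_filter_of_dominated_convergence
    (μ := volume) (a := 0) (b := 1) (l := atTop) (fun _ => (1 : ℝ)) (f := fun _ => (0 : ℝ))
    (F := fun (N : ℕ) x => ((1 + Real.cos (2 * Real.pi * x)) / 2) ^ N)
    (Eventually.of_forall fun N => by fun_prop)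
    (Eventually.of_forall fun N => Eventually.of_forall fun x _ => by
      have h1 := Real.neg_one_le_cos (2 * Real.pi * x)
      have h2 := Real.cos_le_one (2 * Real.pi * x)
      rw [Real.norm_eq_abs, abs_pow, abs_of_nonneg (by linarith)]
      exact pow_le_one₀ (by linarith) (by linarith))
    (by simp) ?_
  · simpa using h
  · have hne : ∀ᵐ x : ℝ, x ≠ 1 := by simp [ae_iff]
    filter_upwards [hne] with x hx hx2
    rw [Set.uIoc_of_le zero_le_one] at hx2
    have h1 := Real.neg_one_le_cos (2 * Real.pi * x)
    have h2 : Real.cos (2 * Real.pi * x) < 1 := by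
      refine lt_of_le_of_ne (Real.cos_le_one _) fun h => ?_
      have h3 := (Real.cos_eq_one_iff_of_lt_of_lt (x := 2 * Real.pi * x)
        (by nlinarith [Real.pi_pos, hx2.1]) (by
          have := lt_of_le_of_ne hx2.2 hx
          nlinarith [Real.pi_pos])).1 h
      exact (mul_pos (mul_pos two_pos Real.pi_pos) hx2.1).ne' h3
    exact tendsto_pow_atTop_nhds_zero_of_lt_one (by linarith) (by linarith)

/-- A circle diffeomorphism which contracts by `1/2` outside a small interval. -/
lemma exists_stretch {κ : ℝ} (hκ : 0 < κ) : ∃ (A : Equiv.Perm ℝ) (u : ℝ → ℝ) (s : ℝ),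
    IsCircleDiffeoLift A ∧ Continuous u ∧ (∀ x, u (x + 1) = u x) ∧ (∀ x, 0 ≤ u x) ∧
    ∫ x in (0 : ℝ)..1, u x ≤ κ ∧ 0 < s ∧
    ∀ x, u x < 1 → deriv A x = 1 / 2 ∧ Real.cos (2 * Real.pi * A x) ≤ -s := by
  obtain ⟨N, hN⟩ := (tendsto_integral_cos_pow.eventually_lt_const (half_pos hκ)).exists
  have hπ := Real.pi_pos
  set c : ℝ := 1 - 1 / (N + 1) with hc
  have hN1 : (0 : ℝ) < 1 / (N + 1) := by positivity
  have hN2 : (1 : ℝ) / (N + 1) ≤ 1 := by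
    rw [div_le_one (by positivity)]; linarith [Nat.cast_nonneg (α := ℝ) N]
  set v : ℝ → ℝ := fun x => Real.cos (2 * Real.pi * x) with hv
  have hvper : ∀ x, v (x + 1) = v x := fun x => by
    simp only [hv]; rw [mul_add, mul_one, Real.cos_add_two_pi]
  have sv : Sm v := Real.contDiff_cos.comp (contDiff_const.mul contDiff_id)
  set w : ℝ → ℝ := fun x => Real.smoothTransition (v x - c) with hw
  have sw : Sm w := Real.smoothTransition.contDiff.comp (sv.sub contDiff_const)
  have w0 : ∀ x, 0 ≤ w x := fun x => Real.smoothTransition.nonneg _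
  have hwper : Function.Periodic w 1 := fun x => by simp only [hw]; rw [hvper]
  have hwint : ∀ a b, IntervalIntegrable w volume a b := fun a b =>
    sw.continuous.intervalIntegrable _ _
  set J := ∫ x in (0 : ℝ)..1, w x with hJ
  have J0 : 0 < J := by
    refine intervalIntegral.integral_pos zero_lt_one sw.continuous.continuousOn (fun x _ => w0 x)
      ⟨0, by simp, Real.smoothTransition.pos_of_pos ?_⟩
    simp only [hv, mul_zero, Real.cos_zero]; linarith
  set f : ℝ → ℝ := fun x => x / 2 + (1 / 2) * (1 / 2 + J⁻¹ * ∫ t in (1 / 2 : ℝ)..x, w t) with hf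
  have hfd : ∀ x, HasDerivAt f (1 / 2 + (1 / 2) * (J⁻¹ * w x)) x := fun x => by
    have h1 := intervalIntegral.integral_hasDerivAt_right (hwint (1 / 2) x)
      (sw.continuous.stronglyMeasurableAtFilter _ _) sw.continuous.continuousAt
    exact ((hasDerivAt_id' x).div_const 2).add (((h1.const_mul J⁻¹).const_add (1 / 2)).const_mul _)
  have hfd' : deriv f = fun x => 1 / 2 + (1 / 2) * (J⁻¹ * w x) := funext fun x => (hfd x).deriv
  have sf : Sm f := by
    rw [Sm, contDiff_infty_iff_deriv, hfd']
    exact ⟨fun x => (hfd x).differentiableAt,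
      contDiff_const.add (contDiff_const.mul (contDiff_const.mul sw))⟩
  have lf : IsCircleDiffeoLift f := by
    refine ⟨sf, fun x => ?_, fun x => ?_⟩
    · have h1 := intervalIntegral.integral_add_adjacent_intervals (hwint (1 / 2) x) (hwint x (x + 1))
      rw [hwper.intervalIntegral_add_eq x 0, zero_add, ← hJ] at h1
      simp only [hf]
      rw [← h1]
      field_simp
      ring
    · rw [hfd']
      have := w0 x
      positivity
  refine ⟨lf.toPerm, fun x => 2 * ((1 + v x) / 2) ^ N, Real.sqrt ((1 - c) / 2), by simpa using lf,
    by have := sv.continuous; fun_prop, fun x => by simp only [hvper], fun x => ?_, ?_,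
    Real.sqrt_pos.2 (by linarith), fun x hx => ?_⟩
  · have := Real.neg_one_le_cos (2 * Real.pi * x)
    have : 0 ≤ (1 + v x) / 2 := by simp only [hv]; linarith
    positivity
  · rw [intervalIntegral.integral_const_mul]; linarith
  · have hvc : v x ≤ c := by
      by_contra! h
      have h1 : (1 + (N : ℝ) * (-(1 / (2 * (N + 1))))) ≤ (1 + -(1 / (2 * ((N : ℝ) + 1)))) ^ N := by
        refine one_add_mul_le_pow ?_ N
        have : (1 : ℝ) / (2 * (N + 1)) = 1 / (N + 1) / 2 := by field_simp
        rw [this]; linarith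
      have h2 : (1 + -(1 / (2 * ((N : ℝ) + 1)))) ^ N ≤ ((1 + v x) / 2) ^ N := by
        have : (1 : ℝ) / (2 * (N + 1)) = 1 / (N + 1) / 2 := by field_simp
        refine pow_le_pow_left₀ (by rw [this]; linarith) (by rw [this]; linarith) N
      have h3 : (N : ℝ) * (1 / (2 * (N + 1))) ≤ 1 / 2 := by
        rw [mul_one_div, div_le_div_iff₀ (by positivity) (by positivity)]; linarith
      linarith
    simp only [IsCircleDiffeoLift.coe_toPerm]
    refine ⟨?_, ?_⟩
    · rw [hfd']
      simp only [hw]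
      rw [Real.smoothTransition.zero_of_nonpos (by linarith)]
      ring
    · set y := Int.fract x with hy
      have hxy : x = y + ⌊x⌋ := (Int.fract_add_floor x).symm
      have hvy : v y = v x := by
        have := Function.Periodic.int_mul (f := v) hvper ⌊x⌋ y
        rw [mul_one] at this
        rw [← this, ← hxy]
      have hfy : Real.cos (2 * Real.pi * f x) = Real.cos (2 * Real.pi * f y) := by
        rw [hxy, lf.add_int, mul_add, mul_comm (2 * Real.pi) (_ : ℝ), mul_comm (2 * Real.pi) (_ : ℝ),
          Real.cos_add_int_mul_two_pi]
      have hy0 : 0 ≤ y := Int.fract_nonneg x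
      have hy1 : y ≤ 1 := (Int.fract_lt_one x).le
      have hz : ∀ z, v z = -Real.cos (2 * Real.pi * |z - 1 / 2|) := fun z => by
        have : 2 * Real.pi * |z - 1 / 2| = |2 * Real.pi * z - Real.pi| := by
          rw [← abs_of_pos (by positivity : 0 < 2 * Real.pi), ← abs_mul,
            abs_of_pos (by positivity : 0 < 2 * Real.pi)]
          ring_nf
        rw [this, Real.cos_abs, Real.cos_sub_pi, neg_neg]
      have hint : ∫ t in (1 / 2 : ℝ)..y, w t = 0 := by
        rw [← intervalIntegral.integral_zero (a := 1 / 2) (b := y)]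
        refine intervalIntegral.integral_congr fun z hz2 => ?_
        refine Real.smoothTransition.zero_of_nonpos ?_
        have h1 : |z - 1 / 2| ≤ |y - 1 / 2| := by
          have := Set.abs_sub_left_of_mem_uIcc hz2
          exact this
        have h2 : |y - 1 / 2| ≤ 1 / 2 := abs_le.2 ⟨by linarith, by linarith⟩
        have h3 : v z ≤ v y := by
          rw [hz, hz, neg_le_neg_iff]
          refine Real.cos_le_cos_of_nonneg_of_le_pi (by positivity) (by nlinarith) (by gcongr)
        linarith
      have hfv : f y = y / 2 + 1 / 4 := by simp only [hf]; rw [hint]; ring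
      rw [hfy, hfv, show 2 * Real.pi * (y / 2 + 1 / 4) = Real.pi * y + Real.pi / 2 by ring,
        Real.cos_add_pi_div_two, neg_le_neg_iff]
      have hsin : 0 ≤ Real.sin (Real.pi * y) :=
        Real.sin_nonneg_of_nonneg_of_le_pi (by positivity) (by nlinarith)
      refine Real.sqrt_le_iff.2 ⟨hsin, ?_⟩
      have : v y = 1 - 2 * Real.sin (Real.pi * y) ^ 2 := by
        simp only [hv]; rw [mul_assoc, Real.cos_two_mul, Real.cos_sq']; ring
      linarith

/-- The lift `x ↦ A (q x) / q` of the `q`-fold cover of `A`. -/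
def coverLift (A : Equiv.Perm ℝ) (q : ℝ) (hq : q ≠ 0) : Equiv.Perm ℝ :=
  (Equiv.mulLeft₀ q hq).trans (A.trans (Equiv.mulLeft₀ q hq).symm)

lemma coverLift_apply (A : Equiv.Perm ℝ) {q : ℝ} (hq : q ≠ 0) (x : ℝ) :
    coverLift A q hq x = A (q * x) / q := by
  simp [coverLift, div_eq_inv_mul]

lemma coverLift_inv_apply (A : Equiv.Perm ℝ) {q : ℝ} (hq : q ≠ 0) (x : ℝ) :
    (coverLift A q hq)⁻¹ x = A⁻¹ (q * x) / q := by
  rw [Equiv.Perm.inv_eq_iff_eq, coverLift_apply, mul_div_cancel₀ _ hq]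
  simp [hq]

lemma IsCircleDiffeoLift.hasDerivAt_coverLift {A : Equiv.Perm ℝ} (hA : IsCircleDiffeoLift A) {q : ℝ}
    (hq : q ≠ 0) (x : ℝ) : HasDerivAt (coverLift A q hq) (deriv A (q * x)) x := by
  have e : ⇑(coverLift A q hq) = fun x => A (0 + q * x) / q := by
    funext x; rw [coverLift_apply, zero_add]
  have h := (hA.sm.hasDerivAt_comp_affine 0 q x).div_const q
  rwa [← e, zero_add, mul_div_cancel_left₀ _ hq] at h

lemma IsCircleDiffeoLift.coverLift {A : Equiv.Perm ℝ} (hA : IsCircleDiffeoLift A) {q : ℕ}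
    (hq : (q : ℝ) ≠ 0) : IsCircleDiffeoLift (coverLift A q hq) := by
  have e : ⇑(_root_.coverLift A q hq) = fun x => A (0 + q * x) / q := by
    funext x; rw [coverLift_apply, zero_add]
  refine ⟨?_, fun x => ?_, fun x => ?_⟩
  · rw [e]; exact (hA.sm.comp_affine 0 q).div_const _
  · rw [coverLift_apply, coverLift_apply, mul_add, mul_one]
    have := hA.add_int (q * x) q
    rw [Int.cast_natCast] at this
    rw [this, add_div, div_self hq]
  · rw [(hA.hasDerivAt_coverLift hq x).deriv]
    exact hA.deriv_pos _

lemma exists_JB_deriv {H : ℝ → ℝ} (hH : IsCircleDiffeoLift H) (r : ℕ) :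
    ∃ C, 0 ≤ C ∧ ∀ x, JB r C (deriv H) x :=
  hH.sm.deriv.exists_JB_of_periodic hH.deriv_periodic r

/-- Conjugating a perturbation of a rotation by a fixed map. -/
lemma exists_conj_close {H : Equiv.Perm ℝ} (hH : IsCircleDiffeoLift H) (a : ℝ) (r : ℕ) {ε : ℝ}
    (hε : 0 < ε) : ∃ η, 0 < η ∧ ∀ e : ℝ → ℝ, Sm e → (∀ x, JB r η e x) →
      ∀ x, JB r ε (fun x => H⁻¹ (H x + a + e (H x)) - H⁻¹ (H x + a)) x := by
  obtain ⟨C1, hC1, h1⟩ := exists_JB_deriv hH.inv r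
  obtain ⟨C2, hC2, h2⟩ := JB_sub_id hH r
  obtain ⟨K, hK, h3⟩ := JB_comp_sub r (max C1 C2)
  set c : ℝ := r.factorial * C2 ^ r with hc
  have c0 : 0 < c := by positivity
  refine ⟨min (1 / c) (ε / (K * c + 1)), by positivity, fun e he hJ x => ?_⟩
  have hη1 : c * min (1 / c) (ε / (K * c + 1)) ≤ 1 := by
    calc _ ≤ c * (1 / c) := by gcongr; exact min_le_left _ _
      _ = 1 := by field_simp
  have hη2 : K * (c * min (1 / c) (ε / (K * c + 1))) ≤ ε := by
    calc _ ≤ K * (c * (ε / (K * c + 1))) := by gcongr; exact min_le_right _ _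
      _ = ε * (K * c / (K * c + 1)) := by ring
      _ ≤ ε * 1 := by
        gcongr
        rw [div_le_one (by positivity)]; linarith
      _ = ε := mul_one ε
  have he2 := JB.comp he hH.sm hC2 (hJ (H x)) (h2 x)
  refine (h3 (⇑H⁻¹) (fun x => H x + a) (fun x => e (H x)) x _ hH.inv.sm (hH.sm.add contDiff_const)
    (he.comp hH.sm) ?_ (fun s _ => (h1 _).mono le_rfl (le_max_left _ _)) (fun i hi1 hi2 => ?_)
    he2).mono le_rfl ?_
  · rw [hc] at hη1; linarith
  · rw [iteratedDeriv_fun_add (hH.sm.nat i).contDiffAt contDiffAt_const,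
      iteratedDeriv_const, if_neg (by omega), add_zero]
    exact (h2 x i hi1 hi2).trans (le_max_right _ _)
  · rw [hc] at hη2; linarith

/-- Conjugating a rotation close to a rational one by a periodic map. -/
lemma exists_cover_close {A : Equiv.Perm ℝ} (hA : IsCircleDiffeoLift A) (r : ℕ) :
    ∃ K, 0 ≤ K ∧ ∀ (a : ℝ) (p : ℤ) (q : ℕ) (hq : (q : ℝ) ≠ 0), |q * a - p| ≤ 1 →
      ∀ x, JB r (K * (q ^ r * |q * a - p|))
        (fun x => (coverLift A q hq)⁻¹ (coverLift A q hq x + a) - (x + a)) x := by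
  obtain ⟨C1, hC1, h1⟩ := exists_JB_deriv hA.inv r
  obtain ⟨C2, hC2, h2⟩ := JB_sub_id hA r
  obtain ⟨K, hK, h3⟩ := JB_comp_sub r (max C1 C2)
  refine ⟨K + 1, by positivity, fun a p q hq hδ x => ?_⟩
  set δ := q * a - p with hδd
  have hq1 : (1 : ℝ) ≤ q := by
    have : q ≠ 0 := fun h => hq (by simp [h])
    exact_mod_cast Nat.one_le_iff_ne_zero.2 this
  set w : ℝ → ℝ := fun x => A⁻¹ (A x + δ) - A⁻¹ (A x) - δ with hw
  have sw : Sm w :=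
    ((hA.inv.sm.comp (hA.sm.add contDiff_const)).sub (hA.inv.sm.comp hA.sm)).sub contDiff_const
  have hwJ : ∀ x, JB r ((K + 1) * |δ|) w x := fun x => by
    have h4 := h3 (⇑A⁻¹) A (fun _ => δ) x |δ| hA.inv.sm hA.sm contDiff_const hδ
      (fun s _ => (h1 _).mono le_rfl (le_max_left _ _))
      (fun i hi1 hi2 => (h2 x i hi1 hi2).trans (le_max_right _ _)) (JB_const r δ x)
    refine (h4.sub ((hA.inv.sm.comp (hA.sm.add contDiff_const)).sub (hA.inv.sm.comp hA.sm))
      contDiff_const (JB_const r δ x)).mono le_rfl (by linarith)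
  have e : (fun x => (coverLift A q hq)⁻¹ (coverLift A q hq x + a) - (x + a)) =
      fun x => (q : ℝ)⁻¹ * w (0 + q * x) := by
    funext x
    have h5 : (q : ℝ) * (A (q * x) / q + a) = (A (q * x) + δ) + p := by
      rw [hδd]; field_simp; ring
    rw [coverLift_inv_apply, coverLift_apply, h5, hA.inv.add_int]
    have h6 : A⁻¹ (A (q * x)) = q * x := by simp
    simp only [hw, zero_add, h6]
    rw [hδd]
    field_simp
    ring
  rw [e]
  intro i hi
  rw [iteratedDeriv_const_mul_field, iteratedDeriv_comp_affine sw, abs_mul, abs_mul, abs_inv,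
    Nat.abs_cast, abs_pow, Nat.abs_cast]
  calc (q : ℝ)⁻¹ * (q ^ i * |iteratedDeriv i w (0 + q * x)|)
      ≤ 1 * (q ^ r * ((K + 1) * |δ|)) := by
        gcongr
        · exact inv_le_one_of_one_le₀ hq1
        · exact hwJ _ i hi
    _ = _ := by ring

lemma IsCircleDiffeoLift.exists_lipschitz {F : ℝ → ℝ} (hF : IsCircleDiffeoLift F) :
    ∃ L, 0 < L ∧ ∀ x y, |F x - F y| ≤ L * |x - y| := by
  obtain ⟨L, L0, hL⟩ := hF.exists_deriv_le
  refine ⟨L, L0, fun x y => ?_⟩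
  have := convex_univ.norm_image_sub_le_of_norm_hasDerivWithin_le
    (f := F) (C := L) (fun x _ => (hF.sm.hasDerivAt x).hasDerivWithinAt)
    (fun x _ => by rw [Real.norm_eq_abs, abs_of_pos (hF.deriv_pos x)]; exact hL x)
    (Set.mem_univ y) (Set.mem_univ x)
  simpa using this

lemma exists_iterate_close {F : ℝ → ℝ} (hF : IsCircleDiffeoLift F) (i : ℕ) {ρ : ℝ} (hρ : 0 < ρ) :
    ∃ η, 0 < η ∧ ∀ f : ℝ → ℝ, (∀ x, |f x - F x| ≤ η) → ∀ x, |f^[i] x - F^[i] x| ≤ ρ := by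
  obtain ⟨L, hL, h⟩ := hF.exists_lipschitz
  induction i generalizing ρ with
  | zero => exact ⟨1, one_pos, fun f _ x => by simpa using hρ.le⟩
  | succ i ih =>
    obtain ⟨η, hη, h1⟩ := ih (ρ := ρ / (2 * L)) (by positivity)
    refine ⟨min η (ρ / 2), by positivity, fun f hf x => ?_⟩
    have h2 := h1 f (fun x => (hf x).trans (min_le_left _ _)) x
    rw [Function.iterate_succ_apply', Function.iterate_succ_apply']
    calc _ ≤ |f (f^[i] x) - F (f^[i] x)| + |F (f^[i] x) - F (F^[i] x)| := abs_sub_le _ _ _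
      _ ≤ ρ / 2 + L * (ρ / (2 * L)) := by
        refine add_le_add ((hf _).trans (min_le_right _ _)) ((h _ _).trans (by gcongr))
      _ = ρ := by field_simp; norm_num

lemma exists_cos_lt {b : ℝ} (hb : Irrational b) {t : ℝ} (ht : 0 < t) :
    ∃ i : ℕ, Real.cos (2 * Real.pi * (i * b)) < -1 + t := by
  have hd : Dense (AddSubgroup.closure {b, 1} : Set ℝ) := by
    rw [dense_addSubgroupClosure_pair_iff]; simpa using hb
  have ho : IsOpen {y : ℝ | Real.cos (2 * Real.pi * y) < -1 + t} :=
    isOpen_lt (by fun_prop) continuous_const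
  obtain ⟨y, hy1, hy2⟩ := hd.exists_mem_open ho ⟨1 / 2, by
    rw [Set.mem_ofPred_eq, show 2 * Real.pi * (1 / 2) = Real.pi by ring, Real.cos_pi]; linarith⟩
  obtain ⟨m, n, rfl⟩ := AddSubgroup.mem_closure_pair.1 hy1
  refine ⟨m.natAbs, ?_⟩
  simp only [Set.mem_ofPred_eq, zsmul_eq_mul, mul_one] at hy2
  rw [mul_add, mul_comm (2 * Real.pi) (n : ℝ), Real.cos_add_int_mul_two_pi] at hy2
  rw [Nat.cast_natAbs, Int.cast_abs]
  rcases abs_choice (m : ℝ) with h | h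
  · rwa [h]
  · rwa [h, neg_mul, mul_neg, Real.cos_neg]

lemma volume_cover_le {H : ℝ → ℝ} (hH : IsCircleDiffeoLift H) {m : ℝ} (hm : 0 < m)
    (hmH : ∀ x, m ≤ deriv H x) {u : ℝ → ℝ} (hu : Continuous u) (hper : ∀ x, u (x + 1) = u x)
    (hu0 : ∀ x, 0 ≤ u x) {q : ℕ} (hq : (q : ℝ) ≠ 0) :
    volume ({x | 1 ≤ u (q * H x)} ∩ Set.Ioc 0 1) ≤
      ENNReal.ofReal (m⁻¹ * ∫ x in (0 : ℝ)..1, u x) := by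
  have hcH := hH.sm.continuous
  have hcd : Continuous (deriv H) := hH.sm.deriv.continuous
  have hc : Continuous fun x => u (q * H x) := by fun_prop
  have hint : ∫ x in (0 : ℝ)..1, u (q * H x) ≤ m⁻¹ * ∫ x in (0 : ℝ)..1, u x := by
    have h1 : ∫ x in (0 : ℝ)..1, u (q * H x) * deriv H x = ∫ x in (0 : ℝ)..1, u x := by
      have h2 := intervalIntegral.integral_comp_mul_deriv (a := 0) (b := 1)
        (f := H) (f' := deriv H) (g := fun y => u (q * y)) (fun x _ => hH.sm.hasDerivAt x)
        hcd.continuousOn (by fun_prop)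
      have h3 : H 1 = H 0 + 1 := by simpa using hH.add_one 0
      have hp : Function.Periodic u 1 := hper
      have h4 := hp.intervalIntegral_add_zsmul_eq q (q * H 0) fun a b => hu.intervalIntegrable a b
      simp only [Function.comp_def] at h2
      rw [h2, intervalIntegral.integral_comp_mul_left _ hq, h3, mul_add, mul_one]
      simp only [natCast_zsmul, nsmul_eq_mul, mul_one] at h4
      rw [h4, smul_eq_mul, inv_mul_cancel_left₀ hq, hp.intervalIntegral_add_eq (q * H 0) 0, zero_add]
    rw [← h1, ← intervalIntegral.integral_const_mul]
    refine intervalIntegral.integral_mono_on zero_le_one (hc.intervalIntegrable _ _)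
      ((continuous_const.mul (hc.mul hcd)).intervalIntegrable _ _) fun x _ => ?_
    have := hu0 (q * H x)
    calc u (q * H x) = m⁻¹ * (u (q * H x) * m) := by field_simp
      _ ≤ m⁻¹ * (u (q * H x) * deriv H x) := by gcongr; exact hmH x
  rw [intervalIntegral.integral_of_le zero_le_one] at hint
  have hmk := mul_meas_ge_le_integral_of_nonneg (μ := volume.restrict (Set.Ioc (0 : ℝ) 1))
    (f := fun x => u (q * H x)) (Eventually.of_forall fun x => hu0 _)
    ((hc.integrableOn_Icc (a := 0) (b := 1)).mono_set Set.Ioc_subset_Icc_self) 1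
  rw [one_mul] at hmk
  have hms : MeasurableSet {x | 1 ≤ u (q * H x)} := (isClosed_le continuous_const hc).measurableSet
  rw [← Measure.restrict_apply hms]
  rw [← ENNReal.ofReal_toReal (measure_ne_top (volume.restrict (Set.Ioc (0 : ℝ) 1)) _)]
  exact ENNReal.ofReal_le_ofReal (hmk.trans hint)

/-- The rotation by `a` conjugated by `H`. -/
def conjRot (H : Equiv.Perm ℝ) (a : ℝ) : Equiv.Perm ℝ := H⁻¹ * Equiv.addRight a * H

lemma conjRot_apply (H : Equiv.Perm ℝ) (a x : ℝ) : conjRot H a x = H⁻¹ (H x + a) := rfl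

lemma apply_conjRot (H : Equiv.Perm ℝ) (a x : ℝ) : H (conjRot H a x) = H x + a := by
  simp [conjRot_apply]

lemma IsCircleDiffeoLift.conjRot {H : Equiv.Perm ℝ} (hH : IsCircleDiffeoLift H) (a : ℝ) :
    IsCircleDiffeoLift (conjRot H a) :=
  hH.inv.comp (hH.add_const a)

lemma apply_conjRot_iterate (H : Equiv.Perm ℝ) (a : ℝ) (i : ℕ) (x : ℝ) :
    H ((conjRot H a)^[i] x) = H x + i * a := by
  induction i with
  | zero => simp
  | succ i ih => rw [Function.iterate_succ_apply', apply_conjRot, ih]; push_cast; ring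

lemma cos_add_gt {s α β : ℝ} (hs : 0 < s) (hα : Real.cos α ≤ -s)
    (hβ : Real.cos β < -1 + min (1 / 2) (s ^ 2 / 8)) : -(s / 2) < Real.cos (α + β) := by
  have h1 := min_le_left (1 / 2) (s ^ 2 / 8)
  have h2 := min_le_right (1 / 2) (s ^ 2 / 8)
  have h3 := Real.sin_sq_add_cos_sq β
  have h4 : |Real.sin β| ≤ s / 2 := abs_le_of_sq_le_sq (by nlinarith) (by positivity)
  have h5 : |Real.sin α * Real.sin β| ≤ s / 2 := by
    rw [abs_mul]
    exact (mul_le_of_le_one_left (abs_nonneg _) (Real.abs_sin_le_one α)).trans h4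
  rw [Real.cos_add]
  nlinarith [(abs_le.1 h5).2]

lemma exists_step {H : Equiv.Perm ℝ} (hH : IsCircleDiffeoLift H) {a : ℝ} (ha : Liouville a) (r : ℕ)
    {ε κ : ℝ} (hε : 0 < ε) (hκ : 0 < κ) : ∃ H' : Equiv.Perm ℝ, IsCircleDiffeoLift H' ∧
      (∀ x, JB r ε (fun x => conjRot H' a x - conjRot H a x) x) ∧
      ∃ E : Set ℝ, MeasurableSet E ∧ (∀ x, x + 1 ∈ E ↔ x ∈ E) ∧
        volume (E ∩ Set.Ioc 0 1) ≤ ENNReal.ofReal κ ∧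
        (∀ x ∉ E, deriv H' x = deriv H x / 2) ∧
        ∃ i η, 0 < η ∧ ∀ f : ℝ → ℝ, (∀ x, |f x - conjRot H' a x| ≤ η) →
          ∀ x, x ∈ E ∨ f^[i] x ∈ E := by
  obtain ⟨m, hm, hmH⟩ := hH.exists_le_deriv
  obtain ⟨η₀, hη₀, hcl⟩ := exists_conj_close hH a r hε
  obtain ⟨A, u, s, hA, hu, hper, hu0, hint, hs, hAu⟩ := exists_stretch (mul_pos hm hκ)
  obtain ⟨K, hK, hcov⟩ := exists_cover_close hA r
  obtain ⟨p, q, hq, hNq, -, -, hap⟩ := ha.exists_coprime (r + 2) ⌈K / η₀⌉₊ one_pos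
  have hq0 : (0 : ℝ) < q := by exact_mod_cast hq
  have hq1 : (1 : ℝ) ≤ q := by exact_mod_cast hq
  have hKq : K ≤ q * η₀ := by
    rw [← div_le_iff₀ hη₀]
    exact (Nat.le_ceil _).trans (by exact_mod_cast hNq)
  have hδ : (q : ℝ) ^ r * |q * a - p| ≤ 1 / q := by
    have e : q * a - p = q * (a - p / q) := by field_simp
    rw [e, abs_mul, Nat.abs_cast]
    calc (q : ℝ) ^ r * (q * |a - p / q|) ≤ q ^ r * (q * (1 / (q : ℝ) ^ (r + 2))) := by gcongr
      _ = 1 / q := by field_simp; ring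
  have hδ1 : |q * a - p| ≤ 1 := by
    have h1 : 1 / (q : ℝ) ≤ 1 := by rw [div_le_one hq0]; exact hq1
    have h2 : |q * a - p| ≤ (q : ℝ) ^ r * |q * a - p| :=
      le_mul_of_one_le_left (abs_nonneg _) (one_le_pow₀ hq1)
    linarith
  have lC : IsCircleDiffeoLift (coverLift A q hq0.ne') := hA.coverLift hq0.ne'
  set Cv := coverLift A q hq0.ne' with hCv
  have lH' : IsCircleDiffeoLift ⇑(Cv * H) := lC.comp hH
  have hder : ∀ x, deriv ⇑(Cv * H) x = deriv A (q * H x) * deriv H x := fun x =>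
    ((hA.hasDerivAt_coverLift hq0.ne' (H x)).comp x (hH.sm.hasDerivAt x)).deriv
  have hqH : ∀ x, q * (Cv * H) x = A (q * H x) := fun x => by
    rw [Equiv.Perm.mul_apply, hCv, coverLift_apply, mul_div_cancel₀ _ hq0.ne']
  refine ⟨Cv * H, lH', fun x => ?_, {x | 1 ≤ u (q * H x)}, ?_, fun x => ?_, ?_, fun x hx => ?_, ?_⟩
  · have se : Sm fun y => Cv⁻¹ (Cv y + a) - (y + a) :=
      (lC.inv.sm.comp (lC.sm.add contDiff_const)).sub (contDiff_id.add contDiff_const)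
    have h1 := hcl _ se (fun x => (hcov a p q hq0.ne' hδ1 x).mono le_rfl (by
      calc K * (q ^ r * |q * a - p|) ≤ K * (1 / q) := by gcongr
        _ ≤ η₀ := by rw [mul_one_div, div_le_iff₀ hq0, mul_comm]; exact hKq)) x
    simp only [add_sub_cancel] at h1
    exact h1
  · have := hH.sm.continuous
    exact (isClosed_le continuous_const (by fun_prop)).measurableSet
  · rw [Set.mem_ofPred_eq, Set.mem_ofPred_eq, hH.add_one, mul_add, mul_one]
    have hp : Function.Periodic u 1 := hper
    have := hp.nat_mul q (q * H x)
    rw [mul_one] at this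
    rw [this]
  · refine (volume_cover_le hH hm hmH hu hper hu0 hq0.ne').trans (ENNReal.ofReal_le_ofReal ?_)
    rw [inv_mul_le_iff₀ hm]; exact hint
  · rw [hder, (hAu _ (not_le.1 hx)).1]; ring
  · have hirr : Irrational (q * a) := ha.irrational.natCast_mul hq.ne'
    obtain ⟨i, hi⟩ := exists_cos_lt hirr (t := min (1 / 2) (s ^ 2 / 8)) (by positivity)
    obtain ⟨L, hL, hLip⟩ := lH'.exists_lipschitz
    have hπ := Real.pi_pos
    obtain ⟨η, hη, hit⟩ := exists_iterate_close (lH'.conjRot a) i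
      (ρ := s / (4 * Real.pi * q * L)) (by positivity)
    refine ⟨i, η, hη, fun f hf x => ?_⟩
    by_contra! hcon
    have h1 := (hAu _ (not_le.1 hcon.1)).2
    have h2 := (hAu _ (not_le.1 hcon.2)).2
    rw [← hqH] at h1 h2
    have h3 := (hLip _ _).trans (mul_le_mul_of_nonneg_left (hit f hf x) hL.le)
    rw [apply_conjRot_iterate] at h3
    have h4 := cos_add_gt hs h1 hi
    have h5 : |2 * Real.pi * (q * (Cv * H) (f^[i] x)) -
        (2 * Real.pi * (q * (Cv * H) x) + 2 * Real.pi * (i * (q * a)))| ≤ s / 2 := by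
      have e : 2 * Real.pi * (q * (Cv * H) (f^[i] x)) -
        (2 * Real.pi * (q * (Cv * H) x) + 2 * Real.pi * (i * (q * a))) =
        (2 * Real.pi * q) * ((Cv * H) (f^[i] x) - ((Cv * H) x + i * a)) := by ring
      rw [e, abs_mul, abs_of_pos (by positivity : 0 < 2 * Real.pi * q)]
      calc _ ≤ 2 * Real.pi * q * (L * (s / (4 * Real.pi * q * L))) := by gcongr
        _ = s / 2 := by field_simp; norm_num
    have h6 := (abs_le.1 ((Real.abs_cos_sub_cos_le _ _).trans h5)).1
    linarith

lemma sm_tsum {D : ℕ → ℝ → ℝ} {r : ℕ} {τ : ℕ → ℝ} (hD : ∀ n, Sm (D n))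
    (hJ : ∀ n x, JB (r + n) (τ n) (D n) x) (hτ : Summable τ) :
    (Sm fun x => ∑' n, D n x) ∧ ∀ x, JB r (∑' n, τ n) (fun x => ∑' n, D n x) x := by
  refine ⟨?_, fun x k hk => ?_⟩
  · refine contDiff_tsum_of_eventually (v := fun _ => τ) hD (fun k _ => hτ) fun k _ => ?_
    rw [Nat.cofinite_eq_atTop]
    filter_upwards [eventually_ge_atTop k] with n hn x
    rw [norm_iteratedFDeriv_eq_norm_iteratedDeriv, Real.norm_eq_abs]
    exact hJ n x k (by omega)
  · have h1 : ∀ (j n : ℕ) (x : ℝ), (j : ℕ∞) ≤ (r : ℕ∞) → ‖iteratedFDeriv ℝ j (D n) x‖ ≤ τ n :=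
      fun j n x hj => by
        rw [norm_iteratedFDeriv_eq_norm_iteratedDeriv, Real.norm_eq_abs]
        have : j ≤ r := by exact_mod_cast hj
        exact hJ n x j (by omega)
    rw [← Real.norm_eq_abs, ← norm_iteratedFDeriv_eq_norm_iteratedDeriv,
      iteratedFDeriv_tsum (N := (r : ℕ∞)) (v := fun _ => τ) (fun n => (hD n).nat r)
        (fun j _ => hτ) (fun j n x hj => h1 j n x (by exact_mod_cast hj)) (by exact_mod_cast hk)]
    have hb : ∀ n, ‖iteratedFDeriv ℝ k (D n) x‖ ≤ τ n := fun n => h1 k n x (by exact_mod_cast hk)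
    exact tsum_of_norm_bounded hτ.hasSum hb

lemma exists_seq_of_step {S : Type*} (R : ℕ → S → S → Prop) (h : ∀ n s, ∃ s', R n s s') (s₀ : S) :
    ∃ u : ℕ → S, u 0 = s₀ ∧ ∀ n, R n (u n) (u (n + 1)) := by
  choose g hg using h
  exact ⟨fun n => Nat.rec s₀ (fun n s => g n s) n, rfl, fun n => hg n _⟩

lemma exists_modulus {φ : ℝ → ℝ} (hφ : Continuous φ) (hper : ∀ x, φ (x + 1) = φ x) {ε : ℝ}
    (hε : 0 < ε) : ∃ ω, 0 < ω ∧ ∀ x y, |x - y| ≤ ω → |φ x - φ y| ≤ ε := by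
  have huc : UniformContinuous φ := by
    have h1 : Continuous (Function.Periodic.lift (c := (1 : ℝ)) hper) := continuous_quot_lift _ hφ
    have h2 : UniformContinuous ((↑) : ℝ → AddCircle (1 : ℝ)) :=
      uniformContinuous_addMonoidHom_of_continuous (f := QuotientAddGroup.mk' _)
        (AddCircle.continuous_mk' 1)
    exact (CompactSpace.uniformContinuous_of_continuous h1).comp h2
  obtain ⟨ω, hω, h⟩ := Metric.uniformContinuous_iff.1 huc ε hε
  refine ⟨ω / 2, by positivity, fun x y hxy => (h ?_).le⟩
  rw [Real.dist_eq]; linarith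

/-- The property of consecutive steps of the approximation by conjugation. -/
def Step (a : ℝ) (r n : ℕ) (H H' : Equiv.Perm ℝ) (τ τ' : ℝ) : Prop :=
  (∀ x, JB (r + n) τ (fun x => conjRot H' a x - conjRot H a x) x) ∧ τ' ≤ τ / 2 ∧
    (∀ x y, |x - y| ≤ 2 * τ' →
      |2 ^ (n + 1) * deriv H' x - 2 ^ (n + 1) * deriv H' y| ≤ (1 / 2) ^ n) ∧
    ∃ E : Set ℝ, MeasurableSet E ∧ (∀ x, x + 1 ∈ E ↔ x ∈ E) ∧
      volume (E ∩ Set.Ioc 0 1) ≤ ENNReal.ofReal ((1 / 2) ^ n) ∧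
      (∀ x ∉ E, deriv H' x = deriv H x / 2) ∧
      ∃ i : ℕ, ∀ f : ℝ → ℝ, (∀ x, |f x - conjRot H' a x| ≤ 2 * τ') → ∀ x, x ∈ E ∨ f^[i] x ∈ E

lemma exists_Step {a : ℝ} (ha : Liouville a) (r n : ℕ) {H : Equiv.Perm ℝ}
    (hH : IsCircleDiffeoLift H) {τ : ℝ} (hτ : 0 < τ) : ∃ (H' : Equiv.Perm ℝ) (τ' : ℝ),
    IsCircleDiffeoLift H' ∧ 0 < τ' ∧ Step a r n H H' τ τ' := by
  obtain ⟨H', lH', hJ, E, hE, hper, hvol, hder, i, η, hη, hcov⟩ :=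
    exists_step hH ha (r + n) hτ (pow_pos (by norm_num : (0 : ℝ) < 1 / 2) n)
  obtain ⟨ω, hω, hmod⟩ := exists_modulus (φ := fun x => 2 ^ (n + 1) * deriv H' x)
    (continuous_const.mul lH'.sm.deriv.continuous) (fun x => by rw [lH'.deriv_periodic])
    (pow_pos (by norm_num : (0 : ℝ) < 1 / 2) n)
  refine ⟨H', min (τ / 2) (min (ω / 2) (η / 2)), lH', by positivity, hJ, min_le_left _ _,
    fun x y hxy => hmod x y ?_, E, hE, hper, hvol, hder, i, fun f hf => hcov f fun x => ?_⟩
  · have := (min_le_right (τ / 2) (min (ω / 2) (η / 2))).trans (min_le_left _ _)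
    linarith
  · have := (min_le_right (τ / 2) (min (ω / 2) (η / 2))).trans (min_le_right _ _)
    linarith [hf x]

/-- The limit of the approximation by conjugation. -/
lemma exists_limit {a : ℝ} (ha : Liouville a) (r : ℕ) {H₀ : Equiv.Perm ℝ}
    (h₀ : IsCircleDiffeoLift H₀) {ε : ℝ} (hε : 0 < ε) :
    ∃ (f : ℝ → ℝ) (H : ℕ → Equiv.Perm ℝ) (τ : ℕ → ℝ), IsCircleDiffeoLift f ∧
      (∀ x, JB r ε (fun x => f x - conjRot H₀ a x) x) ∧ (∀ n, IsCircleDiffeoLift (H n)) ∧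
      Tendsto τ atTop (nhds 0) ∧ (∀ n, Step a (r + 1) n (H n) (H (n + 1)) (τ n) (τ (n + 1))) ∧
      ∀ n x, |f x - conjRot (H n) a x| ≤ 2 * τ n ∧
        |deriv f x - deriv (conjRot (H n) a) x| ≤ 2 * τ n := by
  obtain ⟨c, hc, hcF⟩ := (h₀.conjRot a).exists_le_deriv
  obtain ⟨u, hu0, hu⟩ := exists_seq_of_step
    (S := {s : Equiv.Perm ℝ × ℝ // IsCircleDiffeoLift s.1 ∧ 0 < s.2})
    (fun n s s' => Step a (r + 1) n s.1.1 s'.1.1 s.1.2 s'.1.2)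
    (fun n s => by
      obtain ⟨H', τ', h1, h2, h3⟩ := exists_Step ha (r + 1) n s.2.1 s.2.2
      exact ⟨⟨(H', τ'), h1, h2⟩, h3⟩)
    ⟨(H₀, min (ε / 2) (c / 4)), h₀, by positivity⟩
  set H : ℕ → Equiv.Perm ℝ := fun n => (u n).1.1 with hH
  set τ : ℕ → ℝ := fun n => (u n).1.2 with hτ
  have H0 : H 0 = H₀ := by rw [hH]; simp only [hu0]
  have τ0 : τ 0 = min (ε / 2) (c / 4) := by rw [hτ]; simp only [hu0]
  have lH : ∀ n, IsCircleDiffeoLift (H n) := fun n => (u n).2.1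
  have pτ : ∀ n, 0 < τ n := fun n => (u n).2.2
  have hS : ∀ n, Step a (r + 1) n (H n) (H (n + 1)) (τ n) (τ (n + 1)) := hu
  have hτm : ∀ m n, τ (m + n) ≤ τ m * (1 / 2) ^ n := fun m n => by
    induction n with
    | zero => simp
    | succ n ih =>
      have := (hS (m + n)).2.1
      rw [pow_succ, ← add_assoc]; linarith
  have hgeo : ∀ m, Summable fun n => τ m * (1 / 2 : ℝ) ^ n := fun m =>
    summable_geometric_two.mul_left _
  have hsum : ∀ m, Summable fun n => τ (m + n) := fun m =>
    Summable.of_nonneg_of_le (fun n => (pτ _).le) (hτm m) (hgeo m)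
  have htsum : ∀ m, ∑' n, τ (m + n) ≤ 2 * τ m := fun m => by
    refine ((hsum m).tsum_le_tsum (hτm m) (hgeo m)).trans ?_
    rw [tsum_mul_left, tsum_geometric_two, mul_comm]
  set D : ℕ → ℝ → ℝ := fun n x => conjRot (H (n + 1)) a x - conjRot (H n) a x with hD
  have sD : ∀ n, Sm (D n) := fun n => ((lH _).conjRot a).sm.sub ((lH _).conjRot a).sm
  have hDJ : ∀ n x, JB (r + 1 + n) (τ n) (D n) x := fun n x => (hS n).1 x
  have hm := fun m => sm_tsum (D := fun n => D (m + n)) (r := r + 1 + m) (τ := fun n => τ (m + n))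
    (fun n => sD _) (fun n x => by rw [add_assoc]; exact hDJ _ x) (hsum m)
  set f : ℝ → ℝ := fun x => conjRot (H 0) a x + ∑' n, D n x with hf
  have hDs : ∀ x, Summable fun n => D n x := fun x =>
    Summable.of_norm_bounded (by simpa using hsum 0) fun n => (hDJ n x).apply
  have hfm : ∀ m x, f x - conjRot (H m) a x = ∑' n, D (m + n) x := fun m x => by
    have h1 := (hDs x).sum_add_tsum_nat_add m
    have h2 := Finset.sum_range_sub (fun n => conjRot (H n) a x) m
    simp only [hf]
    rw [← h1]
    simp only [hD] at h2 ⊢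
    rw [h2]
    simp only [add_comm m]
    ring
  have sf : Sm f := by
    have := (hm 0).1
    simp only [zero_add] at this
    exact ((lH 0).conjRot a).sm.add this
  have hclose : ∀ m x, JB (r + 1 + m) (2 * τ m) (fun x => f x - conjRot (H m) a x) x :=
    fun m x => by
      have := ((hm m).2 x).mono le_rfl (htsum m)
      rwa [← funext (hfm m)] at this
  have hd : ∀ m x, |deriv f x - deriv (conjRot (H m) a) x| ≤ 2 * τ m := fun m x => by
    have := hclose m x 1 (by omega)
    rwa [iteratedDeriv_one, ((sf.hasDerivAt x).fun_sub
      (((lH m).conjRot a).sm.hasDerivAt x)).deriv] at this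
  refine ⟨f, H, τ, ⟨sf, fun x => ?_, fun x => ?_⟩, fun x => ?_, lH, ?_, hS,
    fun n x => ⟨(hclose n x).apply, hd n x⟩⟩
  · have hp : ∀ n, D n (x + 1) = D n x := fun n => by
      simp only [hD]; rw [((lH _).conjRot a).add_one, ((lH _).conjRot a).add_one]; ring
    simp only [hf, hp]
    rw [((lH _).conjRot a).add_one]; ring
  · have h1 := (abs_le.1 (hd 0 x)).1
    have h2 := hcF x
    rw [H0, τ0] at h1
    have := min_le_right (ε / 2) (c / 4)
    linarith
  · have := hclose 0 x
    rw [H0, τ0] at this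
    exact this.mono (by omega) (by linarith [min_le_left (ε / 2) (c / 4)])
  · have := (hsum 0).tendsto_atTop_zero
    simpa using this

lemma IsCircleDiffeoLift.abs_sub_sub_le {H : ℝ → ℝ} (hH : IsCircleDiffeoLift H) (x : ℝ) :
    |H x - x - H 0| ≤ 1 := by
  have h1 := hH.add_int (Int.fract x) ⌊x⌋
  rw [Int.fract_add_floor] at h1
  have h2 := hH.strictMono.monotone (Int.fract_nonneg x)
  have h3 := hH.strictMono.monotone (Int.fract_lt_one x).le
  have h4 := hH.add_one 0
  rw [zero_add] at h4
  have h5 := Int.fract_add_floor x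
  have h6 := Int.fract_nonneg x
  have h7 := (Int.fract_lt_one x).le
  rw [abs_le]; constructor <;> linarith

lemma conjRot_iterate_zero {H : Equiv.Perm ℝ} (hH : IsCircleDiffeoLift H) (a : ℝ) (N : ℕ) :
    |(conjRot H a)^[N] 0 - N * a| ≤ 1 := by
  have h1 := hH.abs_sub_sub_le ((conjRot H a)^[N] 0)
  rw [apply_conjRot_iterate] at h1
  rw [abs_le] at h1 ⊢
  constructor <;> linarith

lemma tendsto_iterate_div {f : ℝ → ℝ} {a C : ℝ} (h : ∀ N : ℕ, |f^[N] 0 - N * a| ≤ C) :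
    Tendsto (fun n : ℕ => f^[n] 0 / (n : ℝ)) atTop (nhds a) := by
  rw [tendsto_iff_norm_sub_tendsto_zero]
  refine squeeze_zero' (.of_forall fun _ => norm_nonneg _) ?_
    (tendsto_const_div_atTop_nhds_zero_nat C)
  filter_upwards [eventually_gt_atTop 0] with n hn
  have hn0 : (0 : ℝ) < n := by exact_mod_cast hn
  rw [show f^[n] 0 / (n : ℝ) - a = (f^[n] 0 - n * a) / n by field_simp, Real.norm_eq_abs, abs_div,
    abs_of_pos hn0]
  gcongr
  exact h n

lemma tendsto_iterate_div_of_close {f : ℝ → ℝ} (hf : IsCircleDiffeoLift f) {a : ℝ}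
    {H : ℕ → Equiv.Perm ℝ} (hH : ∀ n, IsCircleDiffeoLift (H n)) {τ : ℕ → ℝ}
    (hτ : Tendsto τ atTop (nhds 0)) (hc : ∀ n x, |f x - conjRot (H n) a x| ≤ 2 * τ n) :
    Tendsto (fun n : ℕ => f^[n] 0 / (n : ℝ)) atTop (nhds a) := by
  refine tendsto_iterate_div (C := 2) fun N => ?_
  obtain ⟨η, hη, h⟩ := exists_iterate_close hf N one_pos
  have hτ2 : ∀ᶠ n in atTop, τ n < η / 2 := hτ.eventually (gt_mem_nhds (by positivity))
  obtain ⟨n, hn⟩ := hτ2.exists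
  have h1 := h (conjRot (H n) a) (fun x => by
    rw [abs_sub_comm]; exact (hc n x).trans (by linarith)) 0
  have h2 := conjRot_iterate_zero (hH n) a N
  rw [abs_le] at h1 h2 ⊢
  constructor <;> linarith

lemma Liouville.add_int {α : ℝ} (h : Liouville α) (k : ℤ) : Liouville (α + k) :=
  forall_liouvilleWith_iff.1 fun p => (forall_liouvilleWith_iff.2 h p).add_int k

lemma volume_eq_zero_of_periodic {N : Set ℝ} (hN : ∀ x, x + 1 ∈ N ↔ x ∈ N)
    (h0 : volume (N ∩ Set.Ioc 0 1) = 0) : volume N = 0 := by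
  have hk : ∀ (k : ℤ) (x : ℝ), x + k ∈ N ↔ x ∈ N := fun k x => by
    have hp : Function.Periodic (· ∈ N) (1 : ℝ) := fun x => propext (hN x)
    have := hp.int_mul k x
    rw [mul_one] at this
    exact iff_of_eq this
  have h1 : N ⊆ ⋃ k : ℤ, (fun x : ℝ => x + k) ⁻¹' (N ∩ Set.Ioc 0 1) := fun x hx => by
    have : x ∈ ⋃ k : ℤ, Set.Ioc (k : ℝ) (k + 1) := by rw [iUnion_Ioc_intCast]; trivial
    obtain ⟨k, hk1⟩ := Set.mem_iUnion.1 this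
    refine Set.mem_iUnion.2 ⟨-k, (hk _ _).2 hx, ?_, ?_⟩ <;> push_cast <;>
      linarith [hk1.1, hk1.2]
  refine measure_mono_null h1 (measure_iUnion_null fun k => ?_)
  rw [measure_preimage_add_right, h0]

lemma ae_eventually_notMem_of_periodic {E : ℕ → Set ℝ} (hper : ∀ n x, x + 1 ∈ E n ↔ x ∈ E n)
    (hvol : ∀ n, volume (E n ∩ Set.Ioc 0 1) ≤ ENNReal.ofReal ((1 / 2) ^ n)) :
    ∀ᵐ x, ∀ᶠ n in atTop, x ∉ E n := by
  have hsum : ∑' n, volume (E n ∩ Set.Ioc 0 1) ≠ ⊤ := by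
    refine ne_top_of_le_ne_top ?_ (ENNReal.tsum_le_tsum hvol)
    rw [← ENNReal.ofReal_tsum_of_nonneg (fun n => by positivity) summable_geometric_two]
    exact ENNReal.ofReal_ne_top
  rw [ae_iff]
  refine volume_eq_zero_of_periodic (fun x => by simp [hper]) ?_
  refine measure_mono_null (fun x hx => ?_) (measure_setOfPred_frequently_eq_zero hsum)
  have h2 : ∃ᶠ n in atTop, x ∈ E n := by simpa [Filter.Frequently] using hx.1
  exact h2.mono fun n hn => ⟨hn, hx.2⟩

lemma IsCircleDiffeoLift.ae_comp {f : ℝ → ℝ} (hf : IsCircleDiffeoLift f) {p : ℝ → Prop}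
    (hp : ∀ᵐ x, p x) : ∀ᵐ x, p (f x) := by
  rw [ae_iff] at hp ⊢
  have h := addHaar_image_eq_zero_of_differentiableOn_of_addHaar_eq_zero (μ := volume)
    (f := ⇑hf.toPerm⁻¹) ((inv hf).sm.differentiable'.differentiableOn) hp
  exact measure_mono_null (fun x hx =>
    (Set.mem_image _ _ _).2 ⟨f x, hx, hf.toPerm.symm_apply_apply x⟩) h

lemma deriv_conjRot {H : Equiv.Perm ℝ} (hH : IsCircleDiffeoLift H) (a x : ℝ) :
    deriv H (conjRot H a x) * deriv (conjRot H a) x = deriv H x := by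
  have h1 : HasDerivAt (fun x => H (conjRot H a x)) _ x :=
    (hH.sm.hasDerivAt _).comp x ((hH.conjRot a).sm.hasDerivAt x)
  rw [← h1.deriv]
  simp only [apply_conjRot, deriv_add_const]

/-- A periodic positive density on the line which is invariant under the limit map. -/
lemma exists_density {f : ℝ → ℝ} (hf : IsCircleDiffeoLift f) {a : ℝ} {r : ℕ}
    {H : ℕ → Equiv.Perm ℝ} (hH : ∀ n, IsCircleDiffeoLift (H n)) {τ : ℕ → ℝ}
    (hτ : Tendsto τ atTop (nhds 0)) (hS : ∀ n, Step a r n (H n) (H (n + 1)) (τ n) (τ (n + 1)))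
    (hc : ∀ n x, |f x - conjRot (H n) a x| ≤ 2 * τ n ∧
        |deriv f x - deriv (conjRot (H n) a) x| ≤ 2 * τ n) :
    ∃ φ : ℝ → ℝ, Measurable φ ∧ (∀ x, φ (x + 1) = φ x) ∧ (∀ x, 0 < φ x) ∧
      ∀ᵐ x, φ (f x) * deriv f x = φ x := by
  choose hJ hτ2 hmod E hEm hEp hEv hEd hEi using hS
  have hBC := ae_eventually_notMem_of_periodic hEp hEv
  set ψ : ℕ → ℝ → ℝ := fun n x => 2 ^ n * deriv (H n) x with hψ
  have hψE : ∀ n, ∀ x ∉ E n, ψ (n + 1) x = ψ n x := fun n x hx => by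
    simp only [hψ]; rw [hEd n x hx, pow_succ]; ring
  set S : Set ℝ := {x | ∀ᶠ n in atTop, x ∉ E n} with hSd
  have hSp : ∀ x, x + 1 ∈ S ↔ x ∈ S := fun x => by simp [hSd, hEp]
  have hSm : MeasurableSet S := by
    have : S = ⋃ N, ⋂ n, ⋂ (_ : N ≤ n), (E n)ᶜ := by
      ext x; simp [hSd, eventually_atTop]
    rw [this]
    exact .iUnion fun N => .iInter fun n => .iInter fun _ => (hEm n).compl
  have hex : ∀ x, ∃ y, 0 < y ∧ (x ∈ S → ∀ᶠ n in atTop, ψ n x = y) ∧ (x ∉ S → y = 1) := fun x => by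
    by_cases hx : x ∈ S
    · obtain ⟨N, hN⟩ := eventually_atTop.1 hx
      refine ⟨ψ N x, mul_pos (by positivity) ((hH N).deriv_pos x), fun _ => ?_, fun h => (h hx).elim⟩
      filter_upwards [eventually_ge_atTop N] with n hn
      induction n, hn using Nat.le_induction with
      | base => rfl
      | succ n hn ih => rw [hψE n x (hN n hn), ih]
    · exact ⟨1, one_pos, fun h => (hx h).elim, fun _ => rfl⟩
  choose φ φ0 hφ hφ1 using hex
  refine ⟨φ, ?_, fun x => ?_, φ0, ?_⟩
  · classical
    refine measurable_of_tendsto_metrizable (f := fun n => S.piecewise (ψ n) fun _ => 1)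
      (fun n => Measurable.piecewise hSm
        ((hH n).sm.deriv.continuous.measurable.const_mul _) measurable_const) ?_
    refine tendsto_pi_nhds.2 fun x => ?_
    by_cases hx : x ∈ S
    · simp only [Set.piecewise_eq_of_mem _ _ _ hx]
      exact tendsto_const_nhds.congr' ((hφ x hx).mono fun n hn => hn.symm)
    · simp only [Set.piecewise_eq_of_notMem _ _ _ hx, hφ1 x hx]
      exact tendsto_const_nhds
  · by_cases hx : x ∈ S
    · obtain ⟨n, h1, h2⟩ := ((hφ x hx).and (hφ (x + 1) ((hSp x).2 hx))).exists
      rw [← h1, ← h2]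
      simp only [hψ]
      rw [(hH n).deriv_periodic]
    · rw [hφ1 x hx, hφ1 _ (fun h => hx ((hSp x).1 h))]
  · filter_upwards [hBC, hf.ae_comp hBC] with x hx hfx
    have t1 : Tendsto (fun n => ψ (n + 1) (conjRot (H (n + 1)) a x)) atTop (nhds (φ (f x))) := by
      have e1 : ∀ᶠ n in atTop, ‖ψ (n + 1) (conjRot (H (n + 1)) a x) - φ (f x)‖ ≤ (1 / 2 : ℝ) ^ n := by
        filter_upwards [(tendsto_add_atTop_nat 1).eventually (hφ _ hfx)] with n hn
        rw [← hn, Real.norm_eq_abs, abs_sub_comm]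
        exact hmod n _ _ (hc (n + 1) x).1
      rw [tendsto_iff_norm_sub_tendsto_zero]
      exact squeeze_zero' (.of_forall fun _ => norm_nonneg _) e1
        (tendsto_pow_atTop_nhds_zero_of_lt_one (by norm_num) (by norm_num))
    have t2 : Tendsto (fun n => deriv (conjRot (H (n + 1)) a) x) atTop (nhds (deriv f x)) := by
      rw [tendsto_iff_norm_sub_tendsto_zero]
      refine squeeze_zero (fun _ => norm_nonneg _) (fun n => ?_)
        (by simpa using ((tendsto_add_atTop_iff_nat 1).2 hτ).const_mul 2)
      rw [Real.norm_eq_abs, abs_sub_comm]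
      exact (hc (n + 1) x).2
    refine tendsto_nhds_unique (t1.mul t2) (tendsto_const_nhds.congr' ?_)
    filter_upwards [(tendsto_add_atTop_nat 1).eventually (hφ _ hx)] with n hn
    rw [← hn]
    simp only [hψ]
    rw [mul_assoc, deriv_conjRot (hH _)]

lemma exists_measurable_lift {X : Type*} [MeasurableSpace X] {φ : ℝ → X} (hφ : Measurable φ)
    (hper : ∀ x, φ (x + 1) = φ x) :
    ∃ Φ : UnitAddCircle → X, Measurable Φ ∧ ∀ x : ℝ, Φ x = φ x := by
  have hp : Function.Periodic φ 1 := hper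
  have h : (hp.lift : UnitAddCircle → X) = fun c => φ (AddCircle.measurableEquivIoc 1 0 c) := by
    ext c
    conv_lhs => rw [← AddCircle.coe_equivIoc (p := (1 : ℝ)) (a := 0) (y := c)]
    rw [hp.lift_coe]; rfl
  refine ⟨hp.lift, ?_, fun x => hp.lift_coe x⟩
  rw [h]
  exact hφ.comp (measurable_subtype_coe.comp (AddCircle.measurableEquivIoc 1 0).measurable)

lemma exists_circle_map {f : ℝ → ℝ} (hf : IsCircleDiffeoLift f) :
    ∃ F : UnitAddCircle → UnitAddCircle, Measurable F ∧ ∀ x : ℝ, F x = ↑(f x) :=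
  exists_measurable_lift (φ := fun x => (f x : UnitAddCircle))
    (AddCircle.measurable_mk'.comp hf.sm.continuous.measurable)
    fun x => by simp [hf.add_one]

/-- An invariant density on the line induces an invariant measure on the circle. -/
lemma exists_equivalent_invariant {f : ℝ → ℝ} (hf : IsCircleDiffeoLift f)
    {F : UnitAddCircle → UnitAddCircle} (hF : Measurable F) (hFf : ∀ x : ℝ, F x = ↑(f x))
    {φ : ℝ → ℝ} (hφ : Measurable φ) (hper : ∀ x, φ (x + 1) = φ x) (hpos : ∀ x, 0 < φ x)
    (hinv : ∀ᵐ x, φ (f x) * deriv f x = φ x) :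
    ∃ μ : Measure UnitAddCircle, SigmaFinite μ ∧ Measure.map F μ = μ ∧ μ ≪ volume ∧
      volume ≪ μ := by
  obtain ⟨Φ, hΦ, hΦφ⟩ := exists_measurable_lift hφ hper
  have hΦpos : ∀ c, 0 < Φ c := fun c => by
    induction c using QuotientAddGroup.induction_on with
    | H x => exact (hΦφ x).symm ▸ hpos x
  refine ⟨volume.withDensity fun c => ENNReal.ofReal (Φ c), SigmaFinite.withDensity_ofReal _,
    ?_, withDensity_absolutelyContinuous _ _, withDensity_absolutelyContinuous'
      hΦ.ennreal_ofReal.aemeasurable (.of_forall fun c => (ENNReal.ofReal_pos.2 (hΦpos c)).ne')⟩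
  ext A hA
  set g : ℝ → ENNReal := fun y =>
    A.indicator (fun c => ENNReal.ofReal (Φ c)) (y : UnitAddCircle) with hg
  rw [Measure.map_apply hF hA, withDensity_apply _ (hF hA), withDensity_apply _ hA,
    ← lintegral_indicator (hF hA), ← lintegral_indicator hA,
    ← AddCircle.lintegral_preimage 1 0, ← AddCircle.lintegral_preimage 1 (f 0), zero_add]
  have himg : f '' Set.Ioc 0 1 = Set.Ioc (f 0) (f 0 + 1) := by
    have := (hf.strictMono.orderIsoOfSurjective f hf.surjective).image_Ioc 0 1
    have h1 := hf.add_one 0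
    rw [zero_add] at h1
    rw [← h1]
    exact this
  rw [← himg, lintegral_image_eq_lintegral_abs_deriv_mul measurableSet_Ioc
    (fun x _ => (hf.sm.hasDerivAt x).hasDerivWithinAt) hf.strictMono.injective.injOn]
  refine lintegral_congr_ae (ae_restrict_of_ae ?_)
  filter_upwards [hinv] with x hx
  by_cases h : (f x : UnitAddCircle) ∈ A
  · rw [Set.indicator_of_mem (by rwa [Set.mem_preimage, hFf]), Set.indicator_of_mem h, hΦφ, hΦφ,
      ← ENNReal.ofReal_mul (abs_nonneg _), abs_of_pos (hf.deriv_pos x), mul_comm, hx]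
  · rw [Set.indicator_of_notMem (by rwa [Set.mem_preimage, hFf]), Set.indicator_of_notMem h,
      mul_zero]

/-- A circle map for which arbitrarily small sets cover the circle together with one of their
preimages has no finite invariant measure equivalent to Lebesgue measure. -/
lemma no_finite_invariant {f : ℝ → ℝ} {F : UnitAddCircle → UnitAddCircle} (hF : Measurable F)
    (hFf : ∀ x : ℝ, F x = ↑(f x)) {E : ℕ → Set ℝ} (hE : ∀ n, MeasurableSet (E n))
    (hper : ∀ n x, x + 1 ∈ E n ↔ x ∈ E n)
    (hvol : ∀ n, volume (E n ∩ Set.Ioc 0 1) ≤ ENNReal.ofReal ((1 / 2) ^ n))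
    (hcov : ∀ n, ∃ i : ℕ, ∀ x, x ∈ E n ∨ f^[i] x ∈ E n) :
    ¬ ∃ ν : Measure UnitAddCircle, IsFiniteMeasure ν ∧ Measure.map F ν = ν ∧ ν ≪ volume ∧
      volume ≪ ν := by
  rintro ⟨ν, hν, hinv, h1, h2⟩
  have hlift : ∀ n, ∃ B : Set UnitAddCircle, MeasurableSet B ∧ ∀ x : ℝ, (x : UnitAddCircle) ∈ B ↔
      x ∈ E n := fun n => by
    obtain ⟨Φ, hΦ, hΦE⟩ := exists_measurable_lift (φ := fun x => x ∈ E n)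
      (measurable_mem.2 (hE n)) fun x => propext (hper n x)
    exact ⟨{c | Φ c}, measurableSet_setOfPred.2 hΦ, fun x => iff_of_eq (hΦE x)⟩
  choose B hB hBE using hlift
  have hBv : ∀ n, volume (B n) ≤ ENNReal.ofReal ((1 / 2) ^ n) := fun n => by
    rw [AddCircle.add_projection_respects_measure 1 0 (hB n), zero_add]
    convert hvol n using 4
    ext x; exact hBE n x
  have hsum : ∑' n, volume (B n) ≠ ⊤ := by
    refine ne_top_of_le_ne_top ?_ (ENNReal.tsum_le_tsum hBv)
    rw [← ENNReal.ofReal_tsum_of_nonneg (fun n => by positivity) summable_geometric_two]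
    exact ENNReal.ofReal_ne_top
  have hlim : Tendsto (fun n => ν (B n)) atTop (nhds 0) := by
    rw [← measure_empty (μ := ν)]
    refine tendsto_measure_of_ae_tendsto_indicator_of_isFiniteMeasure _ .empty hB ?_
    refine h1.ae_le ?_
    filter_upwards [ae_eventually_notMem hsum] with c hc
    exact hc.mono fun n hn => by simp [hn]
  have hle : ∀ n, ν Set.univ ≤ ν (B n) + ν (B n) := fun n => by
    obtain ⟨i, hi⟩ := hcov n
    have hmp : MeasurePreserving F ν ν := ⟨hF, hinv⟩
    have hiter : ∀ (i : ℕ) (x : ℝ), F^[i] x = ↑(f^[i] x) := fun i x => by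
      induction i with
      | zero => rfl
      | succ i ih => rw [Function.iterate_succ_apply', Function.iterate_succ_apply', ih, hFf]
    have hu : Set.univ ⊆ B n ∪ F^[i] ⁻¹' B n := fun c _ => by
      induction c using QuotientAddGroup.induction_on with
      | H x =>
        refine (hi x).imp (hBE n x).2 fun h => ?_
        rw [Set.mem_preimage]
        exact (hiter i x).symm ▸ (hBE n _).2 h
    calc ν Set.univ ≤ ν (B n ∪ F^[i] ⁻¹' B n) := measure_mono hu
      _ ≤ ν (B n) + ν (F^[i] ⁻¹' B n) := measure_union_le _ _
      _ = ν (B n) + ν (B n) := by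
        rw [(hmp.iterate i).measure_preimage (hB n).nullMeasurableSet]
  have h0 : ν Set.univ = 0 := by
    have := ge_of_tendsto' (hlim.add hlim) hle
    simpa using this
  have := h2 h0
  simp at this

lemma exists_near_conjRot {g : ℝ → ℝ} (hg : IsCircleDiffeoLift g) {a : ℝ} (ha : Liouville a)
    (hga : Tendsto (fun n : ℕ => g^[n] 0 / (n : ℝ)) atTop (nhds a)) (r : ℕ) {ε : ℝ} (hε : 0 < ε) :
    ∃ (f : ℝ → ℝ) (H : ℕ → Equiv.Perm ℝ) (τ : ℕ → ℝ), IsCircleDiffeoLift f ∧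
      liftDist r f g < ε ∧ (∀ n, IsCircleDiffeoLift (H n)) ∧
      Tendsto τ atTop (nhds 0) ∧ (∀ n, Step a (r + 2) n (H n) (H (n + 1)) (τ n) (τ (n + 1))) ∧
      ∀ n x, |f x - conjRot (H n) a x| ≤ 2 * τ n ∧
        |deriv f x - deriv (conjRot (H n) a) x| ≤ 2 * τ n := by
  obtain ⟨δ, hδ, hinv⟩ := inv_close hg.toPerm hg r (ε / 2) (by positivity)
  have hη : 0 < min δ (ε / 2) / 2 := by positivity
  obtain ⟨H₀, lH₀, h₀⟩ := exists_conj_near hg.toPerm hg a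
    (by simpa [← Equiv.Perm.iterate_eq_pow] using hga) ha (r + 1) hη
  obtain ⟨f, H, τ, lf, hf, lH, hτ, hS, hc⟩ := exists_limit ha (r + 1) lH₀ hη
  have hfg : ∀ x, JB (r + 1) (min δ (ε / 2)) (fun x => f x - g x) x := fun x => by
    have s1 : Sm fun x => f x - conjRot H₀ a x := lf.sm.sub (lH₀.conjRot a).sm
    have s2 : Sm fun x => conjRot H₀ a x - g x := (lH₀.conjRot a).sm.sub hg.sm
    have h := JB.add s1 s2 (hf x) (h₀ x)
    simpa [conjRot_apply] using h
  refine ⟨f, H, τ, lf, ?_, lH, hτ, hS, hc⟩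
  have h1 : CrNorm r (fun x => f x - g x) ≤ ε / 2 :=
    CrNorm_le fun x => (hfg x).mono (Nat.le_succ r) (min_le_right _ _)
  have h2 : CrNorm r (fun x => Function.invFun f x - Function.invFun g x) ≤ ε / 2 := by
    rw [lf.invFun_eq, hg.invFun_eq]
    exact CrNorm_le (hinv lf.toPerm lf fun x => (hfg x).mono le_rfl (min_le_left _ _))
  exact (max_le h1 h2).trans_lt (by linarith)

/-- For a Liouville number `α ∈ (0,1)`, type `II_∞` diffeomorphisms are `C^∞`-dense in
the set of smooth circle diffeomorphisms with rotation number `α`. -/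
theorem stmt_1 (α : ℝ) (hα0 : 0 < α) (hα1 : α < 1) (hL : Liouville α)
    (g : ℝ → ℝ) (hg : IsCircleDiffeoLift g) (hρg : HasRotationNumber g α)
    (r : ℕ) (ε : ℝ) (hε : 0 < ε) :
    ∃ f : ℝ → ℝ, IsCircleDiffeoLift f ∧ HasRotationNumber f α ∧
      liftDist r f g < ε ∧
      ∃ F : UnitAddCircle → UnitAddCircle, Measurable F ∧
        (∀ x : ℝ, F ↑x = ↑(f x)) ∧
        (∃ μ : Measure UnitAddCircle, SigmaFinite μ ∧ μ Set.univ = ⊤ ∧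
          Measure.map F μ = μ ∧ μ ≪ volume ∧ volume ≪ μ) ∧
        ¬ ∃ ν : Measure UnitAddCircle, IsFiniteMeasure ν ∧
          Measure.map F ν = ν ∧ ν ≪ volume ∧ volume ≪ ν := by
  obtain ⟨k, hk⟩ := hρg
  obtain ⟨f, H, τ, lf, hfg, lH, hτ, hS, hc⟩ := exists_near_conjRot hg (hL.add_int k) hk r hε
  obtain ⟨F, hF, hFf⟩ := exists_circle_map lf
  obtain ⟨φ, hφ, hper, hpos, hinv⟩ := exists_density lf lH hτ hS hc
  obtain ⟨μ, hμ, h1, h2, h3⟩ := exists_equivalent_invariant lf hF hFf hφ hper hpos hinv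
  choose _ _ _ E hE hEp hEv _ hEi using hS
  have hno := no_finite_invariant hF hFf hE hEp hEv fun n => by
    obtain ⟨i, hi⟩ := hEi n
    exact ⟨i, hi f fun x => (hc (n + 1) x).1⟩
  refine ⟨f, lf, ⟨k, tendsto_iterate_div_of_close lf lH hτ fun n x => (hc n x).1⟩, hfg, F, hF, hFf,
    ⟨μ, hμ, ?_, h1, h2, h3⟩, hno⟩
  by_contra h
  exact hno ⟨μ, ⟨lt_top_iff_ne_top.2 h⟩, h1, h2, h3⟩
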